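/- Let 𝚫 ∈ Ã. Then there exists a gentle quiver 𝚫' without branch arrows, without branch triangles, and without free relations, which is reflection-equivalent to 𝚫 (i.e. obtained from 𝚫 by a finite sequence of reflections and coreflections). -/

import Mathlib

/-! Common formalization infrastructure for gentle quivers (Bobinski–Buan,
    "Derived equivalence classification of gentle cluster tilted algebras"). -/

/-- A (finite) quiver with (length-two, monomial) relations.  Vertices and
arrows are natural numbers; `V` and `A` are the finite sets of vertices and
arrows, `src`/`tgt` give the start and terminus of each arrow, and `rel` is the
set of relations, a relation `(a, b)` standing for the length-two path
`a·b` (so `src a = tgt b`). -/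
structure QuivRel where
  V : Finset ℕ
  A : Finset ℕ
  src : ℕ → ℕ
  tgt : ℕ → ℕ
  rel : Finset (ℕ × ℕ)

namespace GentleQuiv

/-- Two vertices are adjacent if some arrow joins them (in either direction). -/
def Adj (Q : QuivRel) (x y : ℕ) : Prop :=
  ∃ a ∈ Q.A, (Q.src a = x ∧ Q.tgt a = y) ∨ (Q.src a = y ∧ Q.tgt a = x)

/-- A quiver is connected if any two of its vertices are joined by a walk. -/
def Connected (Q : QuivRel) : Prop :=
  ∀ x ∈ Q.V, ∀ y ∈ Q.V, Relation.ReflTransGen (Adj Q) x y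

/-- `l = [α₁, …, αₙ]` is a (nonempty) path in the quiver: consecutive arrows
compose, i.e. `s αᵢ = t αᵢ₊₁`. -/
def IsPathList (Q : QuivRel) (l : List ℕ) : Prop :=
  l ≠ [] ∧ (∀ a ∈ l, a ∈ Q.A) ∧ l.Chain' (fun a b => Q.src a = Q.tgt b)

/-- The path `l` contains a subpath (two consecutive arrows) lying in `R`. -/
def HasRelSubpath (Q : QuivRel) (l : List ℕ) : Prop :=
  ∃ a b, (a, b) ∈ Q.rel ∧ [a, b] <:+: l

/-- Gentle quiver: connected, relations are composable pairs of arrows, at most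
two arrows in/out of every vertex, the usual gentleness conditions on
relations, and a global bound forcing finite dimensionality. -/
def IsGentle (Q : QuivRel) : Prop :=
  Q.V.Nonempty ∧
  (∀ a ∈ Q.A, Q.src a ∈ Q.V ∧ Q.tgt a ∈ Q.V) ∧
  Connected Q ∧
  (∀ ρ ∈ Q.rel, ρ.1 ∈ Q.A ∧ ρ.2 ∈ Q.A ∧ Q.src ρ.1 = Q.tgt ρ.2) ∧
  (∀ x, (Q.A.filter fun a => Q.src a = x).card ≤ 2) ∧
  (∀ x, (Q.A.filter fun a => Q.tgt a = x).card ≤ 2) ∧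
  (∀ a ∈ Q.A, (Q.A.filter fun b => Q.src b = Q.tgt a ∧ (b, a) ∉ Q.rel).card ≤ 1) ∧
  (∀ a ∈ Q.A, (Q.A.filter fun c => Q.tgt c = Q.src a ∧ (a, c) ∉ Q.rel).card ≤ 1) ∧
  (∀ a ∈ Q.A, (Q.A.filter fun b => (b, a) ∈ Q.rel).card ≤ 1) ∧
  (∀ a ∈ Q.A, (Q.A.filter fun c => (a, c) ∈ Q.rel).card ≤ 1) ∧
  (∃ n : ℕ, ∀ l : List ℕ, IsPathList Q l → l.length = n → HasRelSubpath Q l)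

/-- A choice of functions `σ, τ : Δ₁ → {±1}` as in Avella-Alaminos–Geiss. -/
structure SigmaTau (Q : QuivRel) where
  σ : ℕ → ℤ
  τ : ℕ → ℤ
  σ_pm : ∀ a ∈ Q.A, σ a = 1 ∨ σ a = -1
  τ_pm : ∀ a ∈ Q.A, τ a = 1 ∨ τ a = -1
  σ_src : ∀ a ∈ Q.A, ∀ b ∈ Q.A, a ≠ b → Q.src a = Q.src b → σ a = -σ b
  τ_tgt : ∀ a ∈ Q.A, ∀ b ∈ Q.A, a ≠ b → Q.tgt a = Q.tgt b → τ a = -τ b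
  rel_iff : ∀ a ∈ Q.A, ∀ b ∈ Q.A, Q.src a = Q.tgt b → ((a, b) ∈ Q.rel ↔ σ a = τ b)

/-- A thread: either a trivial path/antipath `1_{x,ε}` at a vertex `x` with a
sign `ε`, or a sequence of arrows of positive length. -/
inductive Thread where
  | triv (x : ℕ) (ε : ℤ) : Thread
  | arrows (l : List ℕ) : Thread
deriving DecidableEq

/-- Source of a thread. -/
def Thread.source (Q : QuivRel) : Thread → ℕ
  | .triv x _ => x
  | .arrows l => Q.src l.getLast!

/-- Target of a thread. -/
def Thread.target (Q : QuivRel) : Thread → ℕ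
  | .triv x _ => x
  | .arrows l => Q.tgt l.head!

/-- `σω` (for paths and antipaths alike; `σ 1_{x,ε} = ε = σ 1'_{x,ε}`). -/
def Thread.sigma {Q : QuivRel} (st : SigmaTau Q) : Thread → ℤ
  | .triv _ ε => ε
  | .arrows l => st.σ l.getLast!

/-- `τω` when `ω` is regarded as a path (`τ 1_{x,ε} = -ε`). -/
def Thread.tauPath {Q : QuivRel} (st : SigmaTau Q) : Thread → ℤ
  | .triv _ ε => -ε
  | .arrows l => st.τ l.head!

/-- `τω` when `ω` is regarded as an antipath (`τ 1'_{x,ε} = ε`). -/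
def Thread.tauAnti {Q : QuivRel} (st : SigmaTau Q) : Thread → ℤ
  | .triv _ ε => ε
  | .arrows l => st.τ l.head!

/-- Length of a thread. -/
def Thread.len : Thread → ℕ
  | .triv _ _ => 0
  | .arrows l => l.length

/-- A path in `𝚫` of positive length (no two consecutive arrows in `R`). -/
def IsPermList (Q : QuivRel) (l : List ℕ) : Prop :=
  IsPathList Q l ∧ l.Chain' (fun a b => (a, b) ∉ Q.rel)

/-- An antipath in `𝚫` of positive length (all consecutive pairs in `R`). -/
def IsAntiList (Q : QuivRel) (l : List ℕ) : Prop :=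
  l ≠ [] ∧ (∀ a ∈ l, a ∈ Q.A) ∧ l.Chain' (fun a b => (a, b) ∈ Q.rel)

/-- A thread is a path in `𝚫` (including trivial ones). -/
def IsPathThread (Q : QuivRel) : Thread → Prop
  | .triv x ε => x ∈ Q.V ∧ (ε = 1 ∨ ε = -1)
  | .arrows l => IsPermList Q l

/-- A thread is an antipath in `𝚫` (including trivial ones). -/
def IsAntiThread (Q : QuivRel) : Thread → Prop
  | .triv x ε => x ∈ Q.V ∧ (ε = 1 ∨ ε = -1)
  | .arrows l => IsAntiList Q l

/-- `w ∈ ℳ`: `w` is a maximal path of `𝚫`. -/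
def InM (Q : QuivRel) (st : SigmaTau Q) (w : Thread) : Prop :=
  IsPathThread Q w ∧
  (¬ ∃ a ∈ Q.A, Q.src a = w.target Q ∧ st.σ a = -(w.tauPath st)) ∧
  (¬ ∃ b ∈ Q.A, Q.tgt b = w.source Q ∧ st.τ b = -(w.sigma st))

/-- `w ∈ 𝒩`: `w` is a maximal antipath of `𝚫`. -/
def InN (Q : QuivRel) (st : SigmaTau Q) (w : Thread) : Prop :=
  IsAntiThread Q w ∧
  (¬ ∃ a ∈ Q.A, Q.src a = w.target Q ∧ st.σ a = w.tauAnti st) ∧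
  (¬ ∃ b ∈ Q.A, Q.tgt b = w.source Q ∧ st.τ b = w.sigma st)

/-- The graph of the bijection `Φ = φ ∘ ψ : 𝒩 → 𝒩`:  `PhiRel Q st w w'` holds
iff `w, w' ∈ 𝒩` and the maximal path `ψ w` (with `s(ψw) = sw`, `σ(ψw) = -σw`)
satisfies `t w' = t (ψ w)` and `τ w' = -τ(ψ w)`, i.e. `w' = φ (ψ w) = Φ w`. -/
def PhiRel (Q : QuivRel) (st : SigmaTau Q) (w w' : Thread) : Prop :=
  InN Q st w ∧ InN Q st w' ∧
  ∃ m : Thread, InM Q st m ∧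
    m.source Q = w.source Q ∧ m.sigma st = -(w.sigma st) ∧
    w'.target Q = m.target Q ∧ w'.tauAnti st = -(m.tauPath st)

/-- `O` is an orbit of the `ℤ`-action on `𝒩` induced by `Φ`. -/
def NOrbit (Q : QuivRel) (st : SigmaTau Q) (O : Set Thread) : Prop :=
  ∃ w, InN Q st w ∧ O = {w' | Relation.EqvGen (PhiRel Q st) w w'}

/-- `p(𝒪) = |𝒪|` for an orbit `𝒪 ∈ 𝒩/ℤ`. -/
noncomputable def pN (O : Set Thread) : ℕ := O.ncard

/-- `q(𝒪) = Σ_{ω ∈ 𝒪} ℓ(ω)` for an orbit `𝒪 ∈ 𝒩/ℤ`. -/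
noncomputable def qN (O : Set Thread) : ℕ := ∑ᶠ w ∈ O, Thread.len w

/-- `a ∈ 𝒞`: the arrow `a` occurs in no maximal antipath. -/
def InC (Q : QuivRel) (st : SigmaTau Q) (a : ℕ) : Prop :=
  a ∈ Q.A ∧ ¬ ∃ l : List ℕ, InN Q st (.arrows l) ∧ a ∈ l

/-- The graph of the bijection `Ψ : 𝒞 → 𝒞`. -/
def PsiRel (Q : QuivRel) (st : SigmaTau Q) (a b : ℕ) : Prop :=
  InC Q st a ∧ InC Q st b ∧ Q.tgt b = Q.src a ∧ st.τ b = st.σ a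

/-- `O` is an orbit of the `ℤ`-action on `𝒞` induced by `Ψ`. -/
def COrbit (Q : QuivRel) (st : SigmaTau Q) (O : Set ℕ) : Prop :=
  ∃ a, InC Q st a ∧ O = {b | Relation.EqvGen (PsiRel Q st) a b}

/-- The Avella-Alaminos–Geiss invariant `f_𝚫 : ℕ² → ℕ`:  `f_𝚫 (p,q)` counts the
orbits `𝒪 ∈ 𝒩/ℤ ⊔ 𝒞/ℤ` with `p(𝒪) = p` and `q(𝒪) = q`. -/
noncomputable def fInv (Q : QuivRel) (st : SigmaTau Q) : ℕ × ℕ → ℕ := fun pq =>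
  {O : Set Thread | NOrbit Q st O ∧ pN O = pq.1 ∧ qN O = pq.2}.ncard +
  {O : Set ℕ | COrbit Q st O ∧ pq.1 = 0 ∧ O.ncard = pq.2}.ncard

/-- `[p, q] : ℕ² → ℕ`, the characteristic function of `{(p, q)}`. -/
def charFn (p q : ℕ) : ℕ × ℕ → ℕ := fun pq => if pq = (p, q) then 1 else 0

/-- Tree type: `|Δ₀| = |Δ₁| + 1`. -/
def TreeType (Q : QuivRel) : Prop := Q.V.card = Q.A.card + 1

/-- Removing a set of arrows (keeping all vertices); relations containing a
removed arrow are discarded. -/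
def deleteArrows (Q : QuivRel) (S : Finset ℕ) : QuivRel where
  V := Q.V
  A := Q.A \ S
  src := Q.src
  tgt := Q.tgt
  rel := Q.rel.filter fun ρ => ρ.1 ∉ S ∧ ρ.2 ∉ S

/-- Branch arrow: removing it disconnects the quiver. -/
def BranchArrow (Q : QuivRel) (a : ℕ) : Prop :=
  a ∈ Q.A ∧ ¬ Connected (deleteArrows Q {a})

/-- Cycle arrow: removing it leaves the quiver connected. -/
def CycleArrow (Q : QuivRel) (a : ℕ) : Prop :=
  a ∈ Q.A ∧ Connected (deleteArrows Q {a})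

/-- Branch relation: a relation one of whose arrows is a branch arrow. -/
def BranchRel (Q : QuivRel) (ρ : ℕ × ℕ) : Prop :=
  ρ ∈ Q.rel ∧ (BranchArrow Q ρ.1 ∨ BranchArrow Q ρ.2)

/-- A relation `ρ = (α, β)` is isolated if the antipath `(α, β)` is a maximal
antipath, i.e. `ρ ∈ 𝒩`. -/
def Isolated (Q : QuivRel) (st : SigmaTau Q) (ρ : ℕ × ℕ) : Prop :=
  ρ ∈ Q.rel ∧ InN Q st (.arrows [ρ.1, ρ.2])

/-- `Q'` is obtained from `Q` by completing the relations from `R₀`, the new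
arrow attached to `ρ ∈ R₀` being `γ ρ`. -/
structure IsCompletion (Q : QuivRel) (R0 : Finset (ℕ × ℕ)) (γ : ℕ × ℕ → ℕ)
    (Q' : QuivRel) : Prop where
  subset : R0 ⊆ Q.rel
  fresh : ∀ ρ ∈ R0, γ ρ ∉ Q.A
  inj : ∀ ρ ∈ R0, ∀ ρ' ∈ R0, γ ρ = γ ρ' → ρ = ρ'
  V_eq : Q'.V = Q.V
  A_eq : Q'.A = Q.A ∪ R0.image γ
  src_old : ∀ a ∈ Q.A, Q'.src a = Q.src a
  tgt_old : ∀ a ∈ Q.A, Q'.tgt a = Q.tgt a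
  src_new : ∀ ρ ∈ R0, Q'.src (γ ρ) = Q.tgt ρ.1
  tgt_new : ∀ ρ ∈ R0, Q'.tgt (γ ρ) = Q.src ρ.2
  rel_eq : Q'.rel = Q.rel ∪ R0.image (fun ρ => (γ ρ, ρ.1)) ∪
      R0.image (fun ρ => (ρ.2, γ ρ))

/-- A 3-cycle: three pairwise distinct arrows forming an oriented cycle. -/
def Is3Cycle (Q : QuivRel) (a0 a1 a2 : ℕ) : Prop :=
  a0 ∈ Q.A ∧ a1 ∈ Q.A ∧ a2 ∈ Q.A ∧ a0 ≠ a1 ∧ a1 ≠ a2 ∧ a0 ≠ a2 ∧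
  Q.src a0 = Q.tgt a1 ∧ Q.src a1 = Q.tgt a2 ∧ Q.src a2 = Q.tgt a0

/-- A triangle: a 3-cycle all of whose three compositions are relations. -/
def IsTriangleTriple (Q : QuivRel) (a0 a1 a2 : ℕ) : Prop :=
  Is3Cycle Q a0 a1 a2 ∧ (a0, a1) ∈ Q.rel ∧ (a1, a2) ∈ Q.rel ∧ (a2, a0) ∈ Q.rel

/-- The (unordered) set of arrows of a triangle. -/
def TriangleSet (Q : QuivRel) (O : Finset ℕ) : Prop :=
  ∃ a0 a1 a2, O = {a0, a1, a2} ∧ IsTriangleTriple Q a0 a1 a2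

/-- Branch triangle: removing any two of its arrows disconnects the quiver. -/
def BranchTriangle (Q : QuivRel) (O : Finset ℕ) : Prop :=
  TriangleSet Q O ∧ ∀ S ⊆ O, S.card = 2 → ¬ Connected (deleteArrows Q S)

/-- Free relation: a relation neither of whose arrows lies in `𝒞`. -/
def FreeRel (Q : QuivRel) (st : SigmaTau Q) (ρ : ℕ × ℕ) : Prop :=
  ρ ∈ Q.rel ∧ ¬ InC Q st ρ.1 ∧ ¬ InC Q st ρ.2

/-- The class `𝒜`: gentle quivers with `f_𝚫 = m·[0,3] + [p+m+2, p]`. -/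
def ClassA (Q : QuivRel) (st : SigmaTau Q) : Prop :=
  IsGentle Q ∧ ∃ m p : ℕ, ∀ x, fInv Q st x = m * charFn 0 3 x + charFn (p + m + 2) p x

/-- The class `Ã`: gentle quivers with
`f_𝚫 = (m₁+m₂)·[0,3] + [p+m₁, p] + [q+m₂, q]`, `p+m₁ > 0`, `q+m₂ > 0`. -/
def ClassAtilde (Q : QuivRel) (st : SigmaTau Q) : Prop :=
  IsGentle Q ∧ ∃ m1 m2 p q : ℕ, 0 < p + m1 ∧ 0 < q + m2 ∧
    ∀ x, fInv Q st x =
      (m1 + m2) * charFn 0 3 x + charFn (p + m1) p x + charFn (q + m2) q x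

/-- Isomorphism of quivers with relations. -/
def IsoQR (Q Q' : QuivRel) : Prop :=
  ∃ fV fA : ℕ → ℕ,
    Set.BijOn fV ↑Q.V ↑Q'.V ∧ Set.BijOn fA ↑Q.A ↑Q'.A ∧
    (∀ a ∈ Q.A, Q'.src (fA a) = fV (Q.src a) ∧ Q'.tgt (fA a) = fV (Q.tgt a)) ∧
    (∀ a ∈ Q.A, ∀ b ∈ Q.A, ((a, b) ∈ Q.rel ↔ (fA a, fA b) ∈ Q'.rel))

/-- The quiver has no loops. -/
def NoLoops (Q : QuivRel) : Prop := ∀ a ∈ Q.A, Q.src a ≠ Q.tgt a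

/-- The reflection at `x` is defined: every arrow starting at `x` admits a
(necessarily unique) companion arrow ending at `x` not bound by a relation. -/
def CanReflect (Q : QuivRel) (x : ℕ) : Prop :=
  x ∈ Q.V ∧ ∀ a ∈ Q.A, Q.src a = x → ∃ b ∈ Q.A, Q.tgt b = x ∧ (a, b) ∉ Q.rel

/-- `Q'` is the reflection of the gentle loop-free quiver `Q` at the vertex
`x`, following Brenner–Butler tilting. -/
def IsReflection (Q : QuivRel) (x : ℕ) (Q' : QuivRel) : Prop :=
  IsGentle Q ∧ NoLoops Q ∧ CanReflect Q x ∧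
  Q'.V = Q.V ∧ Q'.A = Q.A ∧
  (∀ a ∈ Q.A, Q.tgt a = x → Q'.src a = x ∧ Q'.tgt a = Q.src a) ∧
  (∀ a ∈ Q.A, Q.src a = x →
    ∀ b ∈ Q.A, Q.tgt b = x → (a, b) ∉ Q.rel → Q'.src a = Q.src b) ∧
  (∀ a ∈ Q.A, Q.tgt a ≠ x → Q.src a ≠ x → Q'.src a = Q.src a) ∧
  (∀ a ∈ Q.A, Q.tgt a ≠ x →
    ((∃ b ∈ Q.A, Q.tgt b = x ∧ Q.src b = Q.tgt a ∧ (b, a) ∈ Q.rel) → Q'.tgt a = x) ∧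
    ((¬ ∃ b ∈ Q.A, Q.tgt b = x ∧ Q.src b = Q.tgt a ∧ (b, a) ∈ Q.rel) →
      Q'.tgt a = Q.tgt a)) ∧
  (∀ a b : ℕ, (a, b) ∈ Q'.rel ↔
    (((a, b) ∈ Q.rel ∧ Q.tgt a ≠ x ∧ Q.src a ≠ x) ∨
     (a ∈ Q.A ∧ b ∈ Q.A ∧ Q.src a = x ∧ Q.tgt b = x ∧ (a, b) ∉ Q.rel) ∨
     (a ∈ Q.A ∧ b ∈ Q.A ∧ Q.tgt a = x ∧
       ∃ c ∈ Q.A, c ≠ a ∧ Q.tgt c = x ∧ Q.src c = Q.tgt b ∧ (c, b) ∈ Q.rel)))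

/-- The opposite quiver with relations. -/
def opQR (Q : QuivRel) : QuivRel where
  V := Q.V
  A := Q.A
  src := Q.tgt
  tgt := Q.src
  rel := Q.rel.image fun ρ => (ρ.2, ρ.1)

/-- Coreflection: the dual of reflection. -/
def IsCoreflection (Q : QuivRel) (x : ℕ) (Q' : QuivRel) : Prop :=
  IsReflection (opQR Q) x (opQR Q')

/-- One step of reflection equivalence: a reflection, a coreflection, or an
isomorphism of quivers with relations. -/
def RefStep (Q Q' : QuivRel) : Prop :=
  (∃ x, IsReflection Q x Q') ∨ (∃ x, IsCoreflection Q x Q') ∨ IsoQR Q Q'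

/-- Reflection equivalence: a finite sequence of reflections/coreflections,
up to isomorphism of quivers with relations. -/
def RefEquiv : QuivRel → QuivRel → Prop := Relation.ReflTransGen RefStep

/-- A cyclic orientation of a `1`-cycle quiver without branch arrows (i.e. a
cycle): enumerations of the vertices and arrows by `ZMod n` such that the
`i`-th arrow joins the `i`-th and `(i+1)`-st vertices. -/
structure CyclicOrientation (Q : QuivRel) (n : ℕ) where
  ev : ZMod n → ℕ
  ea : ZMod n → ℕ
  ev_mem : ∀ i, ev i ∈ Q.V
  ea_mem : ∀ i, ea i ∈ Q.A
  ev_inj : Function.Injective ev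
  ea_inj : Function.Injective ea
  ev_surj : ∀ v ∈ Q.V, ∃ i, ev i = v
  ea_surj : ∀ a ∈ Q.A, ∃ i, ea i = a
  compat : ∀ i : ZMod n,
    (Q.src (ea i) = ev i ∧ Q.tgt (ea i) = ev (i + 1)) ∨
    (Q.src (ea i) = ev (i + 1) ∧ Q.tgt (ea i) = ev i)

/-- Clockwise arrow with respect to a cyclic orientation. -/
def Clockwise (Q : QuivRel) {n : ℕ} (co : CyclicOrientation Q n) (a : ℕ) : Prop :=
  a ∈ Q.A ∧ ∃ i : ZMod n, co.ea i = a ∧ Q.src a = co.ev i ∧ Q.tgt a = co.ev (i + 1)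

/-- Anticlockwise arrow with respect to a cyclic orientation. -/
def Anticlockwise (Q : QuivRel) {n : ℕ} (co : CyclicOrientation Q n) (a : ℕ) : Prop :=
  a ∈ Q.A ∧ ∃ i : ZMod n, co.ea i = a ∧ Q.src a = co.ev (i + 1) ∧ Q.tgt a = co.ev i

end GentleQuiv

namespace GentleQuiv
set_option linter.unusedSectionVars false
set_option linter.deprecated false
set_option linter.unusedVariables false

/-- Combinatorial model of a gentle quiver: half-vertices and gaps. -/
structure Mod (X : Type) where
  ι : X → X
  π : Equiv.Perm X
  node : X → X
  inv : ∀ e, ι (ι e) = e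
  fpf : ∀ e, π e ≠ e
  node_gap : ∀ e, ι (node e) = node e
  gap_node : ∀ e, ι e = e → node e = e
  node_step : ∀ e, node (π (ι e)) = node e
  acyc : ∀ S : Set X, (∀ e ∈ S, ι e ≠ e) → (∀ e ∈ S, π (ι e) ∈ S) → S = ∅
  conn : ∀ P : X → Prop, (∀ e, P e ↔ P (ι e)) →
    (∀ e, ι e ≠ e → ι (π e) ≠ π e → (P e ↔ P (π e))) →
    ∀ e e', ι e ≠ e → ι e' ≠ e' → P e → P e'

namespace Mod

variable {X : Type} [Fintype X] [DecidableEq X]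

theorem ext' {M M' : Mod X} (h1 : M.ι = M'.ι) (h2 : M.π = M'.π) (h3 : M.node = M'.node) :
    M = M' := by
  cases M; cases M'; simp_all

theorem rho_ne (M : Mod X) (e : X) : M.π (M.ι e) ≠ e := by
  by_cases he : M.ι e = e
  · rw [he]; exact M.fpf e
  · intro h
    have := M.acyc {e} (by simpa using he) (by simpa using h)
    simp at this

theorem gap_next (M : Mod X) {n : X} (h : M.ι n = n) : M.ι (M.π n) ≠ M.π n := by
  intro h2
  have h3 := M.node_step n
  rw [h, M.gap_node _ h2, M.gap_node _ h] at h3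
  exact M.fpf n h3

theorem gap_prev (M : Mod X) {n : X} (h : M.ι n = n) : M.ι (M.π.symm n) ≠ M.π.symm n := by
  intro h2
  have := M.gap_next h2
  simp at this
  exact this h

/-- The 4-cycle used in a slide. -/
def cyc (M : Mod X) (h : X) : Equiv.Perm X :=
  Equiv.swap (M.π.symm h) h * Equiv.swap h (M.π.symm (M.ι h)) *
    Equiv.swap (M.π.symm (M.ι h)) (M.ι h)

theorem distinct (M : Mod X) {h : X} (hh : M.ι h ≠ h) :
    M.π.symm h ≠ h ∧ M.π.symm (M.ι h) ≠ M.ι h ∧ M.π.symm h ≠ M.ι h ∧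
    M.π.symm (M.ι h) ≠ h ∧ M.π.symm h ≠ M.π.symm (M.ι h) := by
  refine ⟨?_, ?_, ?_, ?_, ?_⟩
  · intro e; rw [Equiv.symm_apply_eq] at e; exact M.fpf _ e.symm
  · intro e; rw [Equiv.symm_apply_eq] at e; exact M.fpf _ e.symm
  · intro e; rw [Equiv.symm_apply_eq] at e; exact M.rho_ne _ e.symm
  · intro e; rw [Equiv.symm_apply_eq] at e
    have := M.rho_ne (M.ι h); rw [M.inv] at this; exact this e.symm
  · intro e; exact hh (M.π.symm.injective e).symm

theorem cyc_y (M : Mod X) {h : X} (hh : M.ι h ≠ h) : M.cyc h (M.π.symm h) = h := by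
  obtain ⟨d1, d2, d3, d4, d5⟩ := M.distinct hh
  simp only [cyc, Equiv.Perm.mul_apply, Equiv.swap_apply_def]; grind
theorem cyc_h (M : Mod X) {h : X} (hh : M.ι h ≠ h) : M.cyc h h = M.π.symm (M.ι h) := by
  obtain ⟨d1, d2, d3, d4, d5⟩ := M.distinct hh
  simp only [cyc, Equiv.Perm.mul_apply, Equiv.swap_apply_def]; grind
theorem cyc_y' (M : Mod X) {h : X} (hh : M.ι h ≠ h) : M.cyc h (M.π.symm (M.ι h)) = M.ι h := by
  obtain ⟨d1, d2, d3, d4, d5⟩ := M.distinct hh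
  simp only [cyc, Equiv.Perm.mul_apply, Equiv.swap_apply_def]; grind
theorem cyc_h' (M : Mod X) {h : X} (hh : M.ι h ≠ h) : M.cyc h (M.ι h) = M.π.symm h := by
  obtain ⟨d1, d2, d3, d4, d5⟩ := M.distinct hh
  simp only [cyc, Equiv.Perm.mul_apply, Equiv.swap_apply_def]; grind
theorem cyc_else (M : Mod X) {h e : X} (h1 : e ≠ h) (h2 : e ≠ M.ι h)
    (h3 : e ≠ M.π.symm h) (h4 : e ≠ M.π.symm (M.ι h)) : M.cyc h e = e := by
  simp only [cyc, Equiv.Perm.mul_apply, Equiv.swap_apply_def]; grind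

/-- The permutation after a slide. -/
def slπ (M : Mod X) (h : X) : Equiv.Perm X := M.cyc h * M.π * (M.cyc h)⁻¹

theorem slπ_cyc (M : Mod X) (h e : X) : M.slπ h (M.cyc h e) = M.cyc h (M.π e) := by
  simp [slπ]

theorem slπ_h (M : Mod X) {h : X} (hh : M.ι h ≠ h) : M.slπ h h = M.π.symm (M.ι h) := by
  have := M.slπ_cyc h (M.π.symm h)
  rwa [M.cyc_y hh, Equiv.apply_symm_apply, M.cyc_h hh] at this
theorem slπ_h' (M : Mod X) {h : X} (hh : M.ι h ≠ h) : M.slπ h (M.ι h) = M.π.symm h := by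
  have := M.slπ_cyc h (M.π.symm (M.ι h))
  rwa [M.cyc_y' hh, Equiv.apply_symm_apply, M.cyc_h' hh] at this
theorem slπ_y (M : Mod X) {h : X} (hh : M.ι h ≠ h) :
    M.slπ h (M.π.symm h) = M.cyc h (M.π (M.ι h)) := by
  have := M.slπ_cyc h (M.ι h)
  rwa [M.cyc_h' hh] at this
theorem slπ_y' (M : Mod X) {h : X} (hh : M.ι h ≠ h) :
    M.slπ h (M.π.symm (M.ι h)) = M.cyc h (M.π h) := by
  have := M.slπ_cyc h h
  rwa [M.cyc_h hh] at this
theorem slπ_else (M : Mod X) {h e : X} (h1 : e ≠ h) (h2 : e ≠ M.ι h)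
    (h3 : e ≠ M.π.symm h) (h4 : e ≠ M.π.symm (M.ι h)) : M.slπ h e = M.cyc h (M.π e) := by
  have := M.slπ_cyc h e
  rwa [M.cyc_else h1 h2 h3 h4] at this

/-- The node map after a slide. -/
def slnode (M : Mod X) (h : X) (e : X) : X :=
  if e = h then M.node (M.π.symm h) else if e = M.ι h then M.node (M.π.symm (M.ι h))
  else M.node e

theorem slnode_cyc (M : Mod X) {h e : X} (hh : M.ι h ≠ h) (h1 : e ≠ h) (h2 : e ≠ M.ι h) :
    M.slnode h (M.cyc h e) = M.node e := by
  by_cases h3 : e = M.π.symm h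
  · subst h3; rw [M.cyc_y hh]; simp [slnode]
  by_cases h4 : e = M.π.symm (M.ι h)
  · subst h4; rw [M.cyc_y' hh]; simp [slnode, hh]
  rw [M.cyc_else h1 h2 h3 h4]; simp [slnode, h1, h2]

/-- Legality of a slide. -/
def Legal (M : Mod X) (h : X) : Prop :=
  (M.ι (M.π.symm h) = M.π.symm h → M.π (M.ι h) = M.π.symm h) ∧
  (M.ι (M.π.symm (M.ι h)) = M.π.symm (M.ι h) → M.π h = M.π.symm (M.ι h))

theorem pi_ne_h (M : Mod X) {h e : X} (he : e ≠ M.π.symm h) : M.π e ≠ h := by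
  intro h2; apply he; rw [← h2]; simp

theorem iota_inj (M : Mod X) {a b : X} (h : M.ι a = M.ι b) : a = b := by
  rw [← M.inv a, h, M.inv]

/-- The slide (reflection) at `h`. -/
def slide (M : Mod X) (h : X) (hh : M.ι h ≠ h) (leg : M.Legal h) : Mod X where
  ι := M.ι
  π := M.slπ h
  node := M.slnode h
  inv := M.inv
  fpf := by
    intro e he
    have : M.slπ h (M.cyc h ((M.cyc h)⁻¹ e)) = M.cyc h ((M.cyc h)⁻¹ e) := by simpa using he
    rw [M.slπ_cyc] at this
    exact M.fpf _ ((M.cyc h).injective this)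
  node_gap := by
    intro e; unfold slnode; split_ifs <;> exact M.node_gap _
  gap_node := by
    intro e he
    have h1 : e ≠ h := by rintro rfl; exact hh he
    have h2 : e ≠ M.ι h := by rintro rfl; rw [M.inv] at he; exact hh he.symm
    simp [slnode, h1, h2, M.gap_node e he]
  node_step := by
    intro e
    obtain ⟨d1, d2, d3, d4, d5⟩ := M.distinct hh
    by_cases h1 : M.ι e = h
    · have : e = M.ι h := by rw [← h1, M.inv]
      rw [h1, M.slπ_h hh, this]; simp [slnode, hh, d2, d4]
    by_cases h2 : M.ι e = M.ι h
    · rw [h2, M.slπ_h' hh, M.iota_inj h2]; simp [slnode, d1, d3]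
    have h1' : e ≠ M.ι h := by rintro rfl; exact h1 (M.inv h)
    have h2' : e ≠ h := by rintro rfl; exact h2 rfl
    have he : M.slnode h e = M.node e := by simp [slnode, h1', h2']
    rw [he]
    by_cases h3 : M.ι e = M.π.symm h
    · rw [h3, M.slπ_y hh, M.slnode_cyc hh, M.node_step, ← M.node_step e, h3]
      · simp
      · exact M.rho_ne h
      · exact M.fpf _
    by_cases h4 : M.ι e = M.π.symm (M.ι h)
    · have := M.node_step (M.ι h)
      have h5 := M.rho_ne (M.ι h)
      rw [M.inv] at this h5
      rw [h4, M.slπ_y' hh, M.slnode_cyc hh, this, ← M.node_step e, h4]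
      · simp
      · exact M.fpf _
      · exact h5
    rw [M.slπ_else h1 h2 h3 h4, M.slnode_cyc hh (M.pi_ne_h h3) (M.pi_ne_h h4), M.node_step]
  acyc := by
    intro S hS hcl
    obtain ⟨d1, d2, d3, d4, d5⟩ := M.distinct hh
    have hy : h ∈ S → M.π.symm h ∈ S := by
      intro H; have := hcl _ H; rwa [M.slπ_h' hh] at this
    have hy' : M.ι h ∈ S → M.π.symm (M.ι h) ∈ S := by
      intro H; have := hcl _ H; rwa [M.inv, M.slπ_h hh] at this
    have key : ∀ z, z ≠ h → z ≠ M.ι h → M.cyc h z ∈ S → z ∈ S := by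
      intro z z1 z2 hz
      by_cases h3 : z = M.π.symm h
      · subst h3; rw [M.cyc_y hh] at hz; exact hy hz
      by_cases h4 : z = M.π.symm (M.ι h)
      · subst h4; rw [M.cyc_y' hh] at hz; exact hy' hz
      rwa [M.cyc_else z1 z2 h3 h4] at hz
    have hk := M.acyc {e | (e ∈ S ∧ e ≠ h ∧ e ≠ M.ι h) ∨ (e = h ∧ M.ι (M.π.symm h) ∈ S) ∨
      (e = M.ι h ∧ M.ι (M.π.symm (M.ι h)) ∈ S)} ?_ ?_
    · have h0 : ∀ e ∈ S, e = h ∨ e = M.ι h := by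
        intro e he
        by_contra hc
        push Not at hc
        have : e ∈ (∅ : Set X) := by rw [← hk]; exact Or.inl ⟨he, hc⟩
        exact this
      ext e
      simp only [Set.mem_empty_iff_false, iff_false]
      intro he
      rcases h0 e he with rfl | rfl
      · rcases h0 _ (hy he) with H | H <;> contradiction
      · rcases h0 _ (hy' he) with H | H <;> contradiction
    · rintro e (⟨he, -⟩ | ⟨rfl, -⟩ | ⟨rfl, -⟩)
      · exact hS e he
      · exact hh
      · rw [M.inv]; exact hh.symm
    · rintro e (⟨he, e1, e2⟩ | ⟨rfl, hk⟩ | ⟨rfl, hk⟩)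
      · have h1 : M.ι e ≠ h := by rintro rfl; exact e2 (M.inv e).symm
        have h2 : M.ι e ≠ M.ι h := fun H => e1 (M.iota_inj H)
        by_cases h3 : M.ι e = M.π.symm h
        · right; left; refine ⟨by rw [h3]; simp, ?_⟩
          rw [← h3, M.inv]; exact he
        by_cases h4 : M.ι e = M.π.symm (M.ι h)
        · right; right; refine ⟨by rw [h4]; simp, ?_⟩
          rw [← h4, M.inv]; exact he
        have := hcl e he
        rw [M.slπ_else h1 h2 h3 h4] at this
        exact Or.inl ⟨key _ (M.pi_ne_h h3) (M.pi_ne_h h4) this, M.pi_ne_h h3, M.pi_ne_h h4⟩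
      · have := hcl _ hk
        rw [M.inv, M.slπ_y hh] at this
        exact Or.inl ⟨key _ (M.rho_ne _) (M.fpf _) this, M.rho_ne _, M.fpf _⟩
      · have := hcl _ hk
        rw [M.inv, M.slπ_y' hh] at this
        have h5 := M.rho_ne (M.ι h)
        rw [M.inv] at h5 ⊢
        exact Or.inl ⟨key _ (M.fpf _) h5 this, M.fpf _, h5⟩
  conn := by
    intro P hι hπ
    obtain ⟨d1, d2, d3, d4, d5⟩ := M.distinct hh
    have hh' : M.ι (M.ι h) ≠ M.ι h := by rw [M.inv]; exact hh.symm
    have hy : M.ι (M.π.symm h) ≠ M.π.symm h → (P h ↔ P (M.π.symm h)) := by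
      intro H
      have := hπ (M.ι h) hh' (by rw [M.slπ_h' hh]; exact H)
      rw [M.slπ_h' hh] at this
      rw [hι h, this]
    have hy' : M.ι (M.π.symm (M.ι h)) ≠ M.π.symm (M.ι h) → (P h ↔ P (M.π.symm (M.ι h))) := by
      intro H
      have := hπ h hh (by rw [M.slπ_h hh]; exact H)
      rwa [M.slπ_h hh] at this
    have hc : ∀ e, M.ι e ≠ e → M.ι (M.cyc h e) ≠ M.cyc h e → (P e ↔ P (M.cyc h e)) := by
      intro e he hce
      by_cases h1 : e = h
      · subst h1; rw [M.cyc_h hh] at *; exact hy' hce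
      by_cases h2 : e = M.ι h
      · subst h2; rw [M.cyc_h' hh] at *; rw [← hι]; exact hy hce
      by_cases h3 : e = M.π.symm h
      · subst h3; rw [M.cyc_y hh] at *; exact (hy he).symm
      by_cases h4 : e = M.π.symm (M.ι h)
      · subst h4; rw [M.cyc_y' hh] at *; rw [← hι]; exact (hy' he).symm
      rw [M.cyc_else h1 h2 h3 h4]
    apply M.conn P hι
    intro e he hpe
    by_cases g1 : M.ι (M.cyc h e) = M.cyc h e
    · exfalso
      by_cases h1 : e = h
      · subst h1; rw [M.cyc_h hh] at g1; have := leg.2 g1; rw [this] at hpe; exact hpe g1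
      by_cases h2 : e = M.ι h
      · subst h2; rw [M.cyc_h' hh] at g1; have := leg.1 g1; rw [this] at hpe; exact hpe g1
      by_cases h3 : e = M.π.symm h
      · subst h3; rw [M.cyc_y hh] at g1; exact hh g1
      by_cases h4 : e = M.π.symm (M.ι h)
      · subst h4; rw [M.cyc_y' hh] at g1; exact hh' g1
      rw [M.cyc_else h1 h2 h3 h4] at g1; exact he g1
    by_cases g2 : M.ι (M.cyc h (M.π e)) = M.cyc h (M.π e)
    · by_cases h1 : M.π e = h
      · have : e = M.π.symm h := by rw [← h1]; simp
        subst this; rw [h1]; exact (hy he).symm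
      by_cases h2 : M.π e = M.ι h
      · have : e = M.π.symm (M.ι h) := by rw [← h2]; simp
        subst this; rw [h2, ← hι]; exact (hy' he).symm
      exfalso
      by_cases h3 : M.π e = M.π.symm h
      · rw [h3, M.cyc_y hh] at g2; exact hh g2
      by_cases h4 : M.π e = M.π.symm (M.ι h)
      · rw [h4, M.cyc_y' hh] at g2; exact hh' g2
      rw [M.cyc_else h1 h2 h3 h4] at g2; exact hpe g2
    rw [hc e he g1, hc _ hpe g2, ← M.slπ_cyc]
    exact hπ _ g1 (by rw [M.slπ_cyc]; exact g2)

/-- The opposite model. -/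
def op (M : Mod X) : Mod X where
  ι := M.ι
  π := M.π.symm
  node := fun e => M.node (M.ι e)
  inv := M.inv
  fpf := by intro e he; exact M.fpf e (by conv_lhs => rw [← he]
                                          simp)
  node_gap := fun e => M.node_gap _
  gap_node := by intro e he; rw [he]; exact M.gap_node e he
  node_step := by
    intro e
    have := M.node_step (M.ι (M.π.symm (M.ι e)))
    rw [M.inv] at this; simpa using this.symm
  acyc := by
    intro S hS hcl
    have hmap : Set.MapsTo (fun e => M.π.symm (M.ι e)) S S := hcl
    have hinj : Set.InjOn (fun e => M.π.symm (M.ι e)) S := by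
      intro a _ b _ hab
      exact M.iota_inj (M.π.symm.injective hab)
    have hsurj := ((Set.Finite.injOn_iff_bijOn_of_mapsTo (Set.toFinite S) hmap).1 hinj).surjOn
    have := M.acyc {e | M.ι e ∈ S} ?_ ?_
    · ext e
      simp only [Set.mem_empty_iff_false, iff_false]
      intro he
      have h2 : M.ι e ∈ ({e | M.ι e ∈ S} : Set X) := by simpa [M.inv] using he
      rw [this] at h2; exact h2
    · intro e he
      have := hS _ he
      rw [M.inv] at this; exact this.symm
    · intro e he
      obtain ⟨f, hf, hfe⟩ := hsurj he
      have : M.ι f = M.π (M.ι e) := by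
        rw [← hfe]; simp
      show M.ι (M.π (M.ι e)) ∈ S
      rw [← this, M.inv]; exact hf
  conn := by
    intro P hι hπ
    apply M.conn P hι
    intro e he hpe
    have := hπ (M.π e) hpe (by simpa using he)
    simp at this
    exact this.symm

theorem op_op (M : Mod X) : M.op.op = M := by
  apply ext'
  · rfl
  · simp [op]
  · funext e; simp [op, M.inv]

/-- One step: slide or co-slide. -/
def Step (M M' : Mod X) : Prop :=
  (∃ h hh leg, M' = M.slide h hh leg) ∨ (∃ h hh leg, M' = (M.op.slide h hh leg).op)

/-- Reachability. -/
def Reach : Mod X → Mod X → Prop := Relation.ReflTransGen Step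

theorem Step.op {M M' : Mod X} (h : Step M M') : Step M.op M'.op := by
  rcases h with ⟨h, hh, leg, rfl⟩ | ⟨h, hh, leg, rfl⟩
  · right
    have : ∀ N : Mod X, N = M → ∃ (h' : X) (hh' : N.ι h' ≠ h') (leg' : N.Legal h'),
        (M.slide h hh leg).op = (N.slide h' hh' leg').op := by
      rintro N rfl; exact ⟨h, hh, leg, rfl⟩
    exact this _ M.op_op
  · left
    exact ⟨h, hh, leg, op_op _⟩

theorem Reach.op {M M' : Mod X} (h : Reach M M') : Reach M.op M'.op := by
  induction h with
  | refl => exact .refl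
  | tail _ h2 ih => exact ih.tail h2.op

theorem Reach.slide (M : Mod X) (h : X) (hh leg) : Reach M (M.slide h hh leg) :=
  .single (Or.inl ⟨h, hh, leg, rfl⟩)

end Mod
end GentleQuiv

namespace GentleQuiv
set_option linter.unusedSectionVars false
set_option linter.deprecated false
set_option linter.unusedVariables false

variable {X : Type} [Fintype X] [DecidableEq X]

/-- `h` is the target half of an arrow. -/
def Mod.Arr (M : Mod X) (h : X) : Prop := M.ι h ≠ h ∧ M.ι (M.π.symm h) ≠ M.π.symm h

/-- `Q` is represented by the model `M`. -/
structure Rep (Q : QuivRel) (M : Mod X) (vm am : X → ℕ) : Prop where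
  vmι : ∀ e, vm (M.ι e) = vm e
  vminj : ∀ e e', M.ι e ≠ e → M.ι e' ≠ e' → vm e = vm e' → e' = e ∨ e' = M.ι e
  V : ∀ v, v ∈ Q.V ↔ ∃ e, M.ι e ≠ e ∧ vm e = v
  A : ∀ a, a ∈ Q.A ↔ ∃ h, M.Arr h ∧ am h = a
  aminj : ∀ h h', M.Arr h → M.Arr h' → am h = am h' → h = h'
  src : ∀ h, M.Arr h → Q.src (am h) = vm (M.π.symm h)
  tgt : ∀ h, M.Arr h → Q.tgt (am h) = vm h
  rel : ∀ a b, (a, b) ∈ Q.rel ↔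
    ∃ h, M.Arr h ∧ M.Arr (M.π.symm h) ∧ a = am h ∧ b = am (M.π.symm h)

open Classical in
/-- Build a quiver from a model. -/
noncomputable def realize (M : Mod X) (vm am : X → ℕ) : QuivRel where
  V := (Finset.univ.filter fun e => M.ι e ≠ e).image vm
  A := (Finset.univ.filter fun e => M.Arr e).image am
  src a := if h : ∃ g, M.Arr g ∧ am g = a then vm (M.π.symm h.choose) else 0
  tgt a := if h : ∃ g, M.Arr g ∧ am g = a then vm h.choose else 0
  rel := (Finset.univ.filter fun e => M.Arr e ∧ M.Arr (M.π.symm e)).image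
    fun e => (am e, am (M.π.symm e))

theorem rep_realize (M : Mod X) (vm am : X → ℕ) (h1 : ∀ e, vm (M.ι e) = vm e)
    (h2 : ∀ e e', M.ι e ≠ e → M.ι e' ≠ e' → vm e = vm e' → e' = e ∨ e' = M.ι e)
    (h3 : ∀ h h', M.Arr h → M.Arr h' → am h = am h' → h = h') :
    Rep (realize M vm am) M vm am where
  vmι := h1
  vminj := h2
  V := by intro v; simp [realize]
  A := by intro v; simp [realize]
  aminj := h3
  src := by
    intro h hh
    have hex : ∃ g, M.Arr g ∧ am g = am h := ⟨h, hh, rfl⟩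
    simp only [realize, dif_pos hex]
    rw [h3 _ _ hex.choose_spec.1 hh hex.choose_spec.2]
  tgt := by
    intro h hh
    have hex : ∃ g, M.Arr g ∧ am g = am h := ⟨h, hh, rfl⟩
    simp only [realize, dif_pos hex]
    rw [h3 _ _ hex.choose_spec.1 hh hex.choose_spec.2]
  rel := by
    intro a b
    simp only [realize, Finset.mem_image, Finset.mem_filter, Finset.mem_univ, true_and,
      Prod.mk.injEq]
    constructor
    · rintro ⟨h, ⟨q1, q2⟩, rfl, rfl⟩; exact ⟨h, q1, q2, rfl, rfl⟩
    · rintro ⟨h, q1, q2, rfl, rfl⟩; exact ⟨h, ⟨q1, q2⟩, rfl, rfl⟩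

/-- Uniform bound for list lengths. -/
theorem Mod.bound (M : Mod X) :
    ∃ N : ℕ, ∀ e, ∃ k, k < N ∧ M.ι ((fun e => M.π (M.ι e))^[k] e) = (fun e => M.π (M.ι e))^[k] e := by
  have h0 := M.acyc {e | ∀ k, M.ι ((fun e => M.π (M.ι e))^[k] e) ≠ (fun e => M.π (M.ι e))^[k] e}
    (fun e he => he 0) (fun e he k => he (k+1))
  have h1 : ∀ e, ∃ k, M.ι ((fun e => M.π (M.ι e))^[k] e) = (fun e => M.π (M.ι e))^[k] e := by
    intro e
    by_contra hc
    push Not at hc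
    have : e ∈ (∅ : Set X) := by rw [← h0]; exact hc
    exact this
  choose f hf using h1
  refine ⟨Finset.univ.sup f + 1, fun e => ⟨f e, ?_, hf e⟩⟩
  have := Finset.le_sup (f := f) (Finset.mem_univ e)
  omega

namespace Rep
variable {Q : QuivRel} {M : Mod X} {vm am : X → ℕ}

theorem gentle (R : Rep Q M vm am) (hne : Nonempty X) : IsGentle Q := by
  refine ⟨?_, ?_, ?_, ?_, ?_, ?_, ?_, ?_, ?_, ?_, ?_⟩
  · obtain ⟨n⟩ := hne
    by_cases hn : M.ι n = n
    · exact ⟨_, (R.V _).2 ⟨_, M.gap_next hn, rfl⟩⟩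
    · exact ⟨_, (R.V _).2 ⟨_, hn, rfl⟩⟩
  · intro a ha
    obtain ⟨h, hh, rfl⟩ := (R.A _).1 ha
    rw [R.src h hh, R.tgt h hh]
    exact ⟨(R.V _).2 ⟨_, hh.2, rfl⟩, (R.V _).2 ⟨_, hh.1, rfl⟩⟩
  · intro x hx y hy
    obtain ⟨e, he, rfl⟩ := (R.V _).1 hx
    obtain ⟨e', he', rfl⟩ := (R.V _).1 hy
    refine M.conn (fun f => Relation.ReflTransGen (Adj Q) (vm e) (vm f)) ?_ ?_ e e' he he' .refl
    · intro f; simp only [R.vmι]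
    · intro f hf hpf
      have harr : M.Arr (M.π f) := ⟨hpf, by simpa using hf⟩
      have hs := R.src _ harr
      have ht := R.tgt _ harr
      simp at hs
      have hA := (R.A _).2 ⟨_, harr, rfl⟩
      constructor
      · intro h; exact h.tail ⟨_, hA, Or.inl ⟨hs, ht⟩⟩
      · intro h; exact h.tail ⟨_, hA, Or.inr ⟨hs, ht⟩⟩
  · rintro ⟨a, b⟩ hr
    obtain ⟨h, h1, h2, rfl, rfl⟩ := (R.rel _ _).1 hr
    exact ⟨(R.A _).2 ⟨_, h1, rfl⟩, (R.A _).2 ⟨_, h2, rfl⟩, by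
      simp only [R.src _ h1, R.tgt _ h2]⟩
  · intro x
    by_cases hx : ∃ e, M.ι e ≠ e ∧ vm e = x
    · obtain ⟨e, he, rfl⟩ := hx
      refine (Finset.card_le_card (t := {am (M.π e), am (M.π (M.ι e))}) ?_).trans Finset.card_le_two
      intro a ha
      simp only [Finset.mem_filter] at ha
      obtain ⟨h, hh, rfl⟩ := (R.A _).1 ha.1
      have := ha.2
      rw [R.src h hh] at this
      rcases R.vminj _ _ he hh.2 this.symm with h3 | h3 <;> simp [← h3]
    · rw [Finset.card_eq_zero.2]; · simp
      rw [Finset.filter_eq_empty_iff]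
      intro a ha hax
      obtain ⟨h, hh, rfl⟩ := (R.A _).1 ha
      rw [R.src h hh] at hax
      exact hx ⟨_, hh.2, hax⟩
  · intro x
    by_cases hx : ∃ e, M.ι e ≠ e ∧ vm e = x
    · obtain ⟨e, he, rfl⟩ := hx
      refine (Finset.card_le_card (t := {am e, am (M.ι e)}) ?_).trans Finset.card_le_two
      intro a ha
      simp only [Finset.mem_filter] at ha
      obtain ⟨h, hh, rfl⟩ := (R.A _).1 ha.1
      have := ha.2
      rw [R.tgt h hh] at this
      rcases R.vminj _ _ he hh.1 this.symm with h3 | h3 <;> simp [← h3]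
    · rw [Finset.card_eq_zero.2]; · simp
      rw [Finset.filter_eq_empty_iff]
      intro a ha hax
      obtain ⟨h, hh, rfl⟩ := (R.A _).1 ha
      rw [R.tgt h hh] at hax
      exact hx ⟨_, hh.1, hax⟩
  · intro a ha
    obtain ⟨h, hh, rfl⟩ := (R.A _).1 ha
    have key : ∀ b ∈ Q.A, Q.src b = Q.tgt (am h) → (b, am h) ∉ Q.rel → b = am (M.π (M.ι h)) := by
      intro b hb hs hr
      obtain ⟨g, hg, rfl⟩ := (R.A _).1 hb
      rw [R.src g hg, R.tgt h hh] at hs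
      rcases R.vminj _ _ hh.1 hg.2 hs.symm with h3 | h3
      · exact absurd ((R.rel _ _).2 ⟨g, hg, by rw [h3]; exact hh, rfl, by rw [h3]⟩) hr
      · rw [← h3]; simp
    rw [Finset.card_le_one]
    intro b hb b' hb'
    simp only [Finset.mem_filter] at hb hb'
    rw [key b hb.1 hb.2.1 hb.2.2, key b' hb'.1 hb'.2.1 hb'.2.2]
  · intro a ha
    obtain ⟨h, hh, rfl⟩ := (R.A _).1 ha
    have key : ∀ b ∈ Q.A, Q.tgt b = Q.src (am h) → (am h, b) ∉ Q.rel → b = am (M.ι (M.π.symm h)) := by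
      intro b hb hs hr
      obtain ⟨g, hg, rfl⟩ := (R.A _).1 hb
      rw [R.tgt g hg, R.src h hh] at hs
      rcases R.vminj _ _ hh.2 hg.1 hs.symm with h3 | h3
      · exact absurd ((R.rel _ _).2 ⟨h, hh, by rw [← h3]; exact hg, rfl, by rw [h3]⟩) hr
      · rw [← h3]
    rw [Finset.card_le_one]
    intro b hb b' hb'
    simp only [Finset.mem_filter] at hb hb'
    rw [key b hb.1 hb.2.1 hb.2.2, key b' hb'.1 hb'.2.1 hb'.2.2]
  · intro a ha
    obtain ⟨h, hh, rfl⟩ := (R.A _).1 ha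
    have key : ∀ b ∈ Q.A, (b, am h) ∈ Q.rel → b = am (M.π h) := by
      intro b hb hr
      obtain ⟨g, h1, h2, rfl, h3⟩ := (R.rel _ _).1 hr
      rw [R.aminj _ _ hh h2 h3]; simp
    rw [Finset.card_le_one]
    intro b hb b' hb'
    simp only [Finset.mem_filter] at hb hb'
    rw [key b hb.1 hb.2, key b' hb'.1 hb'.2]
  · intro a ha
    obtain ⟨h, hh, rfl⟩ := (R.A _).1 ha
    have key : ∀ b ∈ Q.A, (am h, b) ∈ Q.rel → b = am (M.π.symm h) := by
      intro b hb hr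
      obtain ⟨g, h1, h2, h3, rfl⟩ := (R.rel _ _).1 hr
      rw [R.aminj _ _ hh h1 h3]
    rw [Finset.card_le_one]
    intro b hb b' hb'
    simp only [Finset.mem_filter] at hb hb'
    rw [key b hb.1 hb.2, key b' hb'.1 hb'.2]
  · obtain ⟨N, hN⟩ := M.bound
    refine ⟨N, fun l hl hlen => ?_⟩
    by_contra hc
    have key : ∀ l : List ℕ, (∀ a ∈ l, a ∈ Q.A) → l.IsChain (fun a b => Q.src a = Q.tgt b) →
        ¬ HasRelSubpath Q l → l ≠ [] → ∃ h g, M.Arr h ∧ some (am h) = l.head? ∧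
        h = (fun e => M.π (M.ι e))^[l.length - 1] g ∧ ∀ j, j < l.length →
        M.ι ((fun e => M.π (M.ι e))^[j] g) ≠ (fun e => M.π (M.ι e))^[j] g := by
      intro l
      induction l with
      | nil => intro _ _ _ h; exact absurd rfl h
      | cons a l ih =>
        intro hA hch hrel _
        obtain ⟨h, hh, rfl⟩ := (R.A _).1 (hA a (by simp))
        cases l with
        | nil =>
          refine ⟨h, h, hh, by simp, by simp, ?_⟩
          intro j hj
          have : j = 0 := by simp at hj; exact hj
          subst this; exact hh.1
        | cons b l =>
          have hch' := List.isChain_cons_cons.1 hch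
          obtain ⟨h', g, hh', hb, hg, hj⟩ := ih (fun a ha => hA a (List.mem_cons_of_mem _ ha)) hch'.2
            (fun ⟨x, y, hxy, hi⟩ => hrel ⟨x, y, hxy, hi.trans (List.suffix_cons _ _).isInfix⟩) (by simp)
          simp at hb
          subst hb
          have e1 : h = M.π (M.ι h') := by
            have h2 := hch'.1
            rw [R.src _ hh, R.tgt _ hh'] at h2
            rcases R.vminj _ _ hh'.1 hh.2 h2.symm with h3 | h3
            · exfalso; apply hrel
              exact ⟨_, _, (R.rel _ _).2 ⟨h, hh, by rw [h3]; exact hh', rfl, by rw [h3]⟩,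
                ⟨[], l, by simp⟩⟩
            · rw [← h3]; simp
          have e2 : h = (fun e => M.π (M.ι e))^[l.length + 1] g := by
            rw [Function.iterate_succ_apply']
            simp at hg
            rw [← hg, e1]
          refine ⟨h, g, hh, by simp, by simpa using e2, ?_⟩
          intro j hjl
          by_cases hjj : j < (am h' :: l).length
          · exact hj j hjj
          · have : j = l.length + 1 := by simp at hjl hjj; omega
            subst this; rw [← e2]; exact hh.1
    obtain ⟨h, g, -, -, -, hj⟩ := key l hl.2.1 hl.2.2 hc hl.1
    obtain ⟨k, hk, hk2⟩ := hN g
    exact hj k (hlen ▸ hk) hk2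

theorem noloops (R : Rep Q M vm am) : NoLoops Q := by
  intro a ha
  obtain ⟨h, hh, rfl⟩ := (R.A _).1 ha
  rw [R.src h hh, R.tgt h hh]
  intro he
  obtain ⟨d1, d2, d3, d4, d5⟩ := M.distinct hh.1
  rcases R.vminj _ _ hh.1 hh.2 he.symm with h3 | h3 <;> contradiction

theorem op (R : Rep Q M vm am) : Rep (opQR Q) M.op vm (fun e => am (M.π e)) := by
  have harr : ∀ e, M.op.Arr e ↔ M.Arr (M.π e) := by
    intro e; simp [Mod.Arr, Mod.op, and_comm]
  refine ⟨R.vmι, R.vminj, R.V, ?_, ?_, ?_, ?_, ?_⟩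
  · intro a
    simp only [opQR, R.A, harr]
    constructor
    · rintro ⟨h, hh, rfl⟩; exact ⟨M.π.symm h, by simpa using hh, by simp⟩
    · rintro ⟨h, hh, rfl⟩; exact ⟨_, hh, rfl⟩
  · intro h h' hh hh' he
    rw [harr] at hh hh'
    exact M.π.injective (R.aminj _ _ hh hh' he)
  · intro h hh
    rw [harr] at hh
    simpa [opQR, Mod.op] using R.tgt _ hh
  · intro h hh
    rw [harr] at hh
    simpa [opQR, Mod.op] using R.src _ hh
  · intro a b
    have : (a, b) ∈ (opQR Q).rel ↔ (b, a) ∈ Q.rel := by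
      simp [opQR]
    rw [this, R.rel]
    have hs : ∀ h, M.op.π.symm h = M.π h := fun h => by simp [Mod.op]
    simp only [harr, hs]
    constructor
    · rintro ⟨h, h1, h2, rfl, rfl⟩
      exact ⟨M.π.symm (M.π.symm h), by simpa using h2, by simpa using h1, by simp, by simp⟩
    · rintro ⟨h, h1, h2, rfl, rfl⟩
      exact ⟨M.π (M.π h), h2, by simpa using h1, rfl, by simp⟩

end Rep

theorem opQR_opQR (Q : QuivRel) : opQR (opQR Q) = Q := by
  cases Q
  simp [opQR, Finset.image_image, Function.comp_def]

end GentleQuiv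

namespace GentleQuiv
set_option linter.unusedSectionVars false
set_option linter.deprecated false
set_option linter.unusedVariables false

variable {X : Type} [Fintype X] [DecidableEq X]

namespace Mod

/-- renaming of arrows in a slide -/
def ren (M : Mod X) (h : X) : Equiv.Perm X :=
  Equiv.swap (M.π.symm h) h * Equiv.swap (M.π.symm (M.ι h)) (M.ι h)

variable (M : Mod X) {h : X}

theorem ren_y (hh : M.ι h ≠ h) : M.ren h (M.π.symm h) = h := by
  obtain ⟨d1, d2, d3, d4, d5⟩ := M.distinct hh
  simp only [ren, Equiv.Perm.mul_apply, Equiv.swap_apply_def]; grind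
theorem ren_y' (hh : M.ι h ≠ h) : M.ren h (M.π.symm (M.ι h)) = M.ι h := by
  obtain ⟨d1, d2, d3, d4, d5⟩ := M.distinct hh
  simp only [ren, Equiv.Perm.mul_apply, Equiv.swap_apply_def]; grind
theorem ren_cyc (hh : M.ι h ≠ h) {z : X} (h1 : z ≠ h) (h2 : z ≠ M.ι h) : M.ren h (M.cyc h z) = z := by
  obtain ⟨d1, d2, d3, d4, d5⟩ := M.distinct hh
  simp only [cyc, ren, Equiv.Perm.mul_apply, Equiv.swap_apply_def]; grind

theorem slπ_symm_y (hh : M.ι h ≠ h) : (M.slπ h).symm (M.π.symm h) = M.ι h := by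
  rw [Equiv.symm_apply_eq, M.slπ_h' hh]
theorem slπ_symm_y' (hh : M.ι h ≠ h) : (M.slπ h).symm (M.π.symm (M.ι h)) = h := by
  rw [Equiv.symm_apply_eq, M.slπ_h hh]
theorem slπ_symm_cyc (z : X) : (M.slπ h).symm (M.cyc h z) = M.cyc h (M.π.symm z) := by
  rw [Equiv.symm_apply_eq, M.slπ_cyc]; simp

/-- every new half is `y`, `y'` or `c z` -/
theorem cyc_cases (hh : M.ι h ≠ h) (g : X) : g = M.π.symm h ∨ g = M.π.symm (M.ι h) ∨
    ∃ z, z ≠ h ∧ z ≠ M.ι h ∧ g = M.cyc h z := by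
  obtain ⟨z, rfl⟩ := (M.cyc h).surjective g
  by_cases h1 : z = h
  · right; left; rw [h1, M.cyc_h hh]
  by_cases h2 : z = M.ι h
  · left; rw [h2, M.cyc_h' hh]
  exact Or.inr (Or.inr ⟨z, h1, h2, rfl⟩)

variable (hh : M.ι h ≠ h) (leg : M.Legal h)

theorem arr_y : (M.slide h hh leg).Arr (M.π.symm h) ↔ M.Arr h := by
  have : M.ι (M.ι h) ≠ M.ι h := by rw [M.inv]; exact hh.symm
  simp [Arr, slide, M.slπ_symm_y hh, this, hh]
theorem arr_y' : (M.slide h hh leg).Arr (M.π.symm (M.ι h)) ↔ M.Arr (M.ι h) := by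
  have : M.ι (M.ι h) ≠ M.ι h := by rw [M.inv]; exact hh.symm
  simp [Arr, slide, M.slπ_symm_y' hh, this, hh]

theorem arr_cyc {z : X} (h1 : z ≠ h) (h2 : z ≠ M.ι h) :
    (M.slide h hh leg).Arr (M.cyc h z) ↔ M.Arr z := by
  have hh' : M.ι (M.ι h) ≠ M.ι h := by rw [M.inv]; exact hh.symm
  obtain ⟨d1, d2, d3, d4, d5⟩ := M.distinct hh
  simp only [Arr, slide, M.slπ_symm_cyc]
  have a1 : M.π.symm z ≠ M.π.symm h := fun H => h1 (M.π.symm.injective H)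
  have a2 : M.π.symm z ≠ M.π.symm (M.ι h) := fun H => h2 (M.π.symm.injective H)
  have l1 := leg.1
  have l2 := leg.2
  have b1 : M.ι (M.π.symm h) = M.π.symm h → M.π.symm (M.π.symm h) = M.ι h := by
    intro H; rw [← l1 H]; simp
  have b2 : M.ι (M.π.symm (M.ι h)) = M.π.symm (M.ι h) → M.π.symm (M.π.symm (M.ι h)) = h := by
    intro H; rw [← l2 H]; simp
  have e1 := M.cyc_h hh
  have e2 := M.cyc_h' hh
  have e3 := M.cyc_y hh
  have e4 := M.cyc_y' hh
  have e6 : M.π (M.π.symm z) = z := by simp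
  by_cases c1 : M.π.symm z = h
  · rw [c1] at e6 ⊢
    by_cases g1 : z = M.π.symm h
    · grind
    by_cases g2 : z = M.π.symm (M.ι h)
    · grind
    rw [M.cyc_else h1 h2 g1 g2]; grind
  by_cases c2 : M.π.symm z = M.ι h
  · rw [c2] at e6 ⊢
    by_cases g1 : z = M.π.symm h
    · grind
    by_cases g2 : z = M.π.symm (M.ι h)
    · grind
    rw [M.cyc_else h1 h2 g1 g2]; grind
  rw [M.cyc_else c1 c2 a1 a2]
  by_cases g1 : z = M.π.symm h
  · grind
  by_cases g2 : z = M.π.symm (M.ι h)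
  · grind
  rw [M.cyc_else h1 h2 g1 g2]

theorem arr_ren (g : X) : (M.slide h hh leg).Arr g ↔ M.Arr (M.ren h g) := by
  rcases M.cyc_cases hh g with rfl | rfl | ⟨z, h1, h2, rfl⟩
  · rw [M.arr_y hh leg, M.ren_y hh]
  · rw [M.arr_y' hh leg, M.ren_y' hh]
  · rw [M.arr_cyc hh leg h1 h2, M.ren_cyc hh h1 h2]

end Mod

theorem Rep.slide {Q : QuivRel} {M : Mod X} {vm am : X → ℕ} (R : Rep Q M vm am)
    (hne : Nonempty X) (h : X) (hh : M.ι h ≠ h) (leg : M.Legal h) :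
    ∃ Q' am', IsReflection Q (vm h) Q' ∧ Rep Q' (M.slide h hh leg) vm am' := by
  have hh' : M.ι (M.ι h) ≠ M.ι h := by rw [M.inv]; exact hh.symm
  obtain ⟨d1, d2, d3, d4, d5⟩ := M.distinct hh
  let am' : X → ℕ := fun g => am (M.ren h g)
  have R' : Rep (realize (M.slide h hh leg) vm am') (M.slide h hh leg) vm am' := by
    apply rep_realize
    · exact R.vmι
    · exact R.vminj
    · intro g g' hg hg' he
      rw [M.arr_ren] at hg hg'
      exact (M.ren h).injective (R.aminj _ _ hg hg' he)
  refine ⟨_, am', ?_, R'⟩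
  generalize realize (M.slide h hh leg) vm am' = Q' at R'
  -- arrow classification
  have vx : ∀ e, M.ι e ≠ e → vm e = vm h → e = h ∨ e = M.ι h := fun e he hv =>
    R.vminj _ _ hh he hv.symm
  have amy : am' (M.π.symm h) = am h := by simp only [am', M.ren_y hh]
  have amy' : am' (M.π.symm (M.ι h)) = am (M.ι h) := by simp only [am', M.ren_y' hh]
  have amz : ∀ z, z ≠ h → z ≠ M.ι h → am' (M.cyc h z) = am z := fun z z1 z2 => by
    simp only [am', M.ren_cyc hh z1 z2]
  have sth : M.Arr h → Q'.src (am h) = vm h ∧ Q'.tgt (am h) = vm (M.π.symm h) := by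
    intro ha
    have h1 := (M.arr_y hh leg).2 ha
    have h2 := R'.src _ h1
    have h3 := R'.tgt _ h1
    rw [amy] at h2 h3
    refine ⟨?_, h3⟩
    rw [h2]
    show vm ((M.slπ h).symm _) = _
    rw [M.slπ_symm_y hh, R.vmι]
  have sth' : M.Arr (M.ι h) → Q'.src (am (M.ι h)) = vm h ∧
      Q'.tgt (am (M.ι h)) = vm (M.π.symm (M.ι h)) := by
    intro ha
    have h1 := (M.arr_y' hh leg).2 ha
    have h2 := R'.src _ h1
    have h3 := R'.tgt _ h1
    rw [amy'] at h2 h3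
    refine ⟨?_, h3⟩
    rw [h2]
    show vm ((M.slπ h).symm _) = _
    rw [M.slπ_symm_y' hh]
  have stz : ∀ z, z ≠ h → z ≠ M.ι h → M.Arr z → Q'.src (am z) = vm (M.cyc h (M.π.symm z)) ∧
      Q'.tgt (am z) = vm (M.cyc h z) := by
    intro z z1 z2 ha
    have h1 := (M.arr_cyc hh leg z1 z2).2 ha
    have h2 := R'.src _ h1
    have h3 := R'.tgt _ h1
    rw [amz z z1 z2] at h2 h3
    refine ⟨?_, h3⟩
    rw [h2]
    show vm ((M.slπ h).symm _) = _
    rw [M.slπ_symm_cyc]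
  have relm : ∀ g k, M.Arr g → M.Arr k → ((am g, am k) ∈ Q.rel ↔ k = M.π.symm g) := by
    intro g k hg hk
    rw [R.rel]
    constructor
    · rintro ⟨f, f1, f2, f3, f4⟩
      rw [R.aminj _ _ hg f1 f3, R.aminj _ _ hk f2 f4]
    · rintro rfl; exact ⟨g, hg, hk, rfl, rfl⟩
  have tgx : ∀ z, M.Arr z → (Q.tgt (am z) = vm h ↔ z = h ∨ z = M.ι h) := by
    intro z hz
    rw [R.tgt z hz]
    constructor
    · exact vx z hz.1
    · rintro (rfl | rfl)
      · rfl
      · rw [R.vmι]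
  have sgx : ∀ z, M.Arr z → (Q.src (am z) = vm h ↔ M.π.symm z = h ∨ M.π.symm z = M.ι h) := by
    intro z hz
    rw [R.src z hz]
    constructor
    · exact vx _ hz.2
    · rintro (h | h)
      · rw [h]
      · rw [h, R.vmι]
  have tgxc : ∀ b ∈ Q.A, Q.tgt b = vm h → (b = am h ∧ M.Arr h) ∨ (b = am (M.ι h) ∧ M.Arr (M.ι h)) := by
    intro b hb hbt
    obtain ⟨z, hz, rfl⟩ := (R.A _).1 hb
    rcases (tgx z hz).1 hbt with rfl | rfl
    · exact Or.inl ⟨rfl, hz⟩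
    · exact Or.inr ⟨rfl, hz⟩
  have hne' : ∀ z, M.π.symm z = h ∨ M.π.symm z = M.ι h → z ≠ h ∧ z ≠ M.ι h := by
    rintro z hz; constructor <;> rintro rfl <;> rcases hz with hz | hz <;> contradiction
  refine ⟨R.gentle hne, R.noloops, ⟨(R.V _).2 ⟨h, hh, rfl⟩, ?_⟩, ?_, ?_, ?_, ?_, ?_, ?_, ?_⟩
  · intro a ha hs
    obtain ⟨z, hz, rfl⟩ := (R.A _).1 ha
    rcases (sgx z hz).1 hs with h1 | h1
    · have hz' : z = M.π h := by rw [← h1]; simp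
      have harr : M.Arr (M.ι h) := by
        refine ⟨hh', fun H => ?_⟩
        have := leg.2 H
        rw [← hz'] at this
        exact hz.1 (this ▸ H)
      refine ⟨am (M.ι h), (R.A _).2 ⟨_, harr, rfl⟩, (tgx _ harr).2 (Or.inr rfl), ?_⟩
      rw [relm _ _ hz harr, h1]; exact hh
    · have hz' : z = M.π (M.ι h) := by rw [← h1]; simp
      have harr : M.Arr h := by
        refine ⟨hh, fun H => ?_⟩
        have := leg.1 H
        rw [← hz'] at this
        exact hz.1 (this ▸ H)
      refine ⟨am h, (R.A _).2 ⟨_, harr, rfl⟩, (tgx _ harr).2 (Or.inl rfl), ?_⟩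
      rw [relm _ _ hz harr, h1]; exact hh.symm
  · ext v; rw [R'.V, R.V]; rfl
  · ext a
    rw [R'.A, R.A]
    constructor
    · rintro ⟨g, hg, rfl⟩; exact ⟨_, (M.arr_ren hh leg g).1 hg, rfl⟩
    · rintro ⟨g, hg, rfl⟩
      exact ⟨(M.ren h).symm g, (M.arr_ren hh leg _).2 (by simpa using hg), by simp [am']⟩
  · intro a ha ht
    rcases tgxc a ha ht with ⟨rfl, harr⟩ | ⟨rfl, harr⟩
    · rw [R.src _ harr]; exact sth harr
    · rw [R.src _ harr]; exact sth' harr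
  · intro a ha hs b hb ht hr
    obtain ⟨z, hz, rfl⟩ := (R.A _).1 ha
    have hz1 := (sgx z hz).1 hs
    obtain ⟨n1, n2⟩ := hne' z hz1
    rw [(stz z n1 n2 hz).1]
    rcases tgxc b hb ht with ⟨rfl, harr⟩ | ⟨rfl, harr⟩
    · rw [relm _ _ hz harr] at hr
      rcases hz1 with h1 | h1
      · exact absurd h1.symm hr
      · rw [h1, M.cyc_h' hh, R.src _ harr]
    · rw [relm _ _ hz harr] at hr
      rcases hz1 with h1 | h1
      · rw [h1, M.cyc_h hh, R.src _ harr]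
      · exact absurd h1.symm hr
  · intro a ha ht hs
    obtain ⟨z, hz, rfl⟩ := (R.A _).1 ha
    rw [Ne, tgx z hz] at ht
    rw [Ne, sgx z hz] at hs
    push Not at ht hs
    rw [(stz z ht.1 ht.2 hz).1, R.src z hz, M.cyc_else hs.1 hs.2]
    · intro H; exact ht.1 (M.π.symm.injective H)
    · intro H; exact ht.2 (M.π.symm.injective H)
  · intro a ha ht
    obtain ⟨z, hz, rfl⟩ := (R.A _).1 ha
    rw [Ne, tgx z hz] at ht
    push Not at ht
    rw [(stz z ht.1 ht.2 hz).2]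
    constructor
    · rintro ⟨b, hb, hbt, hbs, hr⟩
      rcases tgxc b hb hbt with ⟨rfl, harr⟩ | ⟨rfl, harr⟩
      · rw [relm _ _ harr hz] at hr
        rw [hr, M.cyc_y hh]
      · rw [relm _ _ harr hz] at hr
        rw [hr, M.cyc_y' hh, R.vmι]
    · intro hno
      rw [R.tgt z hz, M.cyc_else ht.1 ht.2]
      · rintro rfl
        apply hno
        have harr : M.Arr h := ⟨hh, hz.1⟩
        exact ⟨am h, (R.A _).2 ⟨_, harr, rfl⟩, R.tgt _ harr, by rw [R.src _ harr, R.tgt _ hz],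
          (relm _ _ harr hz).2 rfl⟩
      · rintro rfl
        apply hno
        have harr : M.Arr (M.ι h) := ⟨hh', hz.1⟩
        exact ⟨am (M.ι h), (R.A _).2 ⟨_, harr, rfl⟩, by rw [R.tgt _ harr, R.vmι],
          by rw [R.src _ harr, R.tgt _ hz], (relm _ _ harr hz).2 rfl⟩
  · intro a b
    rw [R'.rel]
    constructor
    · rintro ⟨g, hg, hg2, rfl, rfl⟩
      have hpi : (M.slide h hh leg).π.symm g = (M.slπ h).symm g := rfl
      rw [hpi] at hg2 ⊢
      rcases M.cyc_cases hh g with rfl | rfl | ⟨z, h1, h2, rfl⟩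
      · rw [M.slπ_symm_y hh] at hg2 ⊢
        rw [amy]
        rw [M.arr_y hh leg] at hg
        have e1 : M.ι h = M.cyc h (M.π.symm (M.ι h)) := (M.cyc_y' hh).symm
        rw [e1] at hg2 ⊢
        rw [amz _ d4 d2]
        rw [M.arr_cyc hh leg d4 d2] at hg2
        have harr : M.Arr (M.ι h) := ⟨hh', hg2.1⟩
        refine Or.inr (Or.inr ⟨(R.A _).2 ⟨_, hg, rfl⟩, (R.A _).2 ⟨_, hg2, rfl⟩, R.tgt _ hg,
          am (M.ι h), (R.A _).2 ⟨_, harr, rfl⟩, ?_, ?_, ?_, ?_⟩)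
        · intro H; exact hh (R.aminj _ _ harr hg H)
        · rw [R.tgt _ harr, R.vmι]
        · rw [R.src _ harr, R.tgt _ hg2]
        · exact (relm _ _ harr hg2).2 rfl
      · rw [M.slπ_symm_y' hh] at hg2 ⊢
        rw [amy']
        rw [M.arr_y' hh leg] at hg
        have e1 : h = M.cyc h (M.π.symm h) := (M.cyc_y hh).symm
        have e2 : am' h = am (M.π.symm h) := by
          conv_lhs => rw [e1]
          exact amz _ d1 d3
        rw [e2]
        have hg3 : M.Arr (M.π.symm h) := by
          rw [← M.arr_cyc hh leg d1 d3, M.cyc_y hh]; exact hg2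
        have harr : M.Arr h := ⟨hh, hg3.1⟩
        refine Or.inr (Or.inr ⟨(R.A _).2 ⟨_, hg, rfl⟩, (R.A _).2 ⟨_, hg3, rfl⟩,
          (by rw [R.tgt _ hg, R.vmι]),
          am h, (R.A _).2 ⟨_, harr, rfl⟩, ?_, R.tgt _ harr, ?_, ?_⟩)
        · intro H; exact hh (R.aminj _ _ harr hg H).symm
        · rw [R.src _ harr, R.tgt _ hg3]
        · exact (relm _ _ harr hg3).2 rfl
      · rw [M.slπ_symm_cyc] at hg2 ⊢
        rw [amz z h1 h2]
        rw [M.arr_cyc hh leg h1 h2] at hg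
        by_cases c1 : M.π.symm z = h
        · rw [c1, M.cyc_h hh] at hg2 ⊢
          rw [M.arr_y' hh leg] at hg2
          rw [amy']
          refine Or.inr (Or.inl ⟨(R.A _).2 ⟨_, hg, rfl⟩, (R.A _).2 ⟨_, hg2, rfl⟩,
            (sgx z hg).2 (Or.inl c1), (tgx _ hg2).2 (Or.inr rfl), ?_⟩)
          rw [relm _ _ hg hg2, c1]; exact hh
        by_cases c2 : M.π.symm z = M.ι h
        · rw [c2, M.cyc_h' hh] at hg2 ⊢
          rw [M.arr_y hh leg] at hg2
          rw [amy]
          refine Or.inr (Or.inl ⟨(R.A _).2 ⟨_, hg, rfl⟩, (R.A _).2 ⟨_, hg2, rfl⟩,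
            (sgx z hg).2 (Or.inr c2), (tgx _ hg2).2 (Or.inl rfl), ?_⟩)
          rw [relm _ _ hg hg2, c2]; exact hh.symm
        rw [amz _ c1 c2]
        rw [M.arr_cyc hh leg c1 c2] at hg2
        refine Or.inl ⟨(relm _ _ hg hg2).2 rfl, ?_, ?_⟩
        · rw [Ne, tgx z hg]; tauto
        · rw [Ne, sgx z hg]; tauto
    · rintro (⟨hr, ht, hs⟩ | ⟨ha, hb, hs, ht, hr⟩ | ⟨ha, hb, ht, c, hc, hca, hct, hcs, hr⟩)
      · obtain ⟨z, hz, hz2, rfl, rfl⟩ := (R.rel _ _).1 hr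
        rw [Ne, tgx z hz] at ht
        rw [Ne, sgx z hz] at hs
        push Not at ht hs
        refine ⟨M.cyc h z, (M.arr_cyc hh leg ht.1 ht.2).2 hz, ?_, (amz z ht.1 ht.2).symm, ?_⟩
        · show Mod.Arr _ ((M.slπ h).symm _)
          rw [M.slπ_symm_cyc]; exact (M.arr_cyc hh leg hs.1 hs.2).2 hz2
        · show _ = am' ((M.slπ h).symm _)
          rw [M.slπ_symm_cyc, amz _ hs.1 hs.2]
      · obtain ⟨z, hz, rfl⟩ := (R.A _).1 ha
        have hz1 := (sgx z hz).1 hs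
        obtain ⟨n1, n2⟩ := hne' z hz1
        refine ⟨M.cyc h z, (M.arr_cyc hh leg n1 n2).2 hz, ?_, (amz z n1 n2).symm, ?_⟩
        · show Mod.Arr _ ((M.slπ h).symm _)
          rw [M.slπ_symm_cyc]
          rcases tgxc b hb ht with ⟨rfl, harr⟩ | ⟨rfl, harr⟩ <;>
            rw [relm _ _ hz harr] at hr <;> rcases hz1 with h1 | h1
          · exact absurd h1.symm hr
          · rw [h1, M.cyc_h' hh]; exact (M.arr_y hh leg).2 harr
          · rw [h1, M.cyc_h hh]; exact (M.arr_y' hh leg).2 harr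
          · exact absurd h1.symm hr
        · show _ = am' ((M.slπ h).symm _)
          rw [M.slπ_symm_cyc]
          rcases tgxc b hb ht with ⟨rfl, harr⟩ | ⟨rfl, harr⟩ <;>
            rw [relm _ _ hz harr] at hr <;> rcases hz1 with h1 | h1
          · exact absurd h1.symm hr
          · rw [h1, M.cyc_h' hh, amy]
          · rw [h1, M.cyc_h hh, amy']
          · exact absurd h1.symm hr
      · obtain ⟨w, hw, rfl⟩ := (R.A _).1 hb
        rcases tgxc a ha ht with ⟨rfl, harr⟩ | ⟨rfl, harr⟩ <;>
          rcases tgxc c hc hct with ⟨rfl, harrc⟩ | ⟨rfl, harrc⟩ <;>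
          rw [relm _ _ harrc hw] at hr <;> subst hr
        · exact absurd rfl hca
        · have hq : (M.slide h hh leg).π.symm (M.π.symm h) = M.cyc h (M.π.symm (M.ι h)) := by
            show (M.slπ h).symm _ = _
            rw [M.slπ_symm_y hh, M.cyc_y' hh]
          refine ⟨M.π.symm h, (M.arr_y hh leg).2 harr, ?_, amy.symm, ?_⟩
          · rw [hq, M.arr_cyc hh leg d4 d2]; exact hw
          · rw [hq, amz _ d4 d2]
        · have hq : (M.slide h hh leg).π.symm (M.π.symm (M.ι h)) = M.cyc h (M.π.symm h) := by
            show (M.slπ h).symm _ = _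
            rw [M.slπ_symm_y' hh, M.cyc_y hh]
          refine ⟨M.π.symm (M.ι h), (M.arr_y' hh leg).2 harr, ?_, amy'.symm, ?_⟩
          · rw [hq, M.arr_cyc hh leg d1 d3]; exact hw
          · rw [hq, amz _ d1 d3]
        · exact absurd rfl hca

theorem Rep.step {Q : QuivRel} {M M' : Mod X} {vm am : X → ℕ} (R : Rep Q M vm am)
    (hne : Nonempty X) (hs : Mod.Step M M') :
    ∃ Q' am', RefStep Q Q' ∧ Rep Q' M' vm am' := by
  rcases hs with ⟨h, hh, leg, rfl⟩ | ⟨h, hh, leg, rfl⟩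
  · obtain ⟨Q', am', h1, h2⟩ := R.slide hne h hh leg
    exact ⟨Q', am', Or.inl ⟨_, h1⟩, h2⟩
  · obtain ⟨Q', am', h1, h2⟩ := R.op.slide hne h hh leg
    refine ⟨opQR Q', _, Or.inr (Or.inl ⟨vm h, ?_⟩), h2.op⟩
    rw [IsCoreflection, opQR_opQR]; exact h1

theorem Rep.reach {Q : QuivRel} {M M' : Mod X} {vm am : X → ℕ} (R : Rep Q M vm am)
    (hne : Nonempty X) (hs : Mod.Reach M M') :
    ∃ Q' am', RefEquiv Q Q' ∧ Rep Q' M' vm am' := by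
  induction hs with
  | refl => exact ⟨Q, am, .refl, R⟩
  | tail _ h2 ih =>
    obtain ⟨Q1, am1, h3, R1⟩ := ih
    obtain ⟨Q2, am2, h4, R2⟩ := R1.step hne h2
    exact ⟨Q2, am2, h3.tail h4, R2⟩

end GentleQuiv

namespace GentleQuiv
set_option linter.unusedSectionVars false
set_option linter.deprecated false
set_option linter.unusedVariables false

variable {X : Type} [Fintype X] [DecidableEq X]

namespace Mod

/-- run length from a gap -/
noncomputable def r (M : Mod X) (n : X) : ℕ :=
  sInf {k | 1 ≤ k ∧ M.ι ((M.π ^ k) n) = (M.π ^ k) n}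

/-- next gap -/
noncomputable def nu (M : Mod X) (n : X) : X := (M.π ^ (M.r n)) n

theorem r_mem (M : Mod X) {n : X} (hn : M.ι n = n) :
    M.r n ∈ {k | 1 ≤ k ∧ M.ι ((M.π ^ k) n) = (M.π ^ k) n} := by
  apply Nat.sInf_mem
  refine ⟨orderOf M.π, orderOf_pos M.π, ?_⟩
  rw [pow_orderOf_eq_one]; exact hn

theorem nu_gap (M : Mod X) {n : X} (hn : M.ι n = n) : M.ι (M.nu n) = M.nu n := (M.r_mem hn).2

theorem r_min (M : Mod X) {n : X} {j : ℕ} (h1 : 1 ≤ j) (h2 : j < M.r n) :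
    M.ι ((M.π ^ j) n) ≠ (M.π ^ j) n := fun h => Nat.notMem_of_lt_sInf h2 ⟨h1, h⟩

theorem r_unique (M : Mod X) {n : X} {k : ℕ} (h1 : 1 ≤ k)
    (h2 : M.ι ((M.π ^ k) n) = (M.π ^ k) n)
    (h3 : ∀ j, 1 ≤ j → j < k → M.ι ((M.π ^ j) n) ≠ (M.π ^ j) n) : M.r n = k := by
  apply le_antisymm
  · exact Nat.sInf_le ⟨h1, h2⟩
  · by_contra hc
    push Not at hc
    have hm : M.r n ∈ {k | 1 ≤ k ∧ M.ι ((M.π ^ k) n) = (M.π ^ k) n} :=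
      Nat.sInf_mem ⟨k, h1, h2⟩
    exact h3 _ hm.1 hc hm.2

theorem r_ge_two (M : Mod X) {n : X} (hn : M.ι n = n) : 2 ≤ M.r n := by
  have h := M.r_mem hn
  by_contra hc
  have h1 : M.r n = 1 := by have := h.1; omega
  have h2 := h.2
  rw [h1] at h2
  simp at h2
  exact M.gap_next hn h2

theorem op_pow (M : Mod X) (k : ℕ) (e : X) : (M.op.π ^ k) e = (M.π ^ k).symm e := by
  have : M.op.π = M.π⁻¹ := rfl
  rw [this, inv_pow]; rfl

theorem op_run (M : Mod X) {n : X} (hn : M.ι n = n) :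
    M.op.r (M.nu n) = M.r n ∧ M.op.nu (M.nu n) = n := by
  have key : ∀ j, j ≤ M.r n → (M.op.π ^ j) (M.nu n) = (M.π ^ (M.r n - j)) n := by
    intro j hj
    rw [op_pow, Equiv.symm_apply_eq, nu, ← Equiv.Perm.mul_apply, ← pow_add]
    congr 2; omega
  have h1 : M.op.r (M.nu n) = M.r n := by
    apply r_unique
    · exact (M.r_mem hn).1
    · rw [key _ le_rfl, Nat.sub_self]; exact hn
    · intro j j1 j2
      rw [key _ j2.le]
      exact M.r_min (by omega) (by omega)
  refine ⟨h1, ?_⟩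
  rw [nu, h1, key _ le_rfl]; simp

theorem nu_op_nu (M : Mod X) {n : X} (hn : M.ι n = n) : M.nu (M.op.nu n) = n := by
  have := (M.op.op_run (n := n) hn).2
  rwa [op_op] at this

theorem r_op (M : Mod X) {n : X} (hn : M.ι n = n) : M.op.r n = M.r (M.op.nu n) := by
  have := (M.op.op_run (n := n) hn).1
  rw [op_op] at this
  exact this.symm

theorem nu_inj (M : Mod X) {n m : X} (hn : M.ι n = n) (hm : M.ι m = m) (h : M.nu n = M.nu m) :
    n = m := by
  rw [← (M.op_run hn).2, h, (M.op_run hm).2]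

/-- legality criterion -/
theorem legal_of (M : Mod X) {h : X}
    (h1 : M.ι (M.π.symm h) = M.π.symm h → M.ι (M.π (M.ι h)) = M.π (M.ι h))
    (h2 : M.ι (M.π.symm (M.ι h)) = M.π.symm (M.ι h) → M.ι (M.π h) = M.π h) : M.Legal h := by
  constructor
  · intro g
    have e1 := M.node_step (M.π.symm h)
    rw [g] at e1
    simp at e1
    rw [← M.gap_node _ g, ← e1, ← M.node_step h, M.gap_node _ (h1 g)]
  · intro g
    have e1 := M.node_step (M.π.symm (M.ι h))
    have e2 := M.node_step (M.ι h)
    rw [g] at e1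
    simp at e1
    rw [M.inv] at e2
    rw [← M.gap_node _ g, ← e1, ← e2, M.gap_node _ (h2 g)]

theorem slide_pow (M : Mod X) (h : X) (k : ℕ) (e : X) :
    (M.slπ h ^ k) (M.cyc h e) = M.cyc h ((M.π ^ k) e) := by
  induction k with
  | zero => rfl
  | succ k ih => rw [pow_succ', pow_succ', Equiv.Perm.mul_apply, ih, slπ_cyc, Equiv.Perm.mul_apply]

/-- non-leaf slides fix gaps under `cyc` -/
theorem cyc_gap_nonleaf (M : Mod X) {h : X} (hh : M.ι h ≠ h)
    (hy : M.ι (M.π.symm h) ≠ M.π.symm h) (hy' : M.ι (M.π.symm (M.ι h)) ≠ M.π.symm (M.ι h))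
    {n : X} (hn : M.ι n = n) : M.cyc h n = n := by
  apply M.cyc_else
  · rintro rfl; exact hh hn
  · rintro rfl; rw [M.inv] at hn; exact hh hn.symm
  · rintro rfl; exact hy hn
  · rintro rfl; exact hy' hn

theorem cyc_gap_iff (M : Mod X) {h : X} (hh : M.ι h ≠ h)
    (hy : M.ι (M.π.symm h) ≠ M.π.symm h) (hy' : M.ι (M.π.symm (M.ι h)) ≠ M.π.symm (M.ι h))
    (e : X) : M.ι (M.cyc h e) = M.cyc h e ↔ M.ι e = e := by
  constructor
  · intro H
    have := M.cyc_gap_nonleaf hh hy hy' H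
    rw [← (M.cyc h).injective this]; exact H
  · intro H; rw [M.cyc_gap_nonleaf hh hy hy' H]; exact H

theorem run_nonleaf (M : Mod X) {h : X} (hh : M.ι h ≠ h) (leg : M.Legal h)
    (hy : M.ι (M.π.symm h) ≠ M.π.symm h) (hy' : M.ι (M.π.symm (M.ι h)) ≠ M.π.symm (M.ι h))
    {n : X} (hn : M.ι n = n) :
    (M.slide h hh leg).r n = M.r n ∧ (M.slide h hh leg).nu n = M.nu n := by
  have key : ∀ k, ((M.slide h hh leg).π ^ k) n = M.cyc h ((M.π ^ k) n) := by
    intro k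
    have := M.slide_pow h k n
    rw [M.cyc_gap_nonleaf hh hy hy' hn] at this
    exact this
  have h1 : (M.slide h hh leg).r n = M.r n := by
    apply r_unique
    · exact (M.r_mem hn).1
    · rw [key]; exact (M.cyc_gap_iff hh hy hy' _).2 (M.r_mem hn).2
    · intro j j1 j2
      rw [key]
      exact fun H => M.r_min j1 j2 ((M.cyc_gap_iff hh hy hy' _).1 H)
  refine ⟨h1, ?_⟩
  rw [nu, h1, key]
  exact M.cyc_gap_nonleaf hh hy hy' (M.r_mem hn).2

/-- colour of gaps is preserved by slides -/
theorem cyc_symm_gap (M : Mod X) {h : X} (hh : M.ι h ≠ h) (leg : M.Legal h)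
    {n : X} (hn : M.ι n = n) : ∃ m, M.cyc h m = n ∧ M.π.SameCycle m n := by
  by_cases h3 : n = M.π.symm h
  · subst h3
    refine ⟨M.ι h, M.cyc_h' hh, ?_⟩
    rw [← leg.1 hn]; exact (Equiv.Perm.SameCycle.refl _ _).apply_right
  by_cases h4 : n = M.π.symm (M.ι h)
  · subst h4
    refine ⟨h, M.cyc_h hh, ?_⟩
    rw [← leg.2 hn]; exact (Equiv.Perm.SameCycle.refl _ _).apply_right
  refine ⟨n, M.cyc_else ?_ ?_ h3 h4, Equiv.Perm.SameCycle.refl _ _⟩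
  · rintro rfl; exact hh hn
  · rintro rfl; rw [M.inv] at hn; exact hh hn.symm

theorem slide_same (M : Mod X) (h : X) (e f : X) :
    (M.slπ h).SameCycle (M.cyc h e) (M.cyc h f) ↔ M.π.SameCycle e f := by
  rw [slπ, Equiv.Perm.sameCycle_conj]; simp

theorem col_slide (M : Mod X) {h : X} (hh : M.ι h ≠ h) (leg : M.Legal h)
    {n m : X} (hn : M.ι n = n) (hm : M.ι m = m) :
    (M.slide h hh leg).π.SameCycle n m ↔ M.π.SameCycle n m := by
  obtain ⟨n', h1, h2⟩ := M.cyc_symm_gap hh leg hn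
  obtain ⟨m', h3, h4⟩ := M.cyc_symm_gap hh leg hm
  have := M.slide_same h n' m'
  rw [h1, h3] at this
  refine this.trans ?_
  constructor
  · intro H; exact h2.symm.trans (H.trans h4)
  · intro H; exact h2.trans (H.trans h4.symm)

theorem op_same (M : Mod X) (e f : X) : M.op.π.SameCycle e f ↔ M.π.SameCycle e f :=
  Equiv.Perm.sameCycle_inv

/-- gapless element -/
def Gapless (M : Mod X) (e : X) : Prop := ∀ n, M.ι n = n → ¬ M.π.SameCycle n e

theorem gapless_slide (M : Mod X) {h : X} (hh : M.ι h ≠ h) (leg : M.Legal h) (e : X) :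
    (M.slide h hh leg).Gapless (M.cyc h e) ↔ M.Gapless e := by
  have : ∀ n, M.ι n = n → ((M.slide h hh leg).π.SameCycle n (M.cyc h e) ↔ M.π.SameCycle n e) := by
    intro n hn
    obtain ⟨n', h1, h2⟩ := M.cyc_symm_gap hh leg hn
    rw [← h1]
    refine (M.slide_same h n' e).trans ?_
    constructor
    · intro H; rw [h1]; exact h2.symm.trans H
    · intro H; rw [h1] at H; exact h2.trans H
  constructor
  · intro H n hn hs; exact H n hn ((this n hn).2 hs)
  · intro H n hn hs; exact H n hn ((this n hn).1 hs)

/-- The invariants I1, I3, I4. -/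
structure Inv (M : Mod X) : Prop where
  tri : ∀ e, M.Gapless e → (M.π ^ 3) e = e
  count : 3 * {e | M.ι e ≠ e}.ncard = 6 * {e | M.ι e = e}.ncard + 2 * {e | M.Gapless e}.ncard
  two : ∃ n m, M.ι n = n ∧ M.ι m = m ∧ ¬ M.π.SameCycle n m ∧
    ∀ k, M.ι k = k → M.π.SameCycle n k ∨ M.π.SameCycle m k

theorem Inv.slide {M : Mod X} (I : M.Inv) {h : X} (hh : M.ι h ≠ h) (leg : M.Legal h) :
    (M.slide h hh leg).Inv where
  tri := by
    intro e he
    obtain ⟨f, rfl⟩ := (M.cyc h).surjective e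
    rw [M.gapless_slide] at he
    show (M.slπ h ^ 3) _ = _
    rw [M.slide_pow, I.tri f he]
  count := by
    have h1 := I.count
    have : {e | (M.slide h hh leg).Gapless e}.ncard = {e | M.Gapless e}.ncard := by
      rw [← Set.ncard_image_of_injective {e | M.Gapless e} (M.cyc h).injective]
      congr 1
      ext e
      obtain ⟨f, rfl⟩ := (M.cyc h).surjective e
      simp [M.gapless_slide]
    rw [this]; exact h1
  two := by
    obtain ⟨n, m, hn, hm, hnm, hk⟩ := I.two
    exact ⟨n, m, hn, hm, fun H => hnm ((M.col_slide hh leg hn hm).1 H), fun k gk =>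
      (hk k gk).imp (fun H => (M.col_slide hh leg hn gk).2 H)
        (fun H => (M.col_slide hh leg hm gk).2 H)⟩

theorem gapless_op (M : Mod X) (e : X) : M.op.Gapless e ↔ M.Gapless e := by
  unfold Gapless; simp only [op_same]; rfl

theorem Inv.op {M : Mod X} (I : M.Inv) : M.op.Inv where
  tri := by
    intro e he
    rw [gapless_op] at he
    rw [op_pow, Equiv.symm_apply_eq, I.tri e he]
  count := by
    have := I.count
    simp only [gapless_op]; exact this
  two := by
    obtain ⟨n, m, hn, hm, hnm, hk⟩ := I.two
    exact ⟨n, m, hn, hm, fun H => hnm ((M.op_same n m).1 H), fun k gk =>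
      (hk k gk).imp (fun H => (M.op_same n k).2 H) (fun H => (M.op_same m k).2 H)⟩

theorem Step.inv {M M' : Mod X} (h : Step M M') (I : M.Inv) : M'.Inv := by
  rcases h with ⟨h, hh, leg, rfl⟩ | ⟨h, hh, leg, rfl⟩
  · exact I.slide hh leg
  · exact (I.op.slide hh leg).op

theorem Reach.inv {M M' : Mod X} (h : Reach M M') (I : M.Inv) : M'.Inv := by
  induction h with
  | refl => exact I
  | tail _ h2 ih => exact h2.inv ih

theorem Step.iota {M M' : Mod X} (h : Step M M') : M'.ι = M.ι := by
  rcases h with ⟨h, hh, leg, rfl⟩ | ⟨h, hh, leg, rfl⟩ <;> rfl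

theorem Reach.iota {M M' : Mod X} (h : Reach M M') : M'.ι = M.ι := by
  induction h with
  | refl => rfl
  | tail _ h2 ih => rw [h2.iota, ih]

theorem Reach.col {M M' : Mod X} (h : Reach M M') {n m : X} (hn : M.ι n = n) (hm : M.ι m = m) :
    M'.π.SameCycle n m ↔ M.π.SameCycle n m := by
  induction h with
  | refl => rfl
  | @tail M1 M2 h1 h2 ih =>
    rw [← ih]
    have hn' : M1.ι n = n := by rw [Reach.iota h1]; exact hn
    have hm' : M1.ι m = m := by rw [Reach.iota h1]; exact hm
    rcases h2 with ⟨h, hh, leg, rfl⟩ | ⟨h, hh, leg, rfl⟩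
    · exact M1.col_slide hh leg hn' hm'
    · rw [op_same, M1.op.col_slide hh leg hn' hm', op_same]

theorem nu_same (M : Mod X) (n : X) : M.π.SameCycle n (M.nu n) := by
  exact (Equiv.Perm.sameCycle_pow_right).2 (Equiv.Perm.SameCycle.refl _ _)

theorem same_nu (M : Mod X) : ∀ (k : ℕ) (n : X), M.ι n = n → M.ι ((M.π ^ k) n) = (M.π ^ k) n →
    ∃ j, (M.π ^ k) n = M.nu^[j] n := by
  intro k
  induction k using Nat.strong_induction_on with
  | _ k ih =>
    intro n hn hk
    rcases Nat.eq_zero_or_pos k with rfl | hpos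
    · exact ⟨0, rfl⟩
    have hle : M.r n ≤ k := Nat.sInf_le ⟨hpos, hk⟩
    have h2 := M.r_ge_two hn
    have e : (M.π ^ k) n = (M.π ^ (k - M.r n)) (M.nu n) := by
      rw [nu, ← Equiv.Perm.mul_apply, ← pow_add]; congr 2; omega
    rw [e] at hk ⊢
    obtain ⟨j, hj⟩ := ih (k - M.r n) (by omega) _ (M.nu_gap hn) hk
    exact ⟨j + 1, by rw [hj]; rfl⟩

theorem same_iff_nu (M : Mod X) {n m : X} (hn : M.ι n = n) (hm : M.ι m = m)
    (h : M.π.SameCycle n m) : ∃ j, m = M.nu^[j] n := by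
  obtain ⟨k, hk⟩ := h.exists_nat_pow_eq
  obtain ⟨j, hj⟩ := M.same_nu k n hn (by rw [hk]; exact hm)
  exact ⟨j, by rw [← hj, hk]⟩

theorem nu_iter_gap (M : Mod X) {n : X} (hn : M.ι n = n) (j : ℕ) : M.ι (M.nu^[j] n) = M.nu^[j] n := by
  induction j with
  | zero => exact hn
  | succ j ih => rw [Function.iterate_succ_apply']; exact M.nu_gap ih

theorem nu_iter_same (M : Mod X) (n : X) (j : ℕ) : M.π.SameCycle n (M.nu^[j] n) := by
  induction j with
  | zero => exact .refl _ _
  | succ j ih => rw [Function.iterate_succ_apply']; exact ih.trans (M.nu_same _)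

end Mod
end GentleQuiv

namespace GentleQuiv
set_option linter.unusedSectionVars false
set_option linter.deprecated false
set_option linter.unusedVariables false

variable {X : Type} [Fintype X] [DecidableEq X]

namespace Mod

/-- Transfer of one unit of run length from `u` to `v`. -/
structure Trans (M M' : Mod X) (u v : X) : Prop where
  reach : Reach M M'
  nu : ∀ n, M.ι n = n → M'.nu n = M.nu n
  ru : M'.r u + 1 = M.r u
  rv : M'.r v = M.r v + 1
  ro : ∀ n, M.ι n = n → n ≠ u → n ≠ v → M'.r n = M.r n

/-- Protected ends of chains. -/
def Prot (M M' : Mod X) (v : X) : Prop :=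
  ∀ f1 f2 v1, M.ι v1 = v1 → v1 ≠ v → M.ι f1 ≠ f1 → M.ι f2 ≠ f2 → M.π f1 = f2 → M.π f2 = v1 →
    M.node f1 ≠ v → M.node f2 ≠ v →
    M'.π f1 = f2 ∧ M'.π f2 = v1 ∧ M'.node f1 = M.node f1 ∧ M'.node f2 = M.node f2

theorem node_iota (M : Mod X) (e : X) : M.node (M.ι e) = M.node (M.π e) := by
  have := M.node_step (M.ι e)
  rw [M.inv] at this; exact this.symm

theorem prot_slide (M : Mod X) {v : X} (hv : M.ι v = v) (leg : M.Legal (M.π.symm v)) :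
    Prot M (M.slide (M.π.symm v) (M.gap_prev hv) leg) v := by
  intro f1 f2 v1 g1 n1 g2 g3 p1 p2 nd1 nd2
  have hh := M.gap_prev hv
  set h := M.π.symm v with hdef
  have hpi : M.π h = v := by simp [hdef]
  have hh' : M.ι (M.ι h) ≠ M.ι h := by rw [M.inv]; exact hh.symm
  obtain ⟨d1, d2, d3, d4, d5⟩ := M.distinct hh
  have nh' : M.node (M.ι h) = v := by rw [M.node_iota, hpi, M.gap_node _ hv]
  have y1 : M.π (M.π.symm h) = h := by simp
  have y2 : M.π (M.π.symm (M.ι h)) = M.ι h := by simp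
  have a1 : f1 ≠ h := by rintro rfl; rw [hpi] at p1; rw [← p1] at g3; exact g3 hv
  have a2 : f1 ≠ M.ι h := by rintro rfl; exact nd1 nh'
  have a3 : f2 ≠ h := by rintro rfl; rw [hpi] at p2; exact n1 p2.symm
  have a4 : f2 ≠ M.ι h := by rintro rfl; exact nd2 nh'
  have a5 : f1 ≠ M.π.symm h := by rintro rfl; rw [y1] at p1; exact a3 p1.symm
  have a6 : f1 ≠ M.π.symm (M.ι h) := by rintro rfl; rw [y2] at p1; exact a4 p1.symm
  have a7 : f2 ≠ M.π.symm h := by rintro rfl; rw [y1] at p2; rw [← p2] at g1; exact hh g1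
  have a8 : f2 ≠ M.π.symm (M.ι h) := by rintro rfl; rw [y2] at p2; rw [← p2] at g1; exact hh' g1
  have b1 : v1 ≠ h := by rintro rfl; exact hh g1
  have b2 : v1 ≠ M.ι h := by rintro rfl; exact hh' g1
  have b3 : v1 ≠ M.π.symm h := by
    rintro rfl
    have := leg.1 g1
    have := (M.π.injective (this.trans p2.symm))
    exact a4 this.symm
  have b4 : v1 ≠ M.π.symm (M.ι h) := by
    rintro rfl
    have := leg.2 g1
    rw [hpi] at this; exact n1 this.symm
  refine ⟨?_, ?_, ?_, ?_⟩
  · show M.slπ h f1 = _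
    rw [M.slπ_else a1 a2 a5 a6, p1, M.cyc_else a3 a4 a7 a8]
  · show M.slπ h f2 = _
    rw [M.slπ_else a3 a4 a7 a8, p2, M.cyc_else b1 b2 b3 b4]
  · show M.slnode h f1 = _
    simp [slnode, a1, a2]
  · show M.slnode h f2 = _
    simp [slnode, a3, a4]

theorem Prot.trans {M M1 M2 : Mod X} {v : X} (hi : M1.ι = M.ι) (h1 : Prot M M1 v) (h2 : Prot M1 M2 v) :
    Prot M M2 v := by
  intro f1 f2 v1 g1 n1 g2 g3 p1 p2 nd1 nd2
  obtain ⟨q1, q2, q3, q4⟩ := h1 f1 f2 v1 g1 n1 g2 g3 p1 p2 nd1 nd2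
  obtain ⟨s1, s2, s3, s4⟩ := h2 f1 f2 v1 (by rw [hi]; exact g1) n1 (by rw [hi]; exact g2)
    (by rw [hi]; exact g3) q1 q2 (by rw [q3]; exact nd1) (by rw [q4]; exact nd2)
  exact ⟨s1, s2, s3.trans q3, s4.trans q4⟩

/-- The leaf slide performing the transfer. -/
theorem leaf_slide (M : Mod X) {u v : X} (hu : M.ι u = u) (huv : u ≠ v) (hv : M.nu u = v)
    (hr : 3 ≤ M.r u) (hy' : M.π.symm (M.ι (M.π.symm v)) = v) (hgv : M.ι v = v)
    (leg : M.Legal (M.π.symm v)) :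
    Trans M (M.slide (M.π.symm v) (M.gap_prev hgv) leg) u v := by
  have hh := M.gap_prev hgv
  set h := M.π.symm v with hdef
  have hpi : M.π h = v := by simp [hdef]
  have hh' : M.ι (M.ι h) ≠ M.ι h := by rw [M.inv]; exact hh.symm
  have hpv : M.π v = M.ι h := by rw [← hy']; simp
  have hy : M.ι (M.π.symm h) ≠ M.π.symm h := by
    have e : M.π.symm h = (M.π ^ (M.r u - 2)) u := by
      rw [Equiv.symm_apply_eq, Equiv.symm_apply_eq, ← hv, nu, ← Equiv.Perm.mul_apply,
        ← Equiv.Perm.mul_apply, mul_assoc, ← pow_succ', ← pow_succ']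
      congr 2; omega
    rw [e]; exact M.r_min (by omega) (by omega)
  have cv : M.cyc h h = v := by rw [M.cyc_h hh, hy']
  have cv2 : M.cyc h v = M.ι h := by
    have := M.cyc_y' hh; rwa [hy'] at this
  have cg : ∀ n, M.ι n = n → n ≠ v → M.cyc h n = n := by
    intro n hn hnv
    apply M.cyc_else
    · rintro rfl; exact hh hn
    · rintro rfl; exact hh' hn
    · rintro rfl; exact hy hn
    · rw [hy']; exact hnv
  have gi : ∀ e, M.ι (M.cyc h e) = M.cyc h e ↔ (e = h ∨ (M.ι e = e ∧ e ≠ v)) := by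
    intro e
    constructor
    · intro H
      by_cases h1 : M.cyc h e = v
      · left; rw [← cv] at h1; exact (M.cyc h).injective h1
      · right
        have := cg _ H h1
        have := (M.cyc h).injective this
        rw [← this]; exact ⟨H, h1⟩
    · rintro (rfl | ⟨h1, h2⟩)
      · rw [cv]; exact hgv
      · rw [cg e h1 h2]; exact h1
  have keyn : ∀ n, M.ι n = n → n ≠ v → ∀ k,
      ((M.slide h hh leg).π ^ k) n = M.cyc h ((M.π ^ k) n) := by
    intro n hn hnv k
    have := M.slide_pow h k n
    rw [cg n hn hnv] at this
    exact this
  have keyv : ∀ k, ((M.slide h hh leg).π ^ (k + 1)) v = M.cyc h ((M.π ^ k) v) := by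
    intro k
    have := M.slide_pow h (k + 1) h
    rw [cv, pow_succ M.π, Equiv.Perm.mul_apply, hpi] at this
    exact this
  have neh : ∀ n, M.ι n = n → M.nu n ≠ v → ∀ j, j < M.r n → (M.π ^ j) n ≠ h := by
    intro n hn hnv j hj he
    have h1 : (M.π ^ (j + 1)) n = v := by rw [pow_succ', Equiv.Perm.mul_apply, he, hpi]
    rcases Nat.lt_or_ge (j + 1) (M.r n) with h2 | h2
    · exact M.r_min (by omega) h2 (by rw [h1]; exact hgv)
    · have : j + 1 = M.r n := by omega
      apply hnv; rw [nu, ← this]; exact h1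
  have nuv : M.nu v ≠ v := by
    intro H; exact huv (M.nu_inj hu hgv (by rw [hv, H]))
  have hru : (M.slide h hh leg).r u = M.r u - 1 := by
    apply r_unique
    · omega
    · show M.ι _ = _
      rw [keyn u hu huv, gi]
      left
      rw [hdef, eq_comm, Equiv.symm_apply_eq, ← hv, nu, ← Equiv.Perm.mul_apply, ← pow_succ']
      congr 2; omega
    · intro j j1 j2
      show M.ι _ ≠ _
      rw [keyn u hu huv, Ne, gi]
      rintro (H | ⟨H, -⟩)
      · have h1 : (M.π ^ (j + 1)) u = v := by rw [pow_succ', Equiv.Perm.mul_apply, H, hpi]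
        exact M.r_min (n := u) (j := j + 1) (by omega) (by omega) (by rw [h1]; exact hgv)
      · exact M.r_min j1 (by omega) H
  have hrv : (M.slide h hh leg).r v = M.r v + 1 := by
    have hv2 := M.r_ge_two hgv
    apply r_unique
    · omega
    · show M.ι _ = _
      rw [keyv, gi]
      right; exact ⟨M.nu_gap hgv, nuv⟩
    · intro j j1 j2
      show M.ι _ ≠ _
      obtain ⟨i, rfl⟩ : ∃ i, j = i + 1 := ⟨j - 1, by omega⟩
      rw [keyv, Ne, gi]
      rintro (H | ⟨H, H2⟩)
      · exact neh v hgv nuv i (by omega) H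
      · rcases Nat.eq_zero_or_pos i with rfl | hi
        · exact H2 rfl
        · exact M.r_min hi (by omega) H
  have hro : ∀ n, M.ι n = n → n ≠ u → n ≠ v → (M.slide h hh leg).r n = M.r n := by
    intro n hn n1 n2
    have nun : M.nu n ≠ v := by
      intro H; exact n1 (M.nu_inj hn hu (by rw [hv, H]))
    apply r_unique
    · exact (M.r_mem hn).1
    · show M.ι _ = _
      rw [keyn n hn n2, gi]
      right; exact ⟨M.nu_gap hn, nun⟩
    · intro j j1 j2
      show M.ι _ ≠ _
      rw [keyn n hn n2, Ne, gi]
      rintro (H | ⟨H, H2⟩)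
      · exact neh n hn nun j j2 H
      · exact M.r_min j1 j2 H
  refine ⟨Reach.slide _ _ _ _, ?_, (by rw [hru]; omega), hrv, hro⟩
  intro n hn
  by_cases n1 : n = u
  · subst n1
    rw [nu, hru, keyn n hu huv, hv, ← cv]
    congr 1
    rw [hdef, eq_comm, Equiv.symm_apply_eq, ← hv, nu, ← Equiv.Perm.mul_apply, ← pow_succ']
    congr 2; omega
  by_cases n2 : n = v
  · subst n2
    rw [nu, hrv, keyv]
    exact cg _ (M.nu_gap hgv) nuv
  rw [nu, hro n hn n1 n2, keyn n hn n2]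
  apply cg _ (M.nu_gap hn)
  intro H; exact n1 (M.nu_inj hn hu (by rw [hv]; exact H))

theorem right_transfer : ∀ (D : ℕ) (M : Mod X) (u v : X), M.ι u = u → u ≠ v → M.nu u = v →
    3 ≤ M.r u → M.node (M.π.symm (M.π.symm v)) ≠ v →
    {e | M.node e = v ∧ e ≠ M.π.symm v}.ncard = D →
    ∃ M', Trans M M' u v ∧ Prot M M' v := by
  intro D
  induction D using Nat.strong_induction_on with
  | _ D ih =>
    intro M u v hu huv hv hr hp hD
    have hgv : M.ι v = v := hv ▸ M.nu_gap hu
    have hh := M.gap_prev hgv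
    have hpi : M.π (M.π.symm v) = v := by simp
    have hy : M.ι (M.π.symm (M.π.symm v)) ≠ M.π.symm (M.π.symm v) := by
      have e : M.π.symm (M.π.symm v) = (M.π ^ (M.r u - 2)) u := by
        rw [Equiv.symm_apply_eq, Equiv.symm_apply_eq]
        conv_lhs => rw [← hv]
        rw [nu, ← Equiv.Perm.mul_apply,
          ← Equiv.Perm.mul_apply, mul_assoc, ← pow_succ', ← pow_succ']
        congr 2; omega
      rw [e]; exact M.r_min (by omega) (by omega)
    have leg : M.Legal (M.π.symm v) := M.legal_of (fun H => absurd H hy) (fun _ => by rw [hpi]; exact hgv)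
    by_cases hy' : M.π.symm (M.ι (M.π.symm v)) = v
    · exact ⟨_, M.leaf_slide hu huv hv hr hy' hgv leg, M.prot_slide hgv leg⟩
    have gy' : M.ι (M.π.symm (M.ι (M.π.symm v))) ≠ M.π.symm (M.ι (M.π.symm v)) := by
      intro H; have := leg.2 H; rw [hpi] at this; exact hy' this.symm
    have hprot := M.prot_slide hgv leg
    obtain ⟨h, hdef⟩ : ∃ h, h = M.π.symm v := ⟨_, rfl⟩
    have hpi : M.π h = v := by simp [hdef]
    have hhs := hh
    rw [← hdef] at hp hh hy leg hy' gy' hD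
    have hh' : M.ι (M.ι h) ≠ M.ι h := by rw [M.inv]; exact hh.symm
    obtain ⟨d1, d2, d3, d4, d5⟩ := M.distinct hh
    have nh' : M.node (M.ι h) = v := by rw [M.node_iota, hpi, M.gap_node _ hgv]
    have hprot' : Prot M (M.slide h hh leg) v := by subst hdef; exact hprot
    have hrun := fun n hn => M.run_nonleaf hh leg hy gy' (n := n) hn
    have p1 : (M.slide h hh leg).π.symm v = M.π.symm (M.ι h) := by
      show (M.slπ h).symm v = _
      rw [Equiv.symm_apply_eq, M.slπ_y' hh, hpi, M.cyc_gap_nonleaf hh hy gy' hgv]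
    have p2 : (M.slide h hh leg).π.symm (M.π.symm (M.ι h)) = h := M.slπ_symm_y' hh
    have nodeh : (M.slide h hh leg).node h = M.node (M.π.symm h) := by
      show M.slnode h h = _; simp [slnode]
    have nodeh' : (M.slide h hh leg).node (M.ι h) = M.node (M.π.symm (M.ι h)) := by
      show M.slnode h _ = _; simp [slnode, hh]
    have nodee : ∀ e, e ≠ h → e ≠ M.ι h → (M.slide h hh leg).node e = M.node e := by
      intro e e1 e2; show M.slnode h _ = _; simp [slnode, e1, e2]
    have hlt : {e | (M.slide h hh leg).node e = v ∧ e ≠ (M.slide h hh leg).π.symm v}.ncard < D := by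
      rw [← hD, p1]
      apply Set.ncard_lt_ncard _ (Set.toFinite _)
      constructor
      · rintro e ⟨e1, e2⟩
        by_cases c1 : e = h
        · subst c1; rw [nodeh] at e1; exact absurd e1 hp
        by_cases c2 : e = M.ι h
        · subst c2; exact ⟨nh', c1⟩
        rw [nodee e c1 c2] at e1
        exact ⟨e1, c1⟩
      · intro hsub
        by_cases c : M.node (M.π.symm (M.ι h)) = v
        · exact (hsub ⟨c, d4⟩).2 rfl
        · have := (hsub ⟨nh', hh⟩).1
          rw [nodeh'] at this; exact c this
    obtain ⟨M', T, P⟩ := ih _ hlt (M.slide h hh leg) u v hu huv (by rw [(hrun u hu).2, hv])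
      (by rw [(hrun u hu).1]; exact hr) (by rw [p1, p2, nodeh]; exact hp) rfl
    refine ⟨M', ⟨(Reach.slide _ _ _ _).trans T.reach, ?_, ?_, ?_, ?_⟩, Prot.trans (M1 := M.slide h hh leg) rfl hprot' P⟩
    · intro n hn; rw [T.nu n hn, (hrun n hn).2]
    · rw [T.ru, (hrun u hu).1]
    · rw [T.rv, (hrun v hgv).1]
    · intro n hn n1 n2; rw [T.ro n hn n1 n2, (hrun n hn).1]

theorem right_tr (M : Mod X) {u v : X} (hu : M.ι u = u) (huv : u ≠ v) (hv : M.nu u = v)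
    (hr : 3 ≤ M.r u) (hp : M.node (M.π.symm (M.π.symm v)) ≠ v) :
    ∃ M', Trans M M' u v ∧ Prot M M' v :=
  right_transfer _ M u v hu huv hv hr hp rfl

/-- right transfer when `r u = 3` : pivot condition automatic -/
theorem right_tr3 (M : Mod X) {u v : X} (hu : M.ι u = u) (huv : u ≠ v) (hv : M.nu u = v)
    (hr : M.r u = 3) : ∃ M', Trans M M' u v ∧ Prot M M' v := by
  apply M.right_tr hu huv hv hr.ge
  have e : M.π.symm (M.π.symm v) = M.π u := by
    rw [Equiv.symm_apply_eq, Equiv.symm_apply_eq, ← hv, nu, hr]; rfl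
  have := M.node_step u
  rw [hu, M.gap_node u hu] at this
  rw [e, this]; exact huv

/-- left transfer -/
theorem left_tr (M : Mod X) {u w : X} (hu : M.ι u = u) (hw : M.ι w = w) (huw : M.nu w = u)
    (hne : M.nu u ≠ u) (hr : 3 ≤ M.r u) (hp : M.node (M.ι (M.π (M.π u))) ≠ u) :
    ∃ M', Trans M M' u w := by
  have h1 := M.op_run hu
  have hgn : M.ι (M.nu u) = M.nu u := M.nu_gap hu
  obtain ⟨M', T, -⟩ := M.op.right_tr (u := M.nu u) (v := u) hgn hne h1.2
    (by rw [h1.1]; exact hr) hp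
  have hi : M'.ι = M.ι := T.reach.iota
  have key : ∀ n, M.ι n = n → M'.op.nu n = M.nu n ∧ M'.op.r n = M'.r (M.nu n) := by
    intro n hn
    have h2 : M'.ι (M.nu n) = M.nu n := by rw [hi]; exact M.nu_gap hn
    have h3 := M'.op_run h2
    have h4 : M'.nu (M.nu n) = n := by
      rw [T.nu _ (M.nu_gap hn)]; exact (M.op_run hn).2
    rw [h4] at h3
    exact ⟨h3.2, h3.1⟩
  refine ⟨M'.op, ?_, ?_, ?_, ?_, ?_⟩
  · have := T.reach.op; rwa [op_op] at this
  · intro n hn; exact (key n hn).1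
  · rw [(key u hu).2, T.ru, h1.1]
  · rw [(key w hw).2, huw, T.rv, ← huw, (M.op_run hw).1]
  · intro n hn n1 n2
    rw [(key n hn).2, T.ro (M.nu n) (M.nu_gap hn), (M.op_run hn).1]
    · intro H; exact n1 (M.nu_inj hn hu H)
    · intro H; exact n2 (M.nu_inj hn hw (by rw [H, huw]))

theorem left_tr3 (M : Mod X) {u w : X} (hu : M.ι u = u) (hw : M.ι w = w) (huw : M.nu w = u)
    (hne : M.nu u ≠ u) (hr : M.r u = 3) : ∃ M', Trans M M' u w := by
  apply M.left_tr hu hw huw hne hr.ge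
  have e : M.π (M.π (M.π u)) = M.nu u := by
    rw [nu, hr]; rfl
  rw [M.node_iota, e, M.gap_node _ (M.nu_gap hu)]; exact hne

end Mod
end GentleQuiv

namespace GentleQuiv
set_option linter.unusedSectionVars false
set_option linter.deprecated false
set_option linter.unusedVariables false

variable {X : Type} [Fintype X] [DecidableEq X]

/-- Counting bound for a connected set of half-edges. -/
theorem count_core (ι s : X → X) (W E : Set X)
    (hι : ∀ e ∈ W, ι e ∈ W ∧ ι e ≠ e ∧ ι (ι e) = e) (hE : ∀ h ∈ E, h ∈ W ∧ s h ∈ W)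
    (conn : ∀ P : X → Prop, (∀ e ∈ W, P e → P (ι e)) → (∀ h ∈ E, (P (s h) ↔ P h)) →
      ∀ e ∈ W, ∀ e' ∈ W, P e → P e') : W.ncard ≤ 2 * (E.ncard + 1) := by
  classical
  rcases W.eq_empty_or_nonempty with rfl | ⟨w, hw⟩
  · simp
  let idx : X → ℕ := fun e => (Fintype.equivFin X e : ℕ)
  have idxinj : Function.Injective idx := fun a b h =>
    (Fintype.equivFin X).injective (Fin.ext h)
  let S : Set X := {e | e ∈ W ∧ idx e < idx (ι e)}
  have hS : 2 * S.ncard ≤ W.ncard := by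
    have hinj : Set.InjOn ι S := by
      intro a ha b hb hab
      rw [← (hι a ha.1).2.2, hab, (hι b hb.1).2.2]
    have h1 : (ι '' S).ncard = S.ncard := Set.ncard_image_of_injOn hinj
    have h2 : Disjoint S (ι '' S) := by
      rw [Set.disjoint_left]
      rintro a ha ⟨b, hb, rfl⟩
      have := ha.2
      rw [(hι b hb.1).2.2] at this
      have := hb.2; omega
    have h3 : (S ∪ ι '' S).ncard = S.ncard + (ι '' S).ncard := Set.ncard_union_eq h2
    have h4 : (S ∪ ι '' S).ncard ≤ W.ncard := by
      refine Set.ncard_le_ncard ?_ (Set.toFinite W)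
      rintro a (ha | ⟨b, hb, rfl⟩)
      · exact ha.1
      · exact (hι b hb.1).1
    omega
  let G : SimpleGraph W := SimpleGraph.fromRel
    (fun a b => (b : X) = ι a ∨ ((b : X) ∈ E ∧ s b = a))
  have hconn : G.Connected := by
    have key : ∀ y : W, G.Reachable ⟨w, hw⟩ y := by
      intro y
      have := conn (fun x => ∃ hx : x ∈ W, G.Reachable ⟨w, hw⟩ ⟨x, hx⟩) ?_ ?_ w hw y y.2
        ⟨hw, SimpleGraph.Reachable.refl _⟩
      · exact this.2
      · rintro e he ⟨_, hr⟩
        refine ⟨(hι e he).1, hr.trans ?_⟩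
        apply SimpleGraph.Adj.reachable
        rw [SimpleGraph.fromRel_adj]
        refine ⟨?_, Or.inl (Or.inl rfl)⟩
        intro h; exact (hι e he).2.1 (congrArg Subtype.val h).symm
      · intro h hh
        have hadj : G.Reachable ⟨s h, (hE h hh).2⟩ ⟨h, (hE h hh).1⟩ := by
          by_cases hs : s h = h
          · have : (⟨s h, (hE h hh).2⟩ : W) = ⟨h, (hE h hh).1⟩ := Subtype.ext hs
            rw [this]
          apply SimpleGraph.Adj.reachable
          rw [SimpleGraph.fromRel_adj]
          exact ⟨fun h' => hs (congrArg Subtype.val h'), Or.inl (Or.inr ⟨hh, rfl⟩)⟩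
        constructor
        · rintro ⟨_, hr⟩; exact ⟨(hE h hh).1, hr.trans hadj⟩
        · rintro ⟨_, hr⟩; exact ⟨(hE h hh).2, hr.trans hadj.symm⟩
    exact { preconnected := fun a b => (key a).symm.trans (key b), nonempty := ⟨⟨w, hw⟩⟩ }
  have h5 := hconn.card_vert_le_card_edgeSet_add_one
  let F : S ⊕ E → Sym2 W := fun x => match x with
    | .inl a => s(⟨a, a.2.1⟩, ⟨ι a, (hι a a.2.1).1⟩)
    | .inr b => s(⟨s b, (hE b b.2).2⟩, ⟨b, (hE b b.2).1⟩)
  have h6 : G.edgeSet ⊆ Set.range F := by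
    intro z
    induction z using Sym2.ind with
    | _ a b =>
      rw [SimpleGraph.mem_edgeSet, SimpleGraph.fromRel_adj]
      have hl : ∀ a b : W, (b : X) = ι a → s(a, b) ∈ Set.range F := by
        intro a b hab
        by_cases h : idx a < idx (ι a)
        · refine ⟨.inl ⟨a, a.2, h⟩, ?_⟩
          have : b = ⟨ι a, (hι a a.2).1⟩ := Subtype.ext hab
          rw [this]
        · refine ⟨.inl ⟨ι a, (hι a a.2).1, ?_⟩, ?_⟩
          · rw [(hι a a.2).2.2]
            have : idx a ≠ idx (ι a) := fun h => (hι a a.2).2.1 (idxinj h).symm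
            omega
          · have e1 : b = ⟨ι a, (hι a a.2).1⟩ := Subtype.ext hab
            rw [Sym2.eq_swap, e1]
            exact Sym2.eq_iff.2 (Or.inl ⟨rfl, Subtype.ext (hι a a.2).2.2⟩)
      have hr : ∀ a b : W, (b : X) ∈ E → s b = a → s(a, b) ∈ Set.range F := by
        intro a b hb hab
        refine ⟨.inr ⟨b, hb⟩, ?_⟩
        have : a = ⟨s b, (hE b hb).2⟩ := Subtype.ext hab.symm
        rw [this]
      rintro ⟨-, (h | ⟨h1, h2⟩) | (h | ⟨h1, h2⟩)⟩
      · exact hl a b h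
      · exact hr a b h1 h2
      · rw [Sym2.eq_swap]; exact hl b a h
      · rw [Sym2.eq_swap]; exact hr b a h1 h2
  have h7 : Nat.card G.edgeSet ≤ S.ncard + E.ncard := by
    rw [Nat.card_coe_set_eq]
    calc G.edgeSet.ncard ≤ (Set.range F).ncard := Set.ncard_le_ncard h6
      _ ≤ Nat.card (S ⊕ E) := by
        rw [← Set.image_univ, ← Set.ncard_univ]; exact Set.ncard_image_le
      _ = _ := by rw [Nat.card_sum, Nat.card_coe_set_eq, Nat.card_coe_set_eq]
  have h8 : Nat.card W = W.ncard := Nat.card_coe_set_eq W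
  omega

namespace Mod

theorem arr_of_gapless (M : Mod X) {e : X} (he : M.Gapless e) : M.Arr e := by
  refine ⟨fun h => he e h (.refl _ _), fun h => he _ h ?_⟩
  have := (Equiv.Perm.SameCycle.refl M.π (M.π.symm e)).apply_right
  simpa using this

theorem gapless_same (M : Mod X) {e f : X} (he : M.Gapless e) (h : M.π.SameCycle e f) :
    M.Gapless f := fun n hn hs => he n hn (hs.trans h.symm)

theorem same_pi (M : Mod X) (e : X) : M.π.SameCycle e (M.π e) :=
  (Equiv.Perm.SameCycle.refl M.π e).apply_right

theorem same_symm (M : Mod X) (e : X) : M.π.SameCycle e (M.π.symm e) := by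
  have := (M.same_pi (M.π.symm e)).symm
  simpa using this

theorem Inv.tri3 {M : Mod X} (I : M.Inv) {e : X} (he : M.Gapless e) : M.π (M.π (M.π e)) = e :=
  I.tri e he

/-- arrows inside `W` -/
def aW (M : Mod X) (W : Set X) : Set X := {h | M.Arr h ∧ h ∈ W ∧ M.π.symm h ∈ W}

theorem count_bound (M : Mod X) (I : M.Inv) (W D : Set X) (hW : ∀ e ∈ W, M.ι e ≠ e)
    (hWι : ∀ e ∈ W, M.ι e ∈ W) (hWg : ∀ e ∈ W, M.Gapless e → M.π e ∈ W) (hD : D ⊆ M.aW W)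
    (conn : ∀ P : X → Prop, (∀ e, P e ↔ P (M.ι e)) →
      (∀ h ∈ M.aW W, h ∉ D → (P (M.π.symm h) ↔ P h)) → ∀ e ∈ W, ∀ e' ∈ W, P e → P e') :
    3 * W.ncard + 6 * D.ncard +
      2 * {e | e ∈ W ∧ M.Gapless e ∧ ∀ d ∈ D, ¬ M.π.SameCycle d e}.ncard
      ≤ 6 * (M.aW W).ncard + 6 := by
  classical
  set U : Set X := {e | e ∈ W ∧ M.Gapless e ∧ ∀ d ∈ D, ¬ M.π.SameCycle d e} with hU
  obtain ⟨idx, idxinj⟩ : ∃ idx : X → ℕ, Function.Injective idx :=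
    ⟨fun e => (Fintype.equivFin X e : ℕ), fun a b h => (Fintype.equivFin X).injective (Fin.ext h)⟩
  have Uπ : ∀ e ∈ U, M.π e ∈ U := by
    rintro e ⟨h1, h2, h3⟩
    exact ⟨hWg e h1 h2, M.gapless_same h2 (M.same_pi e),
      fun d hd hs => h3 d hd (hs.trans (M.same_pi e).symm)⟩
  have U3 : ∀ e ∈ U, M.π (M.π (M.π e)) = e := fun e he => I.tri3 he.2.1
  set R : Set X := {e | e ∈ U ∧ idx e ≤ idx (M.π e) ∧ idx e ≤ idx (M.π (M.π e))} with hR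
  have hUR : U.ncard ≤ 3 * R.ncard := by
    have h1 : U ⊆ R ∪ (M.π '' R ∪ (fun x => M.π (M.π x)) '' R) := by
      intro e he
      have u1 := Uπ e he
      have u2 := Uπ _ u1
      have u3 := U3 e he
      by_cases c1 : idx e ≤ idx (M.π e) ∧ idx e ≤ idx (M.π (M.π e))
      · exact Or.inl ⟨he, c1⟩
      by_cases c2 : idx (M.π e) ≤ idx e ∧ idx (M.π e) ≤ idx (M.π (M.π e))
      · right; right
        exact ⟨M.π e, ⟨u1, c2.2, by rw [u3]; exact c2.1⟩, u3⟩
      · right; left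
        refine ⟨M.π (M.π e), ⟨u2, ?_, ?_⟩, u3⟩
        · rw [u3]; omega
        · rw [u3]; omega
    have c1 := Set.ncard_le_ncard h1 (Set.toFinite _)
    have c2 := Set.ncard_union_le R (M.π '' R ∪ (fun x => M.π (M.π x)) '' R)
    have c3 := Set.ncard_union_le (M.π '' R) ((fun x => M.π (M.π x)) '' R)
    have c4 := Set.ncard_image_le (f := M.π) (Set.toFinite R)
    have c5 := Set.ncard_image_le (f := fun x => M.π (M.π x)) (Set.toFinite R)
    omega
  have hRa : R ⊆ M.aW W := by
    intro e he
    refine ⟨M.arr_of_gapless he.1.2.1, he.1.1, ?_⟩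
    have : M.π.symm e = M.π (M.π e) := by
      rw [Equiv.symm_apply_eq, U3 e he.1]
    rw [this]; exact (Uπ _ (Uπ e he.1)).1
  have hDR : Disjoint D R := by
    rw [Set.disjoint_left]
    intro e he hr
    exact hr.1.2.2 e he (.refl _ _)
  have hRπ : ∀ e ∈ R, M.π e ∉ R ∧ M.π (M.π e) ∉ R := by
    intro e he
    have u3 := U3 e he.1
    have n1 : idx e ≠ idx (M.π e) := fun h => M.fpf e (idxinj h).symm
    have n2 : idx e ≠ idx (M.π (M.π e)) := by
      intro h
      have := idxinj h
      have h2 : M.π e = e := by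
        conv_lhs => rw [this]
        exact u3
      exact M.fpf e h2
    have := he.2
    constructor
    · rintro ⟨-, h1, h2⟩
      rw [u3] at h2; omega
    · rintro ⟨-, h1, h2⟩
      rw [u3] at h1; omega
  have hcard : (M.aW W \ (D ∪ R)).ncard + (D.ncard + R.ncard) = (M.aW W).ncard := by
    rw [← Set.ncard_union_eq hDR]
    exact Set.ncard_sdiff_add_ncard_of_subset (Set.union_subset hD hRa)
  have := count_core M.ι M.π.symm W (M.aW W \ (D ∪ R))
    (fun e he => ⟨hWι e he, hW e he, M.inv e⟩) (fun h hh => hh.1.2) ?_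
  · omega
  intro P hP1 hP2 e he e' he' hPe
  refine (conn (fun x => x ∈ W ∧ P x) ?_ ?_ e he e' he' ⟨he, hPe⟩).2
  · intro x
    constructor
    · rintro ⟨h1, h2⟩; exact ⟨hWι x h1, hP1 x h1 h2⟩
    · rintro ⟨h1, h2⟩
      have h3 := hWι _ h1
      have h4 := hP1 _ h1 h2
      rw [M.inv] at h3 h4; exact ⟨h3, h4⟩
  · intro h hh hhD
    have hmain : P (M.π.symm h) ↔ P h := by
      by_cases hhR : h ∈ R
      · have hu := hhR.1
        have u3 := U3 h hu
        have e1 : M.π.symm h = M.π (M.π h) := by rw [Equiv.symm_apply_eq, u3]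
        have nD : ∀ x ∈ U, x ∉ D := fun x hx hxD => hx.2.2 x hxD (.refl _ _)
        have iA : ∀ x ∈ U, M.π x ∈ M.aW W := by
          intro x hx
          exact ⟨M.arr_of_gapless (Uπ x hx).2.1, (Uπ x hx).1, by simpa using hx.1⟩
        have l1 := hP2 (M.π h) ⟨iA h hu, by
          rintro (h1 | h1)
          · exact nD _ (Uπ h hu) h1
          · exact (hRπ h hhR).1 h1⟩
        have l2 := hP2 (M.π (M.π h)) ⟨iA _ (Uπ h hu), by
          rintro (h1 | h1)
          · exact nD _ (Uπ _ (Uπ h hu)) h1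
          · exact (hRπ h hhR).2 h1⟩
        rw [Equiv.symm_apply_apply] at l1 l2
        rw [e1, ← l2, ← l1]
      · exact hP2 h ⟨hh, by rintro (h1 | h1); exacts [hhD h1, hhR h1]⟩
    constructor
    · rintro ⟨h1, h2⟩; exact ⟨hh.2.1, hmain.1 h2⟩
    · rintro ⟨h1, h2⟩; exact ⟨hh.2.2, hmain.2 h2⟩

/-- All half-edges. -/
def HH (M : Mod X) : Set X := {e | M.ι e ≠ e}

theorem aW_HH (M : Mod X) : M.aW M.HH = {h | M.Arr h} := by
  ext h; exact ⟨fun H => H.1, fun H => ⟨H, H.1, H.2⟩⟩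

theorem arr_count (M : Mod X) : (M.aW M.HH).ncard + {e | M.ι e = e}.ncard = M.HH.ncard := by
  rw [M.aW_HH, ← Set.ncard_image_of_injective {e | M.ι e = e} M.π.injective,
    ← Set.ncard_union_eq]
  · congr 1
    ext h
    constructor
    · rintro (H | ⟨n, hn, rfl⟩)
      · exact H.1
      · exact M.gap_next hn
    · intro H
      by_cases c : M.ι (M.π.symm h) = M.π.symm h
      · right; exact ⟨_, c, by simp⟩
      · left; exact ⟨H, c⟩
  · rw [Set.disjoint_left]
    rintro _ H ⟨n, hn, rfl⟩
    apply H.2; simpa using hn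

theorem Inv.euler {M : Mod X} (I : M.Inv) :
    6 * (M.aW M.HH).ncard = 3 * M.HH.ncard + 2 * {e | M.Gapless e}.ncard := by
  have h1 := M.arr_count
  have h2 := I.count
  have h3 : {e | M.ι e ≠ e} = M.HH := rfl
  rw [h3] at h2
  omega

/-- Connectedness after removing arrows. -/
def CutConn (M : Mod X) (D : Set X) : Prop :=
  ∀ P : X → Prop, (∀ e, P e ↔ P (M.ι e)) →
    (∀ h, M.Arr h → h ∉ D → (P (M.π.symm h) ↔ P h)) → ∀ e e', M.ι e ≠ e → M.ι e' ≠ e' → P e → P e'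

theorem cut_bound (M : Mod X) (I : M.Inv) (D : Set X) (hD : ∀ d ∈ D, M.Arr d) (hc : M.CutConn D) :
    3 * D.ncard + {e | M.Gapless e ∧ ∀ d ∈ D, ¬ M.π.SameCycle d e}.ncard
      ≤ {e | M.Gapless e}.ncard + 3 := by
  have h1 := I.euler
  have h2 := M.count_bound I M.HH D (fun e he => he)
    (fun e he => by show M.ι (M.ι e) ≠ M.ι e; rw [M.inv]; exact fun h => he h.symm)
    (fun e he hg => (M.arr_of_gapless (M.gapless_same hg (M.same_pi e))).1)
    (fun d hd => by rw [M.aW_HH]; exact hD d hd)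
    (fun P hP1 hP2 e he e' he' => hc P hP1 (fun h hh hhD => hP2 h (by rw [M.aW_HH]; exact hh) hhD)
      e e' he he')
  have h3 : {e | e ∈ M.HH ∧ M.Gapless e ∧ ∀ d ∈ D, ¬ M.π.SameCycle d e} =
      {e | M.Gapless e ∧ ∀ d ∈ D, ¬ M.π.SameCycle d e} := by
    ext e
    exact ⟨fun h => h.2, fun h => ⟨(M.arr_of_gapless h.1).1, h⟩⟩
  rw [h3] at h2
  omega

theorem not_cut2 (M : Mod X) (I : M.Inv) {a b : X} (ha : M.Arr a) (hb : M.Arr b) (hab : a ≠ b)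
    (na : ¬ M.Gapless a) (nb : ¬ M.Gapless b) : ¬ M.CutConn {a, b} := by
  intro hc
  have h1 := M.cut_bound I {a, b} (by rintro d (rfl | rfl); exacts [ha, hb]) hc
  have h2 : {e | M.Gapless e ∧ ∀ d ∈ ({a, b} : Set X), ¬ M.π.SameCycle d e} = {e | M.Gapless e} := by
    ext e
    refine ⟨fun h => h.1, fun h => ⟨h, ?_⟩⟩
    rintro d (rfl | rfl) hs
    · exact na (M.gapless_same h hs.symm)
    · exact nb (M.gapless_same h hs.symm)
  rw [h2, Set.ncard_pair hab] at h1
  omega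

theorem not_cut3 (M : Mod X) (I : M.Inv) {a b : X} (ha : M.Arr a)
    (na : ¬ M.Gapless a) (nb : M.Gapless b) : ¬ M.CutConn {a, b, M.π b} := by
  intro hc
  have nb' := M.gapless_same nb (M.same_pi b)
  have h1 := M.cut_bound I {a, b, M.π b}
    (by rintro d (rfl | rfl | rfl); exacts [ha, M.arr_of_gapless nb, M.arr_of_gapless nb']) hc
  have h3 : ({a, b, M.π b} : Set X).ncard = 3 := by
    rw [Set.ncard_eq_three]
    refine ⟨a, b, M.π b, ?_, ?_, fun h => M.fpf b h.symm, rfl⟩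
    · rintro rfl; exact na nb
    · rintro rfl; exact na nb'
  have h2 : {e | M.Gapless e} ⊆ {e | M.Gapless e ∧ ∀ d ∈ ({a, b, M.π b} : Set X), ¬ M.π.SameCycle d e}
      ∪ {b, M.π b, M.π (M.π b)} := by
    intro e he
    by_cases hs : M.π.SameCycle b e
    · right
      obtain ⟨k, hk⟩ := hs.exists_nat_pow_eq
      rw [← hk]
      have : ∀ k : ℕ, (M.π ^ k) b ∈ ({b, M.π b, M.π (M.π b)} : Set X) := by
        intro k
        induction k with
        | zero => simp
        | succ k ih =>
          rw [pow_succ', Equiv.Perm.mul_apply]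
          rcases ih with h | h | h
          · rw [h]; simp
          · rw [h]; simp
          · rw [h, I.tri3 nb]; simp
      exact this k
    · left
      refine ⟨he, ?_⟩
      rintro d (rfl | rfl | rfl) hd
      · exact na (M.gapless_same he hd.symm)
      · exact hs hd
      · exact hs ((M.same_pi b).trans hd)
  have h4 := Set.ncard_le_ncard h2 (Set.toFinite _)
  have h5 := Set.ncard_union_le {e | M.Gapless e ∧ ∀ d ∈ ({a, b, M.π b} : Set X), ¬ M.π.SameCycle d e}
    {b, M.π b, M.π (M.π b)}
  have h6 : ({b, M.π b, M.π (M.π b)} : Set X).ncard ≤ 3 := by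
    have c1 := Set.ncard_insert_le b {M.π b, M.π (M.π b)}
    have c2 := Set.ncard_insert_le (M.π b) {M.π (M.π b)}
    have c3 := Set.ncard_singleton (M.π (M.π b))
    omega
  omega

end Mod
end GentleQuiv

namespace GentleQuiv
set_option linter.unusedSectionVars false
set_option linter.deprecated false
set_option linter.unusedVariables false

variable {X : Type} [Fintype X] [DecidableEq X]

theorem perm_const (σ : Equiv.Perm X) (x : X) (f : X → Prop)
    (h : ∀ e, σ.SameCycle x e → e ≠ x → (f (σ e) ↔ f e)) {e e' : X}
    (he : σ.SameCycle x e) (he' : σ.SameCycle x e') : f e ↔ f e' := by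
  have key : ∀ k : ℕ, f ((σ ^ k) (σ x)) ↔ f (σ x) := by
    intro k
    induction k with
    | zero => rfl
    | succ k ih =>
      rw [pow_succ', Equiv.Perm.mul_apply]
      have hs : σ.SameCycle x ((σ ^ k) (σ x)) :=
        (Equiv.Perm.sameCycle_pow_right).2 (Equiv.Perm.SameCycle.refl σ x).apply_right
      by_cases c : (σ ^ k) (σ x) = x
      · rw [c]
      · rw [h _ hs c, ih]
  have all : ∀ y, σ.SameCycle x y → (f y ↔ f (σ x)) := by
    intro y hy
    have : σ.SameCycle (σ x) y := (Equiv.Perm.SameCycle.refl σ x).apply_right.symm.trans hy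
    obtain ⟨k, hk⟩ := this.exists_nat_pow_eq
    rw [← hk]; exact key k
  rw [all e he, all e' he']

namespace Mod

/-- rotation around nodes -/
def rho (M : Mod X) : Equiv.Perm X := (Function.Involutive.toPerm M.ι M.inv).trans M.π

theorem rho_apply (M : Mod X) (e : X) : M.rho e = M.π (M.ι e) := rfl

theorem rho_node (M : Mod X) {e f : X} (h : M.rho.SameCycle e f) : M.node e = M.node f := by
  obtain ⟨k, hk⟩ := h.exists_nat_pow_eq
  rw [← hk]; clear hk
  induction k with
  | zero => rfl
  | succ k ih => rw [pow_succ', Equiv.Perm.mul_apply, rho_apply, M.node_step, ih]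

theorem rho_same (M : Mod X) (e : X) : M.rho.SameCycle (M.node e) e := by
  by_contra hc
  have hg : ∀ f, M.rho.SameCycle e f → M.ι f ≠ f := by
    intro f hf hgap
    have := M.rho_node hf
    rw [M.gap_node f hgap] at this
    rw [this] at hc; exact hc hf.symm
  have := M.acyc {f | M.rho.SameCycle e f} hg (fun f hf => by
    rw [← M.rho_apply]; exact Equiv.Perm.SameCycle.apply_right hf)
  have h2 : e ∈ ({f | M.rho.SameCycle e f} : Set X) := .refl _ _
  rw [this] at h2; exact h2

/-- closedness at an arrow -/
def Cl (M : Mod X) (P : X → Prop) (h : X) : Prop := P (M.π.symm h) ↔ P h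

/-- extension to gaps -/
def Pt (M : Mod X) (P : X → Prop) (e : X) : Prop := if M.ι e = e then P (M.π e) else P e

theorem Pt_gap (M : Mod X) (P : X → Prop) {e : X} (h : M.ι e = e) : M.Pt P e ↔ P (M.π e) := by
  simp [Pt, h]
theorem Pt_ngap (M : Mod X) (P : X → Prop) {e : X} (h : M.ι e ≠ e) : M.Pt P e ↔ P e := by
  simp [Pt, h]

theorem iota_gap_iff (M : Mod X) (e : X) : M.ι (M.ι e) = M.ι e ↔ M.ι e = e := by
  rw [M.inv]; exact eq_comm

theorem rho_link (M : Mod X) {P : X → Prop} (hP : ∀ e, P e ↔ P (M.ι e)) {e : X}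
    (h1 : M.Arr (M.rho e) → M.Cl P (M.rho e)) (h2 : M.ι (M.rho e) ≠ M.rho e) :
    M.Pt P (M.rho e) ↔ M.Pt P e := by
  rw [M.Pt_ngap P h2]
  by_cases c : M.ι e = e
  · rw [M.Pt_gap P c, M.rho_apply, c]
  · rw [M.Pt_ngap P c]
    have : M.π.symm (M.rho e) = M.ι e := by rw [rho_apply]; simp
    have h3 := h1 ⟨h2, by rw [this, M.inv]; exact fun h => c h.symm⟩
    unfold Cl at h3
    rw [this] at h3
    rw [← h3, ← hP]

theorem fan_const (M : Mod X) {P : X → Prop} (hP : ∀ e, P e ↔ P (M.ι e)) {n : X}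
    (hc : ∀ h, M.Arr h → M.node h = n → M.Cl P h) {e e' : X} (he : M.node e = n)
    (he' : M.node e' = n) : M.Pt P e ↔ M.Pt P e' := by
  have hn : M.ι n = n := by rw [← he]; exact M.node_gap e
  have s : ∀ f, M.node f = n → M.rho.SameCycle (M.rho.symm n) f := by
    intro f hf
    have h1 := M.rho_same f
    rw [hf] at h1
    have h2 := (Equiv.Perm.SameCycle.refl M.rho (M.rho.symm n)).apply_right
    rw [Equiv.apply_symm_apply] at h2
    exact h2.trans h1
  refine perm_const M.rho (M.rho.symm n) _ ?_ (s e he) (s e' he')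
  intro f hf hne
  have nf : M.node f = n := by
    have := M.rho_node ((s n (M.gap_node n hn)).symm.trans hf)
    rw [← this, M.gap_node n hn]
  have nrf : M.node (M.rho f) = n := by rw [rho_apply, M.node_step, nf]
  apply M.rho_link hP
  · intro ha; exact hc _ ha nrf
  · intro hg
    rw [M.gap_node _ hg] at nrf
    apply hne; rw [← nrf]; simp

/-- last and first of a fan -/
theorem fan_ends (M : Mod X) {P : X → Prop} (hP : ∀ e, P e ↔ P (M.ι e)) {n : X} (hn : M.ι n = n)
    (hc : ∀ h, M.Arr h → M.node h = n → M.Cl P h) : P (M.π n) ↔ P (M.π.symm n) := by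
  have h1 : M.node (M.ι (M.π.symm n)) = n := by
    rw [M.node_iota]; simp [M.gap_node n hn]
  have := M.fan_const hP hc (M.gap_node n hn) h1
  rw [M.Pt_gap P hn, M.Pt_ngap P (by rw [Ne, iota_gap_iff]; exact M.gap_prev hn), ← hP] at this
  exact this

theorem pi_link (M : Mod X) {P : X → Prop} (hP : ∀ e, P e ↔ P (M.ι e)) {e : X}
    (h1 : M.Arr (M.π e) → M.Cl P (M.π e))
    (h2 : M.ι (M.π e) = M.π e → ∀ h, M.Arr h → M.node h = M.π e → M.Cl P h) :
    M.Pt P (M.π e) ↔ M.Pt P e := by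
  by_cases c : M.ι e = e
  · rw [M.Pt_gap P c, M.Pt_ngap P (M.gap_next c)]
  rw [M.Pt_ngap P c]
  by_cases d : M.ι (M.π e) = M.π e
  · rw [M.Pt_gap P d, M.fan_ends hP d (h2 d)]; simp
  · rw [M.Pt_ngap P d]
    have := h1 ⟨d, by simpa using c⟩
    unfold Cl at this
    rw [← this]; simp

theorem color_const (M : Mod X) {P : X → Prop} (hP : ∀ e, P e ↔ P (M.ι e)) {n0 : X}
    (hc : ∀ h, M.Arr h → (M.π.SameCycle n0 h ∨ M.π.SameCycle n0 (M.node h)) → M.Cl P h) {e e' : X}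
    (he : M.π.SameCycle n0 e) (he' : M.π.SameCycle n0 e') : M.Pt P e ↔ M.Pt P e' := by
  refine perm_const M.π n0 _ ?_ he he'
  intro f hf _
  have h1 := hf.trans (M.same_pi f)
  exact M.pi_link hP (fun ha => hc _ ha (Or.inl h1))
    (fun _ h ha hn => hc h ha (Or.inr (by rw [hn]; exact h1)))

theorem cut_link (M : Mod X) {P : X → Prop} (hP : ∀ e, P e ↔ P (M.ι e)) {n0 h0 : X}
    (ha0 : M.Arr h0)
    (hx : (M.π.SameCycle n0 h0 ∧ ¬ M.π.SameCycle n0 (M.node h0)) ∨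
      (¬ M.π.SameCycle n0 h0 ∧ M.π.SameCycle n0 (M.node h0)))
    (hc : ∀ h, M.Arr h → h ≠ h0 → (M.π.SameCycle n0 h ∨ M.π.SameCycle n0 (M.node h)) → M.Cl P h) :
    M.Cl P h0 := by
  rcases hx with ⟨h1, h2⟩ | ⟨h1, h2⟩
  · have s0 : M.π.SameCycle (M.π.symm h0) h0 := (M.same_symm h0).symm
    have := perm_const M.π (M.π.symm h0) (M.Pt P) ?_ (.refl _ _) s0
    · rw [M.Pt_ngap P ha0.1, M.Pt_ngap P ha0.2] at this; exact this
    intro f hf hne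
    have hf0 := h1.trans (s0.symm.trans hf)
    have hf1 := hf0.trans (M.same_pi f)
    apply M.pi_link hP
    · intro ha
      exact hc _ ha (fun h => hne (by rw [← h]; simp)) (Or.inl hf1)
    · intro hg h ha hn
      apply hc h ha _ (Or.inr (by rw [hn]; exact hf1))
      rintro rfl
      rw [hn] at h2; exact h2 hf1
  · obtain ⟨n, hn⟩ : ∃ n, n = M.node h0 := ⟨_, rfl⟩
    rw [← hn] at h2
    have gn : M.ι n = n := by rw [hn]; exact M.node_gap _
    have gp := M.gap_prev gn
    have e1 : P (M.π n) ↔ P (M.π.symm n) := by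
      have s0 : M.π.SameCycle (M.π.symm n) n := (M.same_symm n).symm
      have := perm_const M.π (M.π.symm n) (M.Pt P) ?_ s0 (.refl _ _)
      · rw [M.Pt_ngap P gp, M.Pt_gap P gn] at this; exact this
      intro f hf hne
      have hf0 := h2.trans (s0.symm.trans hf)
      have hf1 := hf0.trans (M.same_pi f)
      apply M.pi_link hP
      · intro ha
        exact hc _ ha (fun h => h1 (by rw [← h]; exact hf1)) (Or.inl hf1)
      · intro hg h ha hnh
        apply hc h ha _ (Or.inr (by rw [hnh]; exact hf1))
        rintro rfl
        rw [← hn] at hnh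
        apply hne; rw [hnh]; simp
    have er : M.rho (M.ι (M.π.symm h0)) = h0 := by rw [rho_apply, M.inv]; simp
    have s1 : M.rho.SameCycle (M.ι (M.π.symm h0)) h0 := by
      have := (Equiv.Perm.SameCycle.refl M.rho (M.ι (M.π.symm h0))).apply_right
      rwa [er] at this
    have := perm_const M.rho (M.ι (M.π.symm h0)) (M.Pt P) ?_ (.refl _ _) s1
    · rw [M.Pt_ngap P ha0.1, M.Pt_ngap P (by rw [Ne, iota_gap_iff]; exact ha0.2), ← hP] at this
      exact this
    intro f hf hne
    have hrf : M.rho f ≠ h0 := fun h => hne (M.rho.injective (by rw [h, er]))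
    have nf : M.node f = n := by rw [← M.rho_node hf, M.rho_node s1, hn]
    have nrf : M.node (M.rho f) = n := by rw [rho_apply, M.node_step, nf]
    by_cases g : M.ι (M.rho f) = M.rho f
    · have : M.rho f = n := by rw [M.gap_node _ g] at nrf; exact nrf
      rw [this, M.Pt_gap P gn, e1]
      have hf2 : M.π.symm n = M.ι f := by rw [← this, rho_apply]; simp
      rw [hf2, ← hP]
      rw [M.Pt_ngap]
      rw [Ne, ← iota_gap_iff, ← hf2]; exact gp
    · apply M.rho_link hP _ g
      intro ha
      exact hc _ ha hrf (Or.inr (by rw [nrf]; exact h2))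

/-- every nongapless element has a color -/
theorem exists_gap (M : Mod X) {e : X} (h : ¬ M.Gapless e) : ∃ n, M.ι n = n ∧ M.π.SameCycle n e := by
  unfold Gapless at h; push Not at h; exact h

/-- Color lemma. -/
theorem color_lemma (M : Mod X) (I : M.Inv) {a : X} (ha : M.Arr a)
    (hs : M.π.SameCycle (M.node a) a) : ¬ M.CutConn {a} := by
  intro hcut
  have na : ¬ M.Gapless a := fun h => h _ (M.node_gap a) hs
  have A : ∀ b, M.Arr b → ¬ M.Gapless b → M.π.SameCycle (M.node b) b := by
    intro b hb nb
    by_contra hne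
    have hab : a ≠ b := by rintro rfl; exact hne hs
    apply M.not_cut2 I ha hb hab na nb
    intro P hP hc
    have hb' : M.Cl P b := by
      by_cases c : M.π.SameCycle b a
      · refine M.cut_link hP (n0 := M.node b) hb (Or.inr ⟨hne, .refl _ _⟩) ?_
        intro h hh hhb ht
        apply hc h hh
        rintro (rfl | rfl)
        · rcases ht with ht | ht
          · exact hne (ht.trans c.symm)
          · exact hne (ht.trans (hs.trans c.symm))
        · exact hhb rfl
      · refine M.cut_link hP (n0 := b) hb (Or.inl ⟨.refl _ _, fun h => hne h.symm⟩) ?_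
        intro h hh hhb ht
        apply hc h hh
        rintro (rfl | rfl)
        · rcases ht with ht | ht
          · exact c ht
          · exact c (ht.trans hs)
        · exact hhb rfl
    apply hcut P hP
    intro h hh hha
    by_cases c : h = b
    · rw [c]; exact hb'
    · exact hc h hh (by rintro (h1 | h1); exacts [hha h1, c h1])
  have B : ∀ b, M.Gapless b → M.π.SameCycle (M.node b) (M.node (M.π b)) := by
    intro b hb
    by_contra hne
    have hb' := M.gapless_same hb (M.same_pi b)
    have hb2 := M.gapless_same hb' (M.same_pi _)
    have ab := M.arr_of_gapless hb
    have ab' := M.arr_of_gapless hb'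
    apply M.not_cut3 I ha na hb
    intro P hP hc
    have hab : a ≠ b := by rintro rfl; exact na hb
    have hab' : a ≠ M.π b := by rintro rfl; exact na hb'
    have t3 : M.Cl P (M.π (M.π b)) := by
      apply hc _ (M.arr_of_gapless hb2)
      rintro (h | h | h)
      · exact na (h ▸ hb2)
      · have h3 := I.tri3 hb; rw [h] at h3; exact M.fpf b h3
      · exact M.fpf _ h
    unfold Cl at t3
    have sy : M.π.symm b = M.π (M.π b) := by rw [Equiv.symm_apply_eq, I.tri3 hb]
    have both : M.Cl P b ∧ M.Cl P (M.π b) := by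
      by_cases c : M.π.SameCycle (M.node b) a
      · have : M.Cl P (M.π b) := by
          refine M.cut_link hP (n0 := M.node (M.π b)) ab'
            (Or.inr ⟨fun h => hb' _ (M.node_gap _) h, .refl _ _⟩) ?_
          intro h hh hhb ht
          apply hc h hh
          rintro (rfl | rfl | rfl)
          · rcases ht with ht | ht
            · exact hne (c.trans ht.symm)
            · exact hne (c.trans (hs.symm.trans ht.symm))
          · rcases ht with ht | ht
            · exact hb _ (M.node_gap _) ht
            · exact hne ht.symm
          · exact hhb rfl
        refine ⟨?_, this⟩
        unfold Cl at this ⊢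
        rw [Equiv.symm_apply_apply] at this t3
        rw [sy, ← t3, ← this]
      · have : M.Cl P b := by
          refine M.cut_link hP (n0 := M.node b) ab
            (Or.inr ⟨fun h => hb _ (M.node_gap _) h, .refl _ _⟩) ?_
          intro h hh hhb ht
          apply hc h hh
          rintro (rfl | rfl | rfl)
          · rcases ht with ht | ht
            · exact c ht
            · exact c (ht.trans hs)
          · exact hhb rfl
          · rcases ht with ht | ht
            · exact hb' _ (M.node_gap _) ht
            · exact hne ht
        refine ⟨this, ?_⟩
        unfold Cl at this ⊢
        rw [Equiv.symm_apply_apply] at t3 ⊢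
        rw [sy] at this
        rw [t3, this]
    apply hcut P hP
    intro h hh hha
    by_cases c : h = b
    · rw [c]; exact both.1
    by_cases c' : h = M.π b
    · rw [c']; exact both.2
    · exact hc h hh (by rintro (h1 | h1 | h1); exacts [hha h1, c h1, c' h1])
  have N : ∀ e, M.ι e ≠ e → ¬ M.Gapless e → M.π.SameCycle (M.node e) e := by
    intro e he ng
    by_cases c : M.ι (M.π.symm e) = M.π.symm e
    · have := M.node_step (M.π.symm e)
      rw [c, M.gap_node _ c] at this
      rw [Equiv.apply_symm_apply] at this
      rw [this]; exact (M.same_symm e).symm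
    · exact A e ⟨he, c⟩ ng
  have C : ∀ e, M.π.SameCycle (M.node e) (M.node (M.π e)) := by
    intro e
    by_cases g : M.Gapless e
    · exact B e g
    have g' : ¬ M.Gapless (M.π e) := fun h => g (M.gapless_same h (M.same_pi e).symm)
    have l : ∀ f, ¬ M.Gapless f → M.π.SameCycle (M.node f) f := by
      intro f hf
      by_cases c : M.ι f = f
      · rw [M.gap_node f c]
      · exact N f c hf
    exact (l e g).trans ((M.same_pi e).trans (l _ g').symm)
  obtain ⟨n, m, hn, hm, hnm, -⟩ := I.two
  have := M.conn (fun e => M.π.SameCycle n (M.node e)) ?_ ?_ (M.π n) (M.π m) (M.gap_next hn)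
    (M.gap_next hm) ?_
  · apply hnm
    have h2 := M.node_step m
    rw [hm, M.gap_node m hm] at h2
    simp only [h2] at this; exact this
  · intro e
    rw [M.node_iota]
    exact ⟨fun h => h.trans (C e), fun h => h.trans (C e).symm⟩
  · intro e _ _
    exact ⟨fun h => h.trans (C e), fun h => h.trans (C e).symm⟩
  · have h2 := M.node_step n
    rw [hn, M.gap_node n hn] at h2
    simp only [h2]; exact .refl _ _

end Mod
end GentleQuiv

namespace GentleQuiv
set_option linter.unusedSectionVars false
set_option linter.deprecated false
set_option linter.unusedVariables false
variable {X : Type} [Fintype X] [DecidableEq X]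
namespace Mod

theorem cut_set (M : Mod X) {a : X} (ha : M.Arr a) (h : ¬ M.CutConn {a}) :
    ∃ P : X → Prop, (∀ e, P e ↔ P (M.ι e)) ∧ (∀ h, M.Arr h → h ≠ a → M.Cl P h) ∧
      P (M.π.symm a) ∧ ¬ P a := by
  unfold CutConn at h
  push Not at h
  obtain ⟨P, hP, hc, e, e', he, he', h1, h2⟩ := h
  have hn : ¬ M.Cl P a := by
    intro hcl
    refine h2 (M.conn P hP ?_ e e' he he' h1)
    intro x hx hx'
    have hax : M.Arr (M.π x) := ⟨hx', by simpa using hx⟩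
    have : M.Cl P (M.π x) := by
      by_cases c : M.π x = a
      · rw [c]; exact hcl
      · exact hc _ hax c
    unfold Cl at this
    simpa using this
  unfold Cl at hn
  by_cases c : P a
  · refine ⟨fun x => ¬ P x, fun e => not_congr (hP e), fun h hh hha => not_congr (hc h hh hha), ?_, ?_⟩
    · intro c'; exact hn ⟨fun _ => c, fun _ => c'⟩
    · exact fun h => h c
  · refine ⟨P, hP, fun h hh hha => hc h hh hha, ?_, c⟩
    by_contra c'
    exact hn ⟨fun h => absurd h c', fun h => absurd h c⟩

/-- the nongap part of a predicate -/
def WW (M : Mod X) (P : X → Prop) : Set X := {e | M.ι e ≠ e ∧ P e}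

theorem piece (M : Mod X) (I : M.Inv) {P : X → Prop} (hP : ∀ e, P e ↔ P (M.ι e))
    (hg : ∀ e, M.Gapless e → P e → P (M.π e)) (w0 : X) (hw0 : M.ι w0 ≠ w0)
    (hc : ∀ h, M.Arr h → ¬ M.Cl P h → (P h → h = w0) ∧ (P (M.π.symm h) → M.π.symm h = w0)) :
    3 * (M.WW P).ncard + 2 * {e | e ∈ M.WW P ∧ M.Gapless e}.ncard ≤ 6 * (M.aW (M.WW P)).ncard + 6 := by
  have key := M.count_bound I (M.WW P) ∅ (fun e he => he.1)
    (fun e he => ⟨by rw [Ne, M.iota_gap_iff]; exact he.1, (hP e).1 he.2⟩)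
    (fun e he hge => ⟨(M.arr_of_gapless (M.gapless_same hge (M.same_pi e))).1, hg e hge he.2⟩)
    (Set.empty_subset _) ?_
  · simpa using key
  intro P' hP' hc' 
  have main : ∀ P' : X → Prop, (∀ e, P' e ↔ P' (M.ι e)) →
      (∀ h ∈ M.aW (M.WW P), (P' (M.π.symm h) ↔ P' h)) → ¬ P' w0 → ∀ e ∈ M.WW P, ¬ P' e := by
    intro P' hP' hc' h0 e he hpe
    have := M.conn (fun e => P e ∧ P' e) (fun e => and_congr (hP e) (hP' e)) ?_ e w0 he.1 hw0 ⟨he.2, hpe⟩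
    · exact h0 this.2
    intro x hx hx'
    have hax : M.Arr (M.π x) := ⟨hx', by simpa using hx⟩
    by_cases c : M.Cl P (M.π x)
    · unfold Cl at c
      rw [Equiv.symm_apply_apply] at c
      by_cases d : P x
      · have := hc' (M.π x) ⟨hax, ⟨hx', c.1 d⟩, by simpa using ⟨hx, d⟩⟩
        rw [Equiv.symm_apply_apply] at this
        rw [c, this]
      · have d' : ¬ P (M.π x) := fun h => d (c.2 h)
        simp [d, d']
    · have c1 := hc _ hax c
      unfold Cl at c
      rw [Equiv.symm_apply_apply] at c c1
      constructor
      · rintro ⟨a, b⟩; rw [c1.2 a] at b; exact absurd b h0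
      · rintro ⟨a, b⟩; rw [c1.1 a] at b; exact absurd b h0
  intro e he e' he' h
  by_cases c : P' w0
  · by_contra h'
    exact main (fun e => ¬ P' e) (fun e => not_congr (hP' e))
      (fun h hh => not_congr (hc' h hh (by simp))) (fun h => h c) e' he' h'
  · exact absurd h (main P' hP' (fun h hh => hc' h hh (by simp)) c e he)

theorem split (M : Mod X) (P R : X → Prop) {h0 : X} (ha : M.Arr h0) (hP : P h0) (hP' : P (M.π.symm h0))
    (hR : ¬ M.Cl R h0) (hc : ∀ h, M.Arr h → h ≠ h0 → M.Cl R h) :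
    (M.WW P).ncard = (M.WW fun e => P e ∧ R e).ncard + (M.WW fun e => P e ∧ ¬ R e).ncard ∧
    (M.aW (M.WW P)).ncard = (M.aW (M.WW fun e => P e ∧ R e)).ncard +
      (M.aW (M.WW fun e => P e ∧ ¬ R e)).ncard + 1 ∧
    {e | e ∈ M.WW P ∧ M.Gapless e}.ncard = {e | e ∈ M.WW (fun e => P e ∧ R e) ∧ M.Gapless e}.ncard +
      {e | e ∈ M.WW (fun e => P e ∧ ¬ R e) ∧ M.Gapless e}.ncard := by
  unfold Cl at hR hc
  refine ⟨?_, ?_, ?_⟩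
  · rw [← Set.ncard_union_eq]
    · congr 1; ext e; simp only [WW, Set.mem_union, Set.mem_setOf_eq]; tauto
    · rw [Set.disjoint_left]; intro e h1 h2; exact h2.2.2 h1.2.2
  · rw [← Set.ncard_union_eq, ← Set.ncard_insert_of_notMem (a := h0)]
    · congr 1; ext e
      simp only [aW, WW, Set.mem_union, Set.mem_setOf_eq, Set.mem_insert_iff]
      constructor
      · rintro ⟨a1, a2, a3⟩
        by_cases c : e = h0
        · exact Or.inl c
        · have := hc e a1 c; tauto
      · rintro (rfl | h | h)
        · exact ⟨ha, ⟨ha.1, hP⟩, ⟨ha.2, hP'⟩⟩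
        · tauto
        · tauto
    · simp only [aW, WW, Set.mem_union, Set.mem_setOf_eq]
      tauto
    · rw [Set.disjoint_left]; intro e h1 h2; exact h2.2.1.2.2 h1.2.1.2.2
  · rw [← Set.ncard_union_eq]
    · congr 1; ext e; simp only [WW, Set.mem_union, Set.mem_setOf_eq]; tauto
    · rw [Set.disjoint_left]; intro e h1 h2; exact h2.1.2.2 h1.1.2.2

theorem mono_piece (M : Mod X) (I : M.Inv) {P : X → Prop} (hP : ∀ e, P e ↔ P (M.ι e)) {f : X}
    (hf : M.ι f ≠ f) (pf : P f) (ngf : ¬ M.Gapless f)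
    (hall : ∀ e, M.ι e ≠ e → P e → e ≠ f → M.Gapless e)
    (hcl : ∀ e, M.Gapless e → (P e → P (M.π e))) (hnf : M.Arr f → ¬ P (M.π.symm f)) :
    ∃ g, 4 ≤ g ∧ (M.aW (M.WW P)).ncard = g ∧ (M.WW P).ncard = g + 1 ∧
      {e | e ∈ M.WW P ∧ M.Gapless e}.ncard = g := by
  have e1 : M.aW (M.WW P) = {e | e ∈ M.WW P ∧ M.Gapless e} := by
    ext h
    constructor
    · rintro ⟨a1, a2, a3⟩
      refine ⟨a2, hall h a2.1 a2.2 ?_⟩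
      rintro rfl
      exact hnf a1 a3.2
    · rintro ⟨a1, a2⟩
      have := M.arr_of_gapless a2
      refine ⟨this, a1, this.2, ?_⟩
      have h2 := M.gapless_same a2 (M.same_pi h)
      have h3 := hcl _ h2 (hcl h a2 a1.2)
      have : M.π.symm h = M.π (M.π h) := by rw [Equiv.symm_apply_eq, I.tri3 a2]
      rw [this]; exact h3
  have e2 : M.WW P = insert f {e | e ∈ M.WW P ∧ M.Gapless e} := by
    ext e
    simp only [Set.mem_insert_iff, Set.mem_setOf_eq]
    constructor
    · intro h
      by_cases c : e = f
      · exact Or.inl c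
      · exact Or.inr ⟨h, hall e h.1 h.2 c⟩
    · rintro (rfl | h)
      · exact ⟨hf, pf⟩
      · exact h.1
  have e3 : (M.WW P).ncard = {e | e ∈ M.WW P ∧ M.Gapless e}.ncard + 1 := by
    conv_lhs => rw [e2]
    rw [Set.ncard_insert_of_notMem]
    exact fun h => ngf h.2
  refine ⟨_, ?_, by rw [e1], e3, rfl⟩
  set a := M.ι f with hadef
  have ha : M.ι a ≠ a := by rw [hadef, M.inv]; exact hf.symm
  have pa : P a := (hP f).1 pf
  have ga : M.Gapless a := hall a ha pa hf
  have gb := M.gapless_same ga (M.same_pi a)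
  have gc := M.gapless_same gb (M.same_pi _)
  have pb := hcl a ga pa
  have pc := hcl _ gb pb
  have nb := (M.arr_of_gapless gb).1
  have nc := (M.arr_of_gapless gc).1
  have hd : M.ι (M.π a) ≠ f := by
    intro h
    apply M.fpf a
    rw [← M.inv (M.π a), h]
  have nd : M.ι (M.ι (M.π a)) ≠ M.ι (M.π a) := by rw [Ne, M.iota_gap_iff]; exact nb
  have pd : P (M.ι (M.π a)) := (hP _).1 pb
  have gd := hall _ nd pd hd
  have sub : ({a, M.π a, M.π (M.π a), M.ι (M.π a)} : Set X) ⊆ {e | e ∈ M.WW P ∧ M.Gapless e} := by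
    rintro e (rfl | rfl | rfl | rfl)
    · exact ⟨⟨ha, pa⟩, ga⟩
    · exact ⟨⟨nb, pb⟩, gb⟩
    · exact ⟨⟨nc, pc⟩, gc⟩
    · exact ⟨⟨nd, pd⟩, gd⟩
  have h4 : ({a, M.π a, M.π (M.π a), M.ι (M.π a)} : Set X).ncard = 4 := by
    have d1 := M.fpf a
    have d2 := M.fpf (M.π a)
    have d3 : M.π (M.π a) ≠ a := by
      intro h
      have h3 := I.tri3 ga
      rw [h] at h3; exact M.fpf _ h3
    have d4 : M.ι (M.π a) ≠ a := by
      intro h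
      apply ngf
      have : f = M.π a := by rw [← M.inv (M.π a), h, hadef, M.inv]
      rw [this]; exact gb
    have d6 : M.ι (M.π a) ≠ M.π (M.π a) := by
      intro h
      apply M.rho_ne (M.ι (M.π a))
      rw [M.inv, h]
    rw [Set.ncard_insert_of_notMem, Set.ncard_insert_of_notMem, Set.ncard_pair d6.symm]
    · rintro (h | h)
      · exact d2 h.symm
      · exact nb h.symm
    · rintro (h | h | h)
      · exact d1 h.symm
      · exact d3 h.symm
      · exact d4 h.symm
  rw [← h4]
  exact Set.ncard_le_ncard sub

theorem perm_fwd (σ : Equiv.Perm X) (f : X → Prop) (h : ∀ e, f e → f (σ e)) {x e : X} (hx : f x)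
    (he : σ.SameCycle x e) : f e := by
  obtain ⟨k, rfl⟩ := he.exists_nat_pow_eq
  induction k with
  | zero => exact hx
  | succ k ih => rw [pow_succ', Equiv.Perm.mul_apply]; exact h _ (ih ((Equiv.Perm.sameCycle_pow_right).2 (.refl _ _)))

theorem other_col (M : Mod X) (I : M.Inv) {u : X} (hu : M.ι u = u) : ∃ m, M.ι m = m ∧
    ¬ M.π.SameCycle u m ∧ ∀ k, M.ι k = k → M.π.SameCycle u k ∨ M.π.SameCycle m k := by
  obtain ⟨n, m, hn, hm, hnm, hk⟩ := I.two
  rcases hk u hu with h | h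
  · refine ⟨m, hm, fun h' => hnm (h.trans h'), fun k hk' => ?_⟩
    exact (hk k hk').imp (fun h' => h.symm.trans h') id
  · refine ⟨n, hn, fun h' => hnm (h.trans h').symm, fun k hk' => ?_⟩
    exact (hk k hk').symm.imp (fun h' => h.symm.trans h') id

theorem left_stuck (M : Mod X) (I : M.Inv) {u : X} (hu : M.ι u = u) (hr : 4 ≤ M.r u)
    (hst : M.node (M.π (M.π (M.π u))) = u) : ¬ M.π.SameCycle (M.node (M.π (M.π u))) u := by
  intro hcol
  have g0 := M.gap_next hu
  have g1 : M.ι (M.π (M.π u)) ≠ M.π (M.π u) := M.r_min (n := u) (j := 2) (by omega) (by omega)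
  have g2 : M.ι (M.π (M.π (M.π u))) ≠ M.π (M.π (M.π u)) :=
    M.r_min (n := u) (j := 3) (by omega) (by omega)
  have s0 : M.π.SameCycle u (M.π u) := M.same_pi u
  set f0 := M.π u with hf0
  have s1 : M.π.SameCycle u (M.π f0) := s0.trans (M.same_pi _)
  set f1 := M.π f0 with hf1
  have s2 : M.π.SameCycle u (M.π f1) := s1.trans (M.same_pi _)
  set f2 := M.π f1 with hf2
  have a1 : M.Arr f1 := ⟨g1, by simpa [hf1] using g0⟩
  have a2 : M.Arr f2 := ⟨g2, by simpa [hf2] using g1⟩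
  have p1 : M.π.symm f1 = f0 := by simp [hf1]
  have p2 : M.π.symm f2 = f1 := by simp [hf2]
  have n0 : M.node f0 = u := by
    have := M.node_step u
    rwa [hu, M.gap_node u hu] at this
  have n1' : M.node (M.ι f1) = u := by rw [M.node_iota]; exact hst
  have d12 : f1 ≠ f2 := fun h => M.fpf f1 h.symm
  have d01 : f0 ≠ f1 := fun h => M.fpf f0 h.symm
  have ng : ∀ {e}, M.π.SameCycle u e → ¬ M.Gapless e := fun h g => g u hu h
  obtain ⟨P1, hP1, c1, t1, t1'⟩ := M.cut_set a1 (M.color_lemma I a1 (hcol.trans s1))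
  obtain ⟨P2, hP2, c2, t2, t2'⟩ := M.cut_set a2 (M.color_lemma I a2 (by rw [hst]; exact s2))
  rw [p1] at t1
  rw [p2] at t2
  have t20 : P2 f0 := by
    have := c2 f1 a1 d12
    unfold Cl at this
    rw [p1] at this; exact this.2 t2
  have n1 : M.node f1 = u := by
    by_contra hne
    have := M.fan_const hP1 (n := u) (fun h hh hn => c1 h hh (by rintro rfl; exact hne hn)) n0 n1'
    rw [M.Pt_ngap _ g0, M.Pt_ngap _ (by rw [Ne, M.iota_gap_iff]; exact g1), ← hP1] at this
    exact t1' (this.1 t1)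
  have A : ∀ e, M.π.SameCycle u e → e ≠ u → e ≠ f0 → ¬ M.Pt P1 e := by
    intro e he h1 h2
    have := perm_fwd M.π (fun e => e = u ∨ e = f0 ∨ ¬ M.Pt P1 e) ?_ (Or.inl rfl) he
    · rcases this with h | h | h
      · exact absurd h h1
      · exact absurd h h2
      · exact h
    intro x hx
    by_cases x1 : x = u
    · right; left; rw [x1]
    by_cases x2 : x = f0
    · right; right; rw [x2, M.Pt_ngap _ g1]; exact t1'
    by_cases x3 : M.π x = u
    · exact Or.inl x3
    right; right
    have hx' : ¬ M.Pt P1 x := by tauto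
    rw [M.pi_link hP1 (fun ha => c1 _ ha (fun h => x2 (M.π.injective h)))
      (fun hg h hh hn => c1 _ hh (by rintro rfl; exact x3 (hn.symm.trans n1)))]
    exact hx'
  have B : ∀ e, M.π.SameCycle u e → e ≠ u → e ≠ f0 → e ≠ f1 → ¬ M.Pt P2 e := by
    intro e he h1 h2 h3
    have := perm_fwd M.π (fun e => e = u ∨ e = f0 ∨ e = f1 ∨ ¬ M.Pt P2 e) ?_ (Or.inl rfl) he
    · tauto
    intro x hx
    by_cases x1 : x = u
    · right; left; rw [x1]
    by_cases x2 : x = f0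
    · right; right; left; rw [x2]
    by_cases x2' : x = f1
    · right; right; right; rw [x2', M.Pt_ngap _ g2]; exact t2'
    by_cases x3 : M.π x = u
    · exact Or.inl x3
    right; right; right
    have hx' : ¬ M.Pt P2 x := by tauto
    rw [M.pi_link hP2 (fun ha => c2 _ ha (fun h => x2' (M.π.injective h)))
      (fun hg h hh hn => c2 _ hh (by rintro rfl; exact x3 (hn.symm.trans hst)))]
    exact hx'
  obtain ⟨m, hm, hum, hk⟩ := M.other_col I hu
  have Cm : ∀ e, M.π.SameCycle m e → (M.Pt P1 m ↔ M.Pt P1 e) := by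
    intro e he
    refine M.color_const hP1 (n0 := m) ?_ (.refl _ _) he
    intro h hh hor
    apply c1 h hh
    rintro rfl
    rcases hor with h' | h'
    · exact hum (s1.trans h'.symm)
    · rw [n1] at h'; exact hum h'.symm
  have gap_or : ∀ e, ¬ M.Gapless e → M.π.SameCycle u e ∨ M.π.SameCycle m e := by
    intro e he
    obtain ⟨n, hn, hs⟩ := M.exists_gap he
    exact (hk n hn).imp (fun h => h.trans hs) (fun h => h.trans hs)
  have G1 : ∀ e, M.Gapless e → (P1 e ↔ P1 (M.π e)) := by
    intro e he
    have h2 := M.gapless_same he (M.same_pi e)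
    have := c1 _ (M.arr_of_gapless h2) (by intro h; rw [h] at h2; exact ng s1 h2)
    unfold Cl at this; simpa using this
  have G2 : ∀ e, M.Gapless e → (P2 e ↔ P2 (M.π e)) := by
    intro e he
    have h2 := M.gapless_same he (M.same_pi e)
    have := c2 _ (M.arr_of_gapless h2) (by intro h; rw [h] at h2; exact ng s2 h2)
    unfold Cl at this; simpa using this
  have nc1 : ¬ M.Cl P1 f1 := by unfold Cl; rw [p1]; tauto
  have nc2 : ¬ M.Cl P2 f2 := by unfold Cl; rw [p2]; tauto
  have E := I.euler
  have eHH : M.HH = M.WW (fun _ => True) := by ext; simp [HH, WW]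
  have eG : {e | M.Gapless e} = {e | e ∈ M.WW (fun _ => True) ∧ M.Gapless e} := by
    ext e; simp only [WW, Set.mem_setOf_eq]
    exact ⟨fun h => ⟨⟨(M.arr_of_gapless h).1, trivial⟩, h⟩, fun h => h.2⟩
  rw [eHH, eG] at E
  by_cases cm : M.Pt P1 m
  · obtain ⟨g, hg, q1, q2, q3⟩ := M.mono_piece I (P := fun e => P2 e ∧ ¬ P1 e) (f := f1)
      (fun e => and_congr (hP2 e) (not_congr (hP1 e))) g1 ⟨t2, t1'⟩ (ng s1)
      (by
        intro e he hpe hne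
        by_contra hng
        rcases gap_or e hng with h | h
        · have h0 : e ≠ f0 := by rintro rfl; exact hpe.2 t1
          have := B e h (by rintro rfl; exact he hu) h0 hne
          rw [M.Pt_ngap _ he] at this; exact this hpe.1
        · have := (Cm e h).1 cm
          rw [M.Pt_ngap _ he] at this; exact hpe.2 this)
      (fun e he h => ⟨(G2 e he).1 h.1, fun h' => h.2 ((G1 e he).2 h')⟩)
      (fun _ h => h.2 (by rw [p1]; exact t1))
    have k1 := M.piece I (P := fun e => P2 e ∧ P1 e) (fun e => and_congr (hP2 e) (hP1 e))
      (fun e he h => ⟨(G2 e he).1 h.1, (G1 e he).1 h.2⟩) f0 g0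
      (by
        intro h hh hcl
        by_cases x1 : h = f1
        · subst x1; rw [p1]; exact ⟨fun h => absurd h.2 t1', fun _ => rfl⟩
        by_cases x2 : h = f2
        · subst x2; rw [p2]; exact ⟨fun h => absurd h.1 t2', fun h => absurd h.2 t1'⟩
        exact absurd (and_congr (c2 h hh x2) (c1 h hh x1)) hcl)
    have k2 := M.piece I (P := fun e => True ∧ ¬ P2 e) (fun e => and_congr Iff.rfl (not_congr (hP2 e)))
      (fun e he h => ⟨trivial, fun h' => h.2 ((G2 e he).2 h')⟩) f2 g2
      (by
        intro h hh hcl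
        by_cases x2 : h = f2
        · subst x2; rw [p2]; exact ⟨fun _ => rfl, fun h => absurd t2 h.2⟩
        exact absurd (and_congr Iff.rfl (not_congr (c2 h hh x2))) hcl)
    obtain ⟨w1, w2, w3⟩ := M.split (fun _ => True) P2 a2 trivial trivial nc2 c2
    obtain ⟨v1, v2, v3⟩ := M.split P2 P1 a1 t2 (by rw [p1]; exact t20) nc1 c1
    have tt : (fun e => True ∧ P2 e) = P2 := by ext; simp
    rw [tt] at w1 w2 w3
    omega
  · obtain ⟨g, hg, q1, q2, q3⟩ := M.mono_piece I (P := fun e => True ∧ P1 e) (f := f0)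
      (fun e => and_congr Iff.rfl (hP1 e)) g0 ⟨trivial, t1⟩ (ng s0)
      (by
        intro e he hpe hne
        by_contra hng
        rcases gap_or e hng with h | h
        · have := A e h (by rintro rfl; exact he hu) hne
          rw [M.Pt_ngap _ he] at this; exact this hpe.2
        · have := mt (Cm e h).2 cm
          rw [M.Pt_ngap _ he] at this; exact this hpe.2)
      (fun e he h => ⟨trivial, (G1 e he).1 h.2⟩)
      (fun h => absurd (by simpa [hf0] using hu) h.2)
    have k2 := M.piece I (P := fun e => True ∧ ¬ P1 e) (fun e => and_congr Iff.rfl (not_congr (hP1 e)))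
      (fun e he h => ⟨trivial, fun h' => h.2 ((G1 e he).2 h')⟩) f1 g1
      (by
        intro h hh hcl
        by_cases x2 : h = f1
        · subst x2; rw [p1]; exact ⟨fun _ => rfl, fun h => absurd t1 h.2⟩
        exact absurd (and_congr Iff.rfl (not_congr (c1 h hh x2))) hcl)
    obtain ⟨w1, w2, w3⟩ := M.split (fun _ => True) P1 a1 trivial trivial nc1 c1
    omega

theorem right_stuck (M : Mod X) (I : M.Inv) {u : X} (hu : M.ι u = u) (hr : 4 ≤ M.r u)
    (hst : M.node (M.π.symm (M.π.symm (M.nu u))) = M.nu u) :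
    ¬ M.π.SameCycle (M.node (M.π.symm (M.nu u))) u := by
  have h := M.op.left_stuck I.op (u := M.nu u) (M.nu_gap hu) (by rw [(M.op_run hu).1]; exact hr)
    (by
      show M.node (M.ι (M.π.symm (M.π.symm (M.π.symm _)))) = _
      rw [M.node_iota, Equiv.apply_symm_apply, hst])
  rw [op_same] at h
  intro hs
  apply h
  show M.π.SameCycle (M.node (M.ι (M.π.symm (M.π.symm _)))) _
  rw [M.node_iota, Equiv.apply_symm_apply]
  exact hs.trans (M.nu_same u)

theorem conn_cut (M : Mod X) {P : X → Prop} (hP : ∀ e, P e ↔ P (M.ι e))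
    (hc : ∀ h, M.Arr h → M.Cl P h) (e e' : X) (he : M.ι e ≠ e) (he' : M.ι e' ≠ e') (h : P e) : P e' := by
  refine M.conn P hP ?_ e e' he he' h
  intro x hx hx'
  have := hc (M.π x) ⟨hx', by simpa using hx⟩
  unfold Cl at this
  simpa using this

theorem double_stuck (M : Mod X) (I : M.Inv) {u : X} (hu : M.ι u = u) (hr : 4 ≤ M.r u)
    (hst : M.node (M.π (M.π (M.π u))) = u) 
    (hst' : M.node (M.π.symm (M.π.symm (M.nu u))) = M.nu u) : False := by
  have L := M.left_stuck I hu hr hst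
  have R := M.right_stuck I hu hr hst'
  have g0 := M.gap_next hu
  have g1 : M.ι (M.π (M.π u)) ≠ M.π (M.π u) := M.r_min (n := u) (j := 2) (by omega) (by omega)
  have q1 : M.π.symm (M.nu u) = (M.π ^ (M.r u - 1)) u := by
    rw [Equiv.symm_apply_eq, nu, ← Equiv.Perm.mul_apply, ← pow_succ']; congr 2; omega
  have q2 : M.π.symm (M.π.symm (M.nu u)) = (M.π ^ (M.r u - 2)) u := by
    rw [q1, Equiv.symm_apply_eq, ← Equiv.Perm.mul_apply, ← pow_succ']; congr 2; omega
  have k1 : M.ι (M.π.symm (M.nu u)) ≠ M.π.symm (M.nu u) := by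
    rw [q1]; exact M.r_min (by omega) (by omega)
  have k2 : M.ι (M.π.symm (M.π.symm (M.nu u))) ≠ M.π.symm (M.π.symm (M.nu u)) := by
    rw [q2]; exact M.r_min (by omega) (by omega)
  have s1 : M.π.SameCycle u (M.π (M.π u)) := (M.same_pi u).trans (M.same_pi _)
  have s2 : M.π.SameCycle u (M.π.symm (M.nu u)) := (M.nu_same u).trans (M.same_symm _)
  have a1 : M.Arr (M.π (M.π u)) := ⟨g1, by simpa using g0⟩
  have a2 : M.Arr (M.π.symm (M.nu u)) := ⟨k1, k2⟩
  have n0 : M.node (M.π u) = u := by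
    have := M.node_step u
    rwa [hu, M.gap_node u hu] at this
  have ne : M.π (M.π u) ≠ M.π.symm (M.nu u) := by
    intro h
    rw [q1] at h
    have : (M.π ^ (M.r u - 3)) u = u := by
      apply (M.π ^ 2).injective
      rw [← Equiv.Perm.mul_apply, ← pow_add]
      show _ = M.π (M.π u)
      rw [h]; congr 2; omega
    exact M.r_min (n := u) (j := M.r u - 3) (by omega) (by omega) (by rw [this, hu])
  refine M.not_cut2 I a1 a2 ne (fun h => h u hu s1) (fun h => h u hu s2) ?_
  intro P hP hc
  have C1 : M.Cl P (M.π (M.π u)) := by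
    have := M.fan_const hP (n := u) (e := M.π u) (e' := M.ι (M.π (M.π u))) ?_ n0
      (by rw [M.node_iota]; exact hst)
    · rw [M.Pt_ngap _ g0, M.Pt_ngap _ (by rw [Ne, M.iota_gap_iff]; exact g1), ← hP] at this
      unfold Cl; simpa using this
    intro h hh hn
    apply hc h hh
    rintro (rfl | rfl)
    · apply L; rw [hn]
    · apply R; rw [hn]
  have C2 : M.Cl P (M.π.symm (M.nu u)) := by
    have := M.fan_const hP (n := M.nu u) (e' := M.ι (M.π.symm (M.nu u))) ?_ hst'
      (by rw [M.node_iota, Equiv.apply_symm_apply, M.gap_node _ (M.nu_gap hu)])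
    · rw [M.Pt_ngap _ k2, M.Pt_ngap _ (by rw [Ne, M.iota_gap_iff]; exact k1), ← hP] at this
      exact this
    intro h hh hn
    apply hc h hh
    rintro (rfl | rfl)
    · apply L; rw [hn]; exact (M.nu_same u).symm
    · apply R; rw [hn]; exact (M.nu_same u).symm
  apply M.conn_cut hP
  intro h hh
  by_cases c : h = M.π (M.π u)
  · rw [c]; exact C1
  by_cases c' : h = M.π.symm (M.nu u)
  · rw [c']; exact C2
  exact hc h hh (by rintro (h1 | h1); exacts [c h1, c' h1])

end Mod
end GentleQuiv

namespace GentleQuiv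
set_option linter.unusedSectionVars false
set_option linter.deprecated false
set_option linter.unusedVariables false
variable {X : Type} [Fintype X] [DecidableEq X]

theorem sum2 (s : Finset X) (f f' : X → ℕ) {u v : X} (hu : u ∈ s) (hv : v ∈ s) (huv : u ≠ v)
    (h : ∀ n ∈ s, n ≠ u → n ≠ v → f' n = f n) :
    ∑ n ∈ s, f' n + (f u + f v) = ∑ n ∈ s, f n + (f' u + f' v) := by
  have hv' : v ∈ s.erase u := Finset.mem_erase.2 ⟨huv.symm, hv⟩
  rw [← Finset.add_sum_erase s f hu, ← Finset.add_sum_erase _ f hv',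
    ← Finset.add_sum_erase s f' hu, ← Finset.add_sum_erase _ f' hv']
  have : ∑ x ∈ (s.erase u).erase v, f' x = ∑ x ∈ (s.erase u).erase v, f x := by
    apply Finset.sum_congr rfl
    intro n hn
    simp only [Finset.mem_erase] at hn
    exact h n hn.2.2 hn.2.1 hn.1
  omega

namespace Mod

open Classical in
/-- gaps of the same color -/
noncomputable def cls (M : Mod X) (n : X) : Finset X :=
  Finset.univ.filter fun k => M.ι k = k ∧ M.π.SameCycle n k

theorem mem_cls (M : Mod X) {n k : X} : k ∈ M.cls n ↔ M.ι k = k ∧ M.π.SameCycle n k := by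
  simp [cls]

/-- average run length at most three -/
def I2 (M : Mod X) : Prop := ∀ n, M.ι n = n → ∑ k ∈ M.cls n, M.r k ≤ 3 * (M.cls n).card

/-- excess -/
noncomputable def Ex (M : Mod X) : ℕ := ∑ n, if M.ι n = n then M.r n - 3 else 0

theorem Trans.ne {M M' : Mod X} {u v : X} (T : Trans M M' u v) : u ≠ v := by
  rintro rfl
  have := T.ru; have := T.rv; omega

theorem Trans.ex {M M' : Mod X} {u v : X} (T : Trans M M' u v) (hu : M.ι u = u) (hv : M.ι v = v) :
    M'.Ex + ((M.r u - 3) + (M.r v - 3)) = M.Ex + ((M'.r u - 3) + (M'.r v - 3)) := by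
  have hi := T.reach.iota
  have := sum2 Finset.univ (fun n => if M.ι n = n then M.r n - 3 else 0)
    (fun n => if M'.ι n = n then M'.r n - 3 else 0) (Finset.mem_univ u) (Finset.mem_univ v) T.ne
    (by
      intro n _ h1 h2
      simp only [hi]
      split_ifs with c
      · rw [T.ro n c h1 h2]
      · rfl)
  simp only [hi, hu, hv, if_true] at this
  unfold Ex
  simp only [hi]
  exact this

theorem Reach.cls {M M' : Mod X} (h : Reach M M') {n : X} (hn : M.ι n = n) : M'.cls n = M.cls n := by
  ext k
  rw [mem_cls, mem_cls, h.iota]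
  constructor
  · rintro ⟨a, b⟩; exact ⟨a, (h.col hn a).1 b⟩
  · rintro ⟨a, b⟩; exact ⟨a, (h.col hn a).2 b⟩

theorem Trans.i2 {M M' : Mod X} {u v : X} (T : Trans M M' u v) (hu : M.ι u = u) (hv : M.ι v = v)
    (huv : M.π.SameCycle u v) (h : M.I2) : M'.I2 := by
  intro n hn
  rw [T.reach.iota] at hn
  rw [T.reach.cls hn]
  have h1 := h n hn
  by_cases c : u ∈ M.cls n
  · have c' : v ∈ M.cls n := by
      rw [mem_cls] at c ⊢; exact ⟨hv, c.2.trans huv⟩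
    have := sum2 (M.cls n) M.r M'.r c c' T.ne (fun k hk h1 h2 => T.ro k (M.mem_cls.1 hk).1 h1 h2)
    have := T.ru; have := T.rv
    omega
  · have c' : v ∉ M.cls n := by
      intro c'; rw [mem_cls] at c c'; exact c ⟨hu, c'.2.trans huv.symm⟩
    rw [Finset.sum_congr rfl (fun k hk => T.ro k (M.mem_cls.1 hk).1 (fun h => c (h ▸ hk)) (fun h => c' (h ▸ hk)))]
    exact h1

def Win (M : Mod X) : Prop := ∃ M', Reach M M' ∧ M'.I2 ∧ M'.Ex < M.Ex

theorem Win.back {M M' : Mod X} (h : Reach M M') (hE : M'.Ex ≤ M.Ex) (w : M'.Win) : M.Win := by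
  obtain ⟨N, h1, h2, h3⟩ := w
  exact ⟨N, h.trans h1, h2, h3.trans_le hE⟩

theorem Trans.win {M M' : Mod X} {u v : X} (T : Trans M M' u v) (hu : M.ι u = u) (hv : M.ι v = v)
    (huv : M.π.SameCycle u v) (h : M.I2) (h4 : 4 ≤ M.r u) (h2 : M.r v = 2) : M.Win := by
  refine ⟨M', T.reach, T.i2 hu hv huv h, ?_⟩
  have := T.ex hu hv
  have := T.ru; have := T.rv
  omega

theorem Trans.iter {M M' : Mod X} {u v : X} (T : Trans M M' u v) {n : X} (hn : M.ι n = n) (s : ℕ) :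
    M'.nu^[s] n = M.nu^[s] n := by
  induction s with
  | zero => rfl
  | succ s ih => rw [Function.iterate_succ_apply', Function.iterate_succ_apply', ih, T.nu _ (M.nu_iter_gap hn s)]

/-- Lemma B -/
theorem winB : ∀ (s ρ : ℕ) (M : Mod X) (Z F Z' : X), M.Inv → M.I2 → M.ι Z = Z → M.r Z = 2 →
    M.nu Z = F → M.r F = ρ → 4 ≤ ρ → Z' = M.nu^[s] F → M.r Z' = 2 → Z' ≠ Z → M.Win := by
  intro s
  induction s with
  | zero =>
    intro ρ M Z F Z' I I2 hZ rZ hF rF h4 hZ' rZ' hne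
    simp at hZ'; subst hZ'; omega
  | succ s ihs =>
    intro ρ
    induction ρ with
    | zero => intros; omega
    | succ ρ ihρ =>
      intro M Z F Z' I I2 hZ rZ hF rF h4 hZ' rZ' hne
      have gF : M.ι F = F := by rw [← hF]; exact M.nu_gap hZ
      have hZF : Z ≠ F := by rintro rfl; omega
      have hFF : M.nu F ≠ F := by
        intro h; exact hZF (M.nu_inj hZ gF (hF.trans h.symm))
      have gv := M.nu_gap gF
      have gZ' : M.ι Z' = Z' := by rw [hZ']; exact M.nu_iter_gap gF _
      have sFZ : M.π.SameCycle F Z := by rw [← hF]; exact (M.nu_same Z).symm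
      by_cases st : M.node (M.ι (M.π (M.π F))) = F
      swap
      · obtain ⟨M', T⟩ := M.left_tr gF hZ hF hFF (by omega) st
        exact T.win gF hZ sFZ I2 (by omega) rZ
      rw [M.node_iota] at st
      have st' : M.node (M.π.symm (M.π.symm (M.nu F))) ≠ M.nu F :=
        fun h => M.double_stuck I gF (by omega) st h
      obtain ⟨M1, T, -⟩ := M.right_tr gF hFF.symm rfl (by omega) st'
      by_cases c2 : M.r (M.nu F) = 2
      · exact T.win gF gv (M.nu_same F) I2 (by omega) c2
      have c3 : 3 ≤ M.r (M.nu F) := by have := M.r_ge_two gv; omega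
      have zv : Z ≠ M.nu F := by intro h; rw [← h] at c3; omega
      have zv' : Z' ≠ M.nu F := by intro h; rw [← h] at c3; omega
      have zF' : Z' ≠ F := by rintro rfl; omega
      have hi := T.reach.iota
      have I1 := T.reach.inv I
      have I21 := T.i2 gF gv (M.nu_same F) I2
      have e1 := T.ex gF gv
      have ru := T.ru
      have rv := T.rv
      have rZ1 := T.ro Z hZ hZF zv
      have rZ1' := T.ro Z' gZ' zF' zv'
      have E1 : M1.Ex ≤ M.Ex := by omega
      apply Win.back T.reach E1
      by_cases c4 : 4 ≤ ρ
      · refine ihρ M1 Z F Z' I1 I21 (by rw [hi]; exact hZ) (by omega) (by rw [T.nu Z hZ, hF]) (by omega) c4 ?_ (by omega) hne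
        rw [T.iter gF]; exact hZ'
      · have r3 : M1.r F = 3 := by omega
        have gF1 : M1.ι F = F := by rw [hi]; exact gF
        have gZ1 : M1.ι Z = Z := by rw [hi]; exact hZ
        have gv1 : M1.ι (M.nu F) = M.nu F := by rw [hi]; exact gv
        have gZ'1 : M1.ι Z' = Z' := by rw [hi]; exact gZ'
        obtain ⟨M2, T2⟩ := M1.left_tr3 gF1 gZ1 (by rw [T.nu Z hZ, hF]) (by rw [T.nu F gF]; exact hFF) r3
        have ru2 := T2.ru
        have rv2 := T2.rv
        have ex2 := T2.ex gF1 gZ1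
        have rV2 := T2.ro (M.nu F) gv1 hFF zv.symm
        have rZ2 := T2.ro Z' gZ'1 zF' hne
        have hi2 := T2.reach.iota
        apply Win.back T2.reach (by omega)
        refine ihs _ M2 F (M.nu F) Z' (T2.reach.inv I1)
          (T2.i2 gF1 gZ1 ((T.reach.col gF hZ).2 sFZ) I21) (by rw [hi2]; exact gF1) (by omega)
          (by rw [T2.nu F gF1, T.nu F gF]) rfl (by omega) ?_ (by omega) zF'
        rw [T2.iter gv1, T.iter gv, hZ']; rfl

/-- Lemma C -/
theorem winC : ∀ (s : ℕ) (M : Mod X) (F c v f1 f2 : X), M.Inv → M.I2 → M.ι F = F → M.r F = 4 →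
    M.nu F = v → M.r c = 2 → c = M.nu^[s] v →
    (∀ n, M.ι n = n → M.π.SameCycle F n → n ≠ F → n ≠ c → M.r n = 3) →
    M.ι f1 ≠ f1 → M.ι f2 ≠ f2 → M.π f1 = f2 → M.π f2 = v → ¬ M.π.SameCycle F (M.node f1) →
    M.node f2 = F → M.Win := by
  intro s
  induction s with
  | zero =>
    intro M F c v f1 f2 I I2 hF rF hv rc hc h3 g1 g2 p1 p2 n1 n2
    simp at hc; subst hc
    have hFv : F ≠ c := by rintro rfl; omega
    have gc : M.ι c = c := by rw [← hv]; exact M.nu_gap hF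
    have sFc : M.π.SameCycle F c := by rw [← hv]; exact M.nu_same F
    obtain ⟨M', T, -⟩ := M.right_tr hF hFv hv (by omega) (by
      rw [← p2, Equiv.symm_apply_apply, ← p1, Equiv.symm_apply_apply]
      intro h; apply n1; rw [h, p1, p2]; exact sFc)
    exact T.win hF gc sFc I2 (by omega) rc
  | succ s ih =>
    intro M F c v f1 f2 I I2 hF rF hv rc hc h3 g1 g2 p1 p2 n1 n2
    have gv : M.ι v = v := by rw [← hv]; exact M.nu_gap hF
    have gc' : M.ι (M.nu^[s] v) = M.nu^[s] v := M.nu_iter_gap gv s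
    have sc' : M.π.SameCycle F (M.nu^[s] v) := by
      have := M.nu_same F
      rw [hv] at this; exact this.trans (M.nu_iter_same v s)
    rw [Function.iterate_succ_apply'] at hc
    set c' := M.nu^[s] v with hc'
    by_cases e1 : c' = c
    · exact ih M F c v f1 f2 I I2 hF rF hv rc e1.symm h3 g1 g2 p1 p2 n1 n2
    have gc : M.ι c = c := by rw [hc]; exact M.nu_gap gc'
    have sc : M.π.SameCycle F c := by rw [hc]; exact sc'.trans (M.nu_same c')
    by_cases e3 : c = v
    · -- go to the zero case
      have hFv : F ≠ v := by rintro rfl; rw [e3] at rc; omega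
      obtain ⟨M', T, -⟩ := M.right_tr hF hFv hv (by omega) (by
        rw [← p2, Equiv.symm_apply_apply, ← p1, Equiv.symm_apply_apply]
        intro h; apply n1; rw [h, p1, p2, ← e3]; exact sc)
      exact T.win hF gv (e3 ▸ sc) I2 (by omega) (e3 ▸ rc)
    have e2 : c' ≠ F := by
      intro h; apply e3; rw [hc, h, hv]
    have r3 := h3 c' gc' sc' e2 e1
    have hcF : c ≠ F := by rintro rfl; omega
    obtain ⟨M', T, Pr⟩ := M.right_tr3 gc' e1 hc.symm r3
    obtain ⟨q1, q2, q3, q4⟩ := Pr f1 f2 v gv (Ne.symm e3) g1 g2 p1 p2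
      (by intro h; apply n1; rw [h]; exact sc) (by rw [n2]; exact hcF.symm)
    have hi := T.reach.iota
    have ex := T.ex gc' gc
    have ru := T.ru
    have rv := T.rv
    apply Win.back T.reach (by omega)
    refine ih M' F c' v f1 f2 (T.reach.inv I) (T.i2 gc' gc (sc'.symm.trans sc) I2) (by rw [hi]; exact hF)
      (by rw [T.ro F hF e2.symm hcF.symm]; exact rF) (by rw [T.nu F hF, hv]) (by omega)
      (by rw [T.iter gv]) ?_ (by rw [hi]; exact g1) (by rw [hi]; exact g2) q1 q2 ?_ (by rw [q4, n2])
    · intro n hn hs h1 h2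
      rw [hi] at hn
      rw [T.reach.col hF hn] at hs
      by_cases h : n = c
      · rw [h]; omega
      · rw [T.ro n hn h2 h]; exact h3 n hn hs h1 h
    · rw [q3, T.reach.col hF (M.node_gap _)]; exact n1

theorem winMain (M : Mod X) (I : M.Inv) (I2 : M.I2) {Z F : X} (hZ : M.ι Z = Z) (rZ : M.r Z = 2)
    (hF : M.nu Z = F) (rF : 4 ≤ M.r F) : M.Win := by
  have gF : M.ι F = F := by rw [← hF]; exact M.nu_gap hZ
  have sZF : M.π.SameCycle Z F := by rw [← hF]; exact M.nu_same Z
  by_cases c : ∃ Z', M.ι Z' = Z' ∧ M.π.SameCycle F Z' ∧ M.r Z' = 2 ∧ Z' ≠ Z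
  · obtain ⟨Z', g', s', r', ne'⟩ := c
    obtain ⟨s, hs⟩ := M.same_iff_nu gF g' s'
    exact winB s _ M Z F Z' I I2 hZ rZ hF rfl rF hs r' ne'
  push Not at c
  have hZF : Z ≠ F := by rintro rfl; omega
  have h3 : ∀ n ∈ M.cls F, n ≠ Z → 3 ≤ M.r n := by
    intro n hn h
    rw [mem_cls] at hn
    have h1 := M.r_ge_two hn.1
    have h2 := c n hn.1 hn.2
    by_contra h4
    exact h (h2 (by omega))
  have mZ : Z ∈ M.cls F := M.mem_cls.2 ⟨hZ, sZF.symm⟩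
  have mF : F ∈ M.cls F := M.mem_cls.2 ⟨gF, .refl _ _⟩
  have mF' : F ∈ (M.cls F).erase Z := Finset.mem_erase.2 ⟨hZF.symm, mF⟩
  have hs := I2 F gF
  rw [← Finset.add_sum_erase _ _ mZ] at hs
  have hcard : ((M.cls F).erase Z).card + 1 = (M.cls F).card := Finset.card_erase_add_one mZ
  have key : ∀ n ∈ ((M.cls F).erase Z).erase F, M.r n = 3 ∧ M.r F = 4 := by
    intro n hn
    have hs' := hs
    rw [← Finset.add_sum_erase _ _ mF', ← Finset.add_sum_erase _ _ hn] at hs'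
    have k1 : 3 * ((((M.cls F).erase Z).erase F).erase n).card ≤ ∑ x ∈ (((M.cls F).erase Z).erase F).erase n, M.r x := by
      rw [mul_comm, ← smul_eq_mul]
      apply Finset.card_nsmul_le_sum
      intro x hx
      simp only [Finset.mem_erase] at hx
      exact h3 x hx.2.2.2 hx.2.2.1
    have k2 := Finset.card_erase_add_one mF'
    have k3 := Finset.card_erase_add_one hn
    have k4 : 3 ≤ M.r n := by
      simp only [Finset.mem_erase] at hn
      exact h3 n hn.2.2 hn.2.1
    omega
  have rF4 : M.r F = 4 := by
    rw [← Finset.add_sum_erase _ _ mF'] at hs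
    have k1 : 3 * (((M.cls F).erase Z).erase F).card ≤ ∑ x ∈ ((M.cls F).erase Z).erase F, M.r x := by
      rw [mul_comm, ← smul_eq_mul]
      apply Finset.card_nsmul_le_sum
      intro x hx
      simp only [Finset.mem_erase] at hx
      exact h3 x hx.2.2 hx.2.1
    have k2 := Finset.card_erase_add_one mF'
    omega
  have hFF : M.nu F ≠ F := fun h => hZF (M.nu_inj hZ gF (hF.trans h.symm))
  by_cases st : M.node (M.ι (M.π (M.π F))) = F
  swap
  · obtain ⟨M', T⟩ := M.left_tr gF hZ hF hFF (by omega) st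
    exact T.win gF hZ sZF.symm I2 (by omega) rZ
  rw [M.node_iota] at st
  have L := M.left_stuck I gF rF st
  have gv := M.nu_gap gF
  obtain ⟨s, hs⟩ := M.same_iff_nu gv hZ ((M.nu_same F).symm.trans sZF.symm)
  refine winC s M F Z (M.nu F) (M.π (M.π F)) (M.π (M.π (M.π F))) I I2 gF rF4 rfl rZ hs ?_
    (M.r_min (n := F) (j := 2) (by omega) (by omega)) (M.r_min (n := F) (j := 3) (by omega) (by omega))
    rfl (by rw [nu, rF4]; rfl) (fun h => L h.symm) st
  intro n hn hs h1 h2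
  exact (key n (by simp only [Finset.mem_erase]; exact ⟨h1, h2, M.mem_cls.2 ⟨hn, hs⟩⟩)).1

theorem winHop : ∀ (k : ℕ) (M : Mod X) (Z F : X), M.Inv → M.I2 → M.ι Z = Z → M.r Z = 2 →
    F = M.nu^[k] Z → 4 ≤ M.r F → M.Win := by
  intro k
  induction k with
  | zero => intro M Z F I I2 hZ rZ hF rF; simp at hF; subst hF; omega
  | succ k ih =>
    intro M Z F I I2 hZ rZ hF rF
    have gn := M.nu_gap hZ
    rw [Function.iterate_succ_apply] at hF
    by_cases c4 : 4 ≤ M.r (M.nu Z)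
    · exact M.winMain I I2 hZ rZ rfl c4
    by_cases c2 : M.r (M.nu Z) = 2
    · exact ih M (M.nu Z) F I I2 gn c2 hF rF
    have r3 : M.r (M.nu Z) = 3 := by have := M.r_ge_two gn; omega
    have nZ : M.nu Z ≠ Z := by intro h; rw [h] at r3; omega
    obtain ⟨M', T⟩ := M.left_tr3 gn hZ rfl (fun h => nZ (M.nu_inj gn hZ h)) r3
    have ex := T.ex gn hZ
    have ru := T.ru
    have rv := T.rv
    have hi := T.reach.iota
    have gF : M.ι F = F := by rw [hF]; exact M.nu_iter_gap gn k
    apply Win.back T.reach (by omega)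
    refine ih M' (M.nu Z) F (T.reach.inv I) (T.i2 gn hZ (M.nu_same Z).symm I2) (by rw [hi]; exact gn)
      (by omega) (by rw [T.iter gn]; exact hF) ?_
    rw [T.ro F gF]
    · exact rF
    · rintro rfl; omega
    · rintro rfl; omega

theorem stageD : ∀ (e : ℕ) (M : Mod X), M.Ex = e → M.Inv → M.I2 →
    ∃ M', Reach M M' ∧ ∀ n, M'.ι n = n → M'.r n ≤ 3 := by
  intro e
  induction e using Nat.strong_induction_on with
  | _ e ih =>
    intro M hE I I2
    by_cases c : ∀ n, M.ι n = n → M.r n ≤ 3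
    · exact ⟨M, .refl, c⟩
    push Not at c
    obtain ⟨F, gF, rF⟩ := c
    have : ∃ Z ∈ M.cls F, M.r Z < 3 := by
      by_contra hc
      push Not at hc
      have hs := I2 F gF
      have mF : F ∈ M.cls F := M.mem_cls.2 ⟨gF, .refl _ _⟩
      rw [← Finset.add_sum_erase _ _ mF] at hs
      have k1 : 3 * ((M.cls F).erase F).card ≤ ∑ x ∈ (M.cls F).erase F, M.r x := by
        rw [mul_comm, ← smul_eq_mul]
        apply Finset.card_nsmul_le_sum
        intro x hx
        exact hc x (Finset.mem_of_mem_erase hx)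
      have k2 := Finset.card_erase_add_one mF
      omega
    obtain ⟨Z, mZ, rZ⟩ := this
    rw [mem_cls] at mZ
    have := M.r_ge_two mZ.1
    obtain ⟨k, hk⟩ := M.same_iff_nu mZ.1 gF mZ.2.symm
    obtain ⟨M', h1, h2, h3⟩ := winHop k M Z F I I2 mZ.1 (by omega) hk rF
    obtain ⟨M'', h4, h5⟩ := ih M'.Ex (by omega) M' rfl (h1.inv I) h2
    exact ⟨M'', h1.trans h4, h5⟩

end Mod
end GentleQuiv

namespace GentleQuiv
set_option linter.unusedSectionVars false
set_option linter.deprecated false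
set_option linter.unusedVariables false
variable {X : Type} [Fintype X] [DecidableEq X]
namespace Mod

/-- same color of nodes -/
def SC (M : Mod X) (e f : X) : Prop := M.π.SameCycle (M.node e) (M.node f)

theorem SC.symm {M : Mod X} {e f : X} (h : M.SC e f) : M.SC f e := Equiv.Perm.SameCycle.symm h
theorem SC.trans {M : Mod X} {e f g : X} (h : M.SC e f) (h' : M.SC f g) : M.SC e g :=
  Equiv.Perm.SameCycle.trans h h'
theorem SC.rfl' {M : Mod X} (e : X) : M.SC e e := Equiv.Perm.SameCycle.refl _ _

/-- bichromatic half-edges -/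
def bi (M : Mod X) : Set X := {e | ¬ M.SC e (M.ι e)}

def R3 (M : Mod X) : Prop := ∀ n, M.ι n = n → M.r n ≤ 3

theorem bi_op (M : Mod X) : M.op.bi = M.bi := by
  ext e
  show ¬ M.op.π.SameCycle (M.node (M.ι e)) (M.node (M.ι (M.ι e))) ↔ ¬ M.π.SameCycle _ _
  rw [op_same, M.inv]
  exact not_congr ⟨fun h => h.symm, fun h => h.symm⟩

theorem op_nu_gap (M : Mod X) {n : X} (hn : M.ι n = n) : M.ι (M.op.nu n) = M.op.nu n :=
  M.op.nu_gap hn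

theorem R3.op {M : Mod X} (h : M.R3) : M.op.R3 := by
  intro n hn
  rw [M.r_op hn]
  exact h _ (M.op_nu_gap hn)

theorem flip (M : Mod X) (hR : M.R3) {h : X} (hh : M.ι h ≠ h) (hy : M.ι (M.π.symm h) ≠ M.π.symm h)
    (hy' : M.ι (M.π.symm (M.ι h)) ≠ M.π.symm (M.ι h)) (hm : M.SC h (M.ι h))
    (hb : ¬ M.SC (M.π.symm h) (M.π.symm (M.ι h))) :
    ∃ M', Reach M M' ∧ M'.R3 ∧ M.bi.ncard < M'.bi.ncard := by
  have leg : M.Legal h := ⟨fun g => absurd g hy, fun g => absurd g hy'⟩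
  refine ⟨M.slide h hh leg, Reach.slide M h hh leg, ?_, ?_⟩
  · intro n hn
    rw [(M.run_nonleaf hh leg hy hy' hn).1]; exact hR n hn
  refine Set.ncard_lt_ncard ?_ (Set.toFinite _)
  have key : ∀ e, e ∈ (M.slide h hh leg).bi ↔ ¬ M.π.SameCycle (M.slnode h e) (M.slnode h (M.ι e)) := by
    intro e
    show ¬ (M.slide h hh leg).π.SameCycle (M.slnode h e) (M.slnode h (M.ι e)) ↔ _
    exact not_congr (M.col_slide hh leg ((M.slide h hh leg).node_gap e)
      ((M.slide h hh leg).node_gap (M.ι e)))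
  rw [Set.ssubset_iff_of_subset]
  · refine ⟨h, ?_, fun h' => h' hm⟩
    rw [key]
    have hb' : ¬ M.π.SameCycle (M.node (M.π.symm h)) (M.node (M.π.symm (M.ι h))) := hb
    simpa [slnode, hh] using hb'
  · intro e he
    have e1 : e ≠ h := by rintro rfl; exact he hm
    have e2 : e ≠ M.ι h := by
      rintro rfl; apply he; rw [M.inv]; exact hm.symm
    have e3 : M.ι e ≠ h := by rintro rfl; exact e2 (M.inv e).symm
    have e4 : M.ι e ≠ M.ι h := fun h' => e1 (M.iota_inj h')
    rw [key]
    have he' : ¬ M.π.SameCycle (M.node e) (M.node (M.ι e)) := he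
    simpa [slnode, e1, e2, e3, e4] using he'

theorem faces (M : Mod X) (hR : M.R3) {e : X} (he : M.ι e ≠ e) : M.Gapless e ∨
    ∃ n, M.ι n = n ∧ ((M.r n = 2 ∧ e = M.π n) ∨ (M.r n = 3 ∧ (e = M.π n ∨ e = M.π (M.π n)))) := by
  by_cases g : M.Gapless e
  · exact Or.inl g
  right
  obtain ⟨n, hn, hs⟩ := M.exists_gap g
  obtain ⟨k, hk⟩ := hs.exists_nat_pow_eq
  clear hs
  induction k using Nat.strong_induction_on generalizing n with
  | _ k ih =>
    by_cases c : k < M.r n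
    · have h0 : k ≠ 0 := by rintro rfl; apply he; rw [← hk]; exact hn
      have h3 := hR n hn
      have h2 := M.r_ge_two hn
      refine ⟨n, hn, ?_⟩
      have : k = 1 ∨ k = 2 := by omega
      rcases this with rfl | rfl
      · have e1 : e = M.π n := by rw [← hk]; rfl
        have : M.r n = 2 ∨ M.r n = 3 := by omega
        tauto
      · have e1 : e = M.π (M.π n) := by rw [← hk]; rfl
        have : M.r n = 3 := by omega
        tauto
    · have h2 := M.r_ge_two hn
      refine ih (k - M.r n) (by omega) (M.nu n) (M.nu_gap hn) ?_
      rw [nu, ← Equiv.Perm.mul_apply, ← pow_add, ← hk]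
      congr 2; omega

theorem node_pi (M : Mod X) {n : X} (hn : M.ι n = n) : M.node (M.π n) = n := by
  have := M.node_step n
  rwa [hn, M.gap_node n hn] at this

theorem r3_nu (M : Mod X) {n : X} (h : M.r n = 3) : M.π (M.π (M.π n)) = M.nu n := by
  rw [nu, h]; rfl

theorem r2_nu (M : Mod X) {n : X} (h : M.r n = 2) : M.π (M.π n) = M.nu n := by
  rw [nu, h]; rfl

/-- half-edge on a monochromatic face -/
def Bad (M : Mod X) (e : X) : Prop := M.ι e ≠ e ∧
  ((M.Gapless e ∧ M.SC e (M.π e) ∧ M.SC e (M.π (M.π e))) ∨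
   (∃ n, M.ι n = n ∧ M.r n = 3 ∧ (e = M.π n ∨ e = M.π (M.π n)) ∧ M.SC (M.π (M.π n)) n))

theorem sc_gap_pi (M : Mod X) {n : X} (hn : M.ι n = n) : M.SC n (M.π n) := by
  unfold SC; rw [M.node_pi hn, M.gap_node n hn]

theorem sc_gap_nu (M : Mod X) {n : X} (hn : M.ι n = n) : M.SC n (M.nu n) := by
  unfold SC; rw [M.gap_node n hn, M.gap_node _ (M.nu_gap hn)]; exact M.nu_same n

theorem bad_mono (M : Mod X) {e : X} (h : M.Bad e) : M.SC e (M.π e) := by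
  rcases h.2 with h | ⟨n, hn, h3, rfl | rfl, h'⟩
  · exact h.2.1
  · exact (M.sc_gap_pi hn).symm.trans h'.symm
  · rw [M.r3_nu h3]; exact h'.trans (M.sc_gap_nu hn)

theorem bad_pi (M : Mod X) (I : M.Inv) {e : X} (h1 : M.ι e ≠ e) (h2 : M.ι (M.π e) ≠ M.π e) :
    M.Bad e ↔ M.Bad (M.π e) := by
  constructor
  · intro h
    refine ⟨h2, ?_⟩
    rcases h.2 with h | ⟨n, hn, h3, rfl | rfl, h'⟩
    · left
      refine ⟨M.gapless_same h.1 (M.same_pi e), h.2.1.symm.trans h.2.2, ?_⟩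
      rw [I.tri3 h.1]; exact h.2.1.symm
    · exact Or.inr ⟨n, hn, h3, Or.inr rfl, h'⟩
    · rw [M.r3_nu h3] at h2; exact absurd (M.nu_gap hn) h2
  · intro h
    refine ⟨h1, ?_⟩
    rcases h.2 with h | ⟨n, hn, h3, h' | h', h⟩
    · left
      have g := M.gapless_same h.1 (M.same_pi e).symm
      have t := h.2.2
      rw [I.tri3 g] at t
      exact ⟨g, t.symm, t.symm.trans h.2.1⟩
    · rw [M.π.injective h'] at h1; exact absurd hn h1
    · exact Or.inr ⟨n, hn, h3, Or.inl (M.π.injective h'), h⟩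

theorem not_all_mono (M : Mod X) (I : M.Inv) (C : ∀ e, M.SC e (M.π e)) : False := by
  obtain ⟨n, m, hn, hm, hnm, -⟩ := I.two
  have := M.conn (fun e => M.π.SameCycle n (M.node e)) ?_ ?_ (M.π n) (M.π m) (M.gap_next hn)
    (M.gap_next hm) ?_
  · apply hnm
    simp only [M.node_pi hm] at this; exact this
  · intro e
    rw [M.node_iota]
    exact ⟨fun h => h.trans (C e), fun h => h.trans (C e).symm⟩
  · intro e _ _
    exact ⟨fun h => h.trans (C e), fun h => h.trans (C e).symm⟩
  · simp only [M.node_pi hn]; exact .refl _ _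

theorem sc_iota (M : Mod X) {e f : X} : M.SC f (M.ι e) ↔ M.SC f (M.π e) := by
  unfold SC; rw [M.node_iota]

theorem exists_flip (M : Mod X) (I : M.Inv) {e0 : X} (hb : M.Bad e0) :
    ∃ e, M.Bad e ∧ ¬ M.Bad (M.ι e) ∧
      (M.ι (M.π (M.ι e)) ≠ M.π (M.ι e) ∨ M.ι (M.π.symm (M.ι e)) ≠ M.π.symm (M.ι e)) := by
  by_contra hc
  push Not at hc
  have all := M.conn (fun e => M.Bad e ∨ M.Bad (M.ι e)) ?_ ?_ e0
  · apply M.not_all_mono I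
    intro e
    by_cases g : M.ι e = e
    · exact M.sc_gap_pi g
    rcases all e hb.1 g (Or.inl hb) with h | h
    · exact M.bad_mono h
    · have := M.bad_mono h
      rw [← M.sc_iota, M.inv] at this
      rw [← M.sc_iota]; exact this.symm
  · intro e; rw [M.inv]; exact or_comm
  · intro e h1 h2
    have A : (M.Bad e ∨ M.Bad (M.ι e)) ↔ M.Bad e := by
      refine ⟨fun h => h.elim id fun h => ?_, Or.inl⟩
      by_contra hn
      have := hc (M.ι e) h (by rw [M.inv]; exact hn)
      rw [M.inv] at this
      exact h2 this.1
    have B : (M.Bad (M.π e) ∨ M.Bad (M.ι (M.π e))) ↔ M.Bad (M.π e) := by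
      refine ⟨fun h => h.elim id fun h => ?_, Or.inl⟩
      by_contra hn
      have := hc (M.ι (M.π e)) h (by rw [M.inv]; exact hn)
      rw [M.inv] at this
      have := this.2
      rw [Equiv.symm_apply_apply] at this
      exact h1 this
    rw [A, B]; exact M.bad_pi I h1 h2

theorem stageE : ∀ (k : ℕ) (M : Mod X), Fintype.card X - M.bi.ncard = k → M.Inv → M.R3 →
    ∃ M', Reach M M' ∧ M'.R3 ∧ ∀ e, ¬ M'.Bad e := by
  intro k
  induction k using Nat.strong_induction_on with
  | _ k ih =>
    intro M hk I hR
    by_cases c : ∀ e, ¬ M.Bad e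
    · exact ⟨M, .refl, hR, c⟩
    push Not at c
    obtain ⟨e0, h0⟩ := c
    suffices ∃ M', Reach M M' ∧ M'.R3 ∧ M.bi.ncard < M'.bi.ncard by
      obtain ⟨M', a1, a2, a3⟩ := this
      have b : M'.bi.ncard ≤ Fintype.card X := by
        rw [← Nat.card_eq_fintype_card]; exact Set.ncard_le_card M'.bi
      obtain ⟨M'', c1, c2, c3⟩ := ih _ (by omega) M' rfl (a1.inv I) a2
      exact ⟨M'', a1.trans c1, c2, c3⟩
    obtain ⟨e, be, bh, hor⟩ := M.exists_flip I h0
    have ge := be.1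
    have gh : M.ι (M.ι e) ≠ M.ι e := by rw [Ne, M.iota_gap_iff]; exact ge
    have me := M.bad_mono be
    rw [← M.sc_iota] at me
    -- `ι e` is in a triangle
    have gl : M.Gapless (M.ι e) := by
      rcases M.faces hR gh with h | ⟨n, hn, ⟨r2, h⟩ | ⟨r3, h⟩⟩
      · exact h
      · exfalso
        rw [h, M.r2_nu r2, Equiv.symm_apply_apply] at hor
        rcases hor with h' | h'
        · exact h' (M.nu_gap hn)
        · exact h' hn
      · exfalso
        apply bh
        refine ⟨gh, Or.inr ⟨n, hn, r3, h, ?_⟩⟩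
        have mh : M.SC (M.ι e) (M.π (M.ι e)) := by
          rw [← M.sc_iota, M.inv]; exact me.symm
        rcases h with h | h
        · rw [h] at mh
          exact mh.symm.trans (M.sc_gap_pi hn).symm
        · rw [h, M.r3_nu r3] at mh
          exact mh.trans (M.sc_gap_nu hn).symm
    have mh : M.SC (M.ι e) (M.π (M.ι e)) := by
      rw [← M.sc_iota, M.inv]; exact me.symm
    have sy : M.π.symm (M.ι e) = M.π (M.π (M.ι e)) := by rw [Equiv.symm_apply_eq, I.tri3 gl]
    have nh : ¬ M.SC (M.ι e) (M.π (M.π (M.ι e))) := fun h => bh ⟨gh, Or.inl ⟨gl, mh, h⟩⟩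
    have ar := M.arr_of_gapless gl
    have gl' := M.gapless_same gl (M.same_pi _)
    by_cases gy : M.ι (M.π.symm e) = M.π.symm e
    · -- use the opposite
      have he : e = M.π (M.π.symm e) := by simp
      have hn3 : M.r (M.π.symm e) = 3 ∧ M.SC (M.π (M.π (M.π.symm e))) (M.π.symm e) := by
        rcases be.2 with h | ⟨n, hn, r3, h | h, h'⟩
        · exact absurd gy (M.arr_of_gapless h.1).2
        · have : M.π.symm e = n := by rw [h]; simp
          rw [this]; exact ⟨r3, h'⟩
        · have : M.π.symm e = M.π n := by rw [h]; simp
          rw [this] at gy; exact absurd gy (M.gap_next hn)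
      obtain ⟨n3, nsc⟩ := hn3
      set n := M.π.symm e with hndef
      have hnu : M.π (M.π e) = M.nu n := by rw [he]; exact M.r3_nu n3
      have ge2 : M.ι (M.π e) ≠ M.π e := by
        rw [he]; exact M.r_min (n := n) (j := 2) (by omega) (by omega)
      obtain ⟨M', a1, a2, a3⟩ := M.op.flip hR.op (h := M.ι e) gh
        (by show M.ι (M.π (M.ι e)) ≠ M.π (M.ι e); exact (M.arr_of_gapless gl').1)
        (by show M.ι (M.π (M.ι (M.ι e))) ≠ M.π (M.ι (M.ι e)); rw [M.inv]; exact ge2)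
        (by
          show M.op.π.SameCycle (M.node (M.ι (M.ι e))) (M.node (M.ι (M.ι (M.ι e))))
          rw [op_same, M.inv]; exact me)
        (by
          show ¬ M.op.π.SameCycle (M.node (M.ι (M.π (M.ι e)))) (M.node (M.ι (M.π (M.ι (M.ι e)))))
          rw [op_same, M.inv, M.node_iota, M.node_iota, hnu]
          intro h
          apply nh
          have h1 : M.SC (M.π (M.π (M.ι e))) (M.nu n) := h
          refine me.symm.trans ?_
          have h2 : M.SC n e := by
            have := M.sc_gap_pi gy
            rwa [← he] at this
          exact h2.symm.trans ((M.sc_gap_nu gy).trans h1.symm))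
      refine ⟨M'.op, ?_, a2.op, ?_⟩
      · have := a1.op
        rwa [op_op] at this
      · rw [bi_op] at a3 ⊢; exact a3
    · refine M.flip hR gh ar.2 (by rw [M.inv]; exact gy) (by rw [M.inv]; exact me.symm) ?_
      rw [M.inv, sy]
      intro h
      apply nh
      refine me.symm.trans (SC.trans ?_ h.symm)
      rcases be.2 with h | ⟨n, hn, r3, h | h, h'⟩
      · have : M.π.symm e = M.π (M.π e) := by rw [Equiv.symm_apply_eq, I.tri3 h.1]
        rw [this]; exact h.2.2
      · exfalso; apply gy; rw [h]; simpa using hn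
      · have : M.π.symm e = M.π n := by rw [h]; simp
        rw [this, h]
        exact h'.trans (M.sc_gap_pi hn)

end Mod
end GentleQuiv

namespace GentleQuiv
set_option linter.unusedSectionVars false
set_option linter.deprecated false
set_option linter.unusedVariables false
variable {X : Type} [Fintype X] [DecidableEq X]
namespace Mod

theorem CutConn.mono {M : Mod X} {D D' : Set X} (h : M.CutConn D') (hs : D ⊆ D') : M.CutConn D := by
  intro P hP hc
  exact h P hP fun x hx hn => hc x hx fun h' => hn (hs h')

theorem arr_faces (M : Mod X) (hR : M.R3) {h : X} (ha : M.Arr h) : M.Gapless h ∨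
    ∃ n, M.ι n = n ∧ M.r n = 3 ∧ h = M.π (M.π n) := by
  rcases M.faces hR ha.1 with g | ⟨n, hn, ⟨_, h1⟩ | ⟨h3, h1 | h1⟩⟩
  · exact Or.inl g
  · exfalso; apply ha.2; rw [h1]; simpa using hn
  · exfalso; apply ha.2; rw [h1]; simpa using hn
  · exact Or.inr ⟨n, hn, h3, h1⟩

theorem rel_faces (M : Mod X) (hR : M.R3) {h : X} (ha : M.Arr h) (ha' : M.Arr (M.π.symm h)) :
    M.Gapless h := by
  rcases M.arr_faces hR ha with g | ⟨n, hn, h3, h1⟩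
  · exact g
  · exfalso; apply ha'.2; rw [h1]; simpa using hn

theorem sc_two (M : Mod X) (I : M.Inv) {a b c : X} (h1 : ¬ M.SC a b) (h2 : ¬ M.SC a c) : M.SC b c := by
  obtain ⟨n, m, hn, hm, hnm, H⟩ := I.two
  unfold SC at *
  rcases H _ (M.node_gap a) with ha | ha <;> rcases H _ (M.node_gap b) with hb | hb <;>
    rcases H _ (M.node_gap c) with hc | hc
  · exact hb.symm.trans hc
  · exact absurd (ha.symm.trans hb) h1
  · exact absurd (ha.symm.trans hc) h2
  · exact hb.symm.trans hc
  · exact hb.symm.trans hc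
  · exact absurd (ha.symm.trans hc) h2
  · exact absurd (ha.symm.trans hb) h1
  · exact hb.symm.trans hc

theorem odd_one (M : Mod X) (I : M.Inv) (nb : ∀ e, ¬ M.Bad e) {h : X} (g : M.Gapless h) :
    ∃ t, M.Gapless t ∧ (h = t ∨ h = M.π t ∨ h = M.π (M.π t)) ∧
      ¬ M.SC t (M.π t) ∧ ¬ M.SC t (M.π (M.π t)) ∧ M.SC (M.π t) (M.π (M.π t)) := by
  have g1 := M.gapless_same g (M.same_pi h)
  have g2 := M.gapless_same g1 (M.same_pi _)
  have t := I.tri3 g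
  by_cases c1 : M.SC h (M.π h)
  · have c2 : ¬ M.SC h (M.π (M.π h)) := fun c2 => nb h ⟨(M.arr_of_gapless g).1, Or.inl ⟨g, c1, c2⟩⟩
    refine ⟨M.π (M.π h), g2, ?_, ?_⟩
    · rw [t]; tauto
    · rw [t]
      exact ⟨fun h' => c2 h'.symm, fun h' => c2 (c1.trans h'.symm), c1⟩
  · by_cases c2 : M.SC h (M.π (M.π h))
    · refine ⟨M.π h, g1, ?_, ?_⟩
      · rw [t]; tauto
      · rw [t]
        exact ⟨fun h' => c1 (c2.trans h'.symm), fun h' => c1 h'.symm, c2.symm⟩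
    · exact ⟨h, g, Or.inl rfl, c1, c2, M.sc_two I c1 c2⟩

theorem tri_cut (M : Mod X) (I : M.Inv) {t a b : X} (gt : M.Gapless t) (ga : M.Gapless a)
    (gb : M.Gapless b) (hta : ¬ M.SC t a) (htb : ¬ M.SC t b) : M.CutConn {t, a} := by
  intro P hP hc
  have ct : M.Cl P t := by
    refine M.cut_link hP (n0 := M.node t) (M.arr_of_gapless gt)
      (Or.inr ⟨gt _ (M.node_gap t), .refl _ _⟩) ?_
    intro h ha hne hh
    apply hc h ha
    rintro (h1 | h1)
    · exact hne h1
    · have h1 : h = a := h1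
      rw [h1] at hh
      exact hh.elim (ga _ (M.node_gap t)) hta
  have ca : M.Cl P a := by
    refine M.cut_link hP (n0 := M.node a) (M.arr_of_gapless ga)
      (Or.inr ⟨ga _ (M.node_gap a), .refl _ _⟩) ?_
    intro h ha hne hh
    by_cases e : h = t
    · rw [e]; exact ct
    · apply hc h ha
      rintro (h1 | h1)
      · exact e h1
      · exact hne h1
  apply M.conn_cut hP
  intro h ha
  by_cases e : h = t
  · rw [e]; exact ct
  by_cases e' : h = a
  · rw [e']; exact ca
  exact hc h ha (by rintro (h1 | h1); exacts [e h1, e' h1])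

theorem no_branch (M : Mod X) (I : M.Inv) (hR : M.R3) (nb : ∀ e, ¬ M.Bad e) {h : X} (ha : M.Arr h) :
    M.CutConn {h} := by
  rcases M.arr_faces hR ha with g | ⟨n, hn, h3, h1⟩
  · obtain ⟨t, gt, ht, n1, n2, s⟩ := M.odd_one I nb g
    have g1 := M.gapless_same gt (M.same_pi t)
    have g2 := M.gapless_same g1 (M.same_pi _)
    have c1 := M.tri_cut I gt g1 g2 n1 n2
    have c2 := M.tri_cut I gt g2 g1 n2 n1
    rcases ht with rfl | rfl | rfl
    · exact c1.mono (by simp)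
    · exact c1.mono (by simp)
    · exact c2.mono (by simp)
  · intro P hP hc
    have ch : M.Cl P h := by
      refine M.cut_link hP (n0 := n) ha (Or.inl ⟨?_, ?_⟩) ?_
      · rw [h1]; exact (M.same_pi n).trans (M.same_pi _)
      · intro hs
        apply nb h
        refine ⟨ha.1, Or.inr ⟨n, hn, h3, Or.inr h1, ?_⟩⟩
        unfold SC
        rw [← h1, M.gap_node n hn]; exact hs.symm
      · intro x hx hne _
        exact hc x hx hne
    apply M.conn_cut hP
    intro x hx
    by_cases e : x = h
    · rw [e]; exact ch
    · exact hc x hx e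

end Mod

namespace Rep
variable {Q : QuivRel} {M : Mod X} {vm am : X → ℕ}

theorem connected_delete (R : Rep Q M vm am) (S : Finset ℕ)
    (hc : M.CutConn {h | M.Arr h ∧ am h ∈ S}) : Connected (deleteArrows Q S) := by
  intro x hx y hy
  obtain ⟨e, he, rfl⟩ := (R.V x).1 hx
  obtain ⟨f, hf, rfl⟩ := (R.V y).1 hy
  refine hc (fun z => Relation.ReflTransGen (Adj (deleteArrows Q S)) (vm e) (vm z)) ?_ ?_ e f he hf .refl
  · intro z; rw [R.vmι]
  · intro h ha hS
    have hS' : am h ∉ S := fun h' => hS ⟨ha, h'⟩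
    have hm : am h ∈ (deleteArrows Q S).A := Finset.mem_sdiff.2 ⟨(R.A _).2 ⟨h, ha, rfl⟩, hS'⟩
    constructor
    · intro p
      exact p.tail ⟨am h, hm, Or.inl ⟨R.src h ha, R.tgt h ha⟩⟩
    · intro p
      exact p.tail ⟨am h, hm, Or.inr ⟨R.src h ha, R.tgt h ha⟩⟩

theorem inC_of_gapless (R : Rep Q M vm am) (st : SigmaTau Q) {h : X} (g : M.Gapless h) :
    InC Q st (am h) := by
  refine ⟨(R.A _).2 ⟨h, M.arr_of_gapless g, rfl⟩, ?_⟩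
  rintro ⟨l, ⟨⟨hne, hl, hch⟩, hN1, -⟩, hmem⟩
  have key : ∀ l : List ℕ, l ≠ [] → l.IsChain (fun a b => (a, b) ∈ Q.rel) → am h ∈ l →
      ∃ g', M.Gapless g' ∧ l.head! = am g' := by
    intro l
    induction l with
    | nil => intro h'; exact absurd rfl h'
    | cons a l ih =>
      intro _ hc hm
      show ∃ g', M.Gapless g' ∧ a = am g'
      rcases List.mem_cons.1 hm with e | hm
      · exact ⟨h, g, e.symm⟩
      · have hl : l ≠ [] := by rintro rfl; simp at hm
        obtain ⟨b, l', rfl⟩ := List.exists_cons_of_ne_nil hl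
        rw [List.isChain_cons_cons] at hc
        obtain ⟨g', gg, e⟩ := ih hl hc.2 hm
        have e : b = am g' := e
        obtain ⟨x, x1, x2, rfl, hb⟩ := (R.rel _ _).1 hc.1
        rw [e] at hb
        have := R.aminj _ _ (M.arr_of_gapless gg) x2 hb
        refine ⟨x, M.gapless_same gg ?_, rfl⟩
        rw [this]; exact (M.same_symm x).symm
  obtain ⟨g', gg, e⟩ := key l hne hch hmem
  have gp := M.gapless_same gg (M.same_pi g')
  have ap := M.arr_of_gapless gp
  have ag := M.arr_of_gapless gg
  have hsrc : Q.src (am (M.π g')) = Q.tgt (am g') := by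
    rw [R.src _ ap, R.tgt _ ag, Equiv.symm_apply_apply]
  apply hN1
  refine ⟨am (M.π g'), (R.A _).2 ⟨_, ap, rfl⟩, ?_, ?_⟩
  · show _ = Q.tgt l.head!
    rw [e, hsrc]
  · show _ = st.τ l.head!
    rw [e]
    refine (st.rel_iff _ ((R.A _).2 ⟨_, ap, rfl⟩) _ ((R.A _).2 ⟨_, ag, rfl⟩) hsrc).1 ?_
    exact (R.rel _ _).2 ⟨M.π g', ap, by simpa using ag, rfl, by simp⟩

theorem conclude (R : Rep Q M vm am) (I : M.Inv) (hR : M.R3) (nb : ∀ e, ¬ M.Bad e)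
    (hne : Nonempty X) :
    IsGentle Q ∧ (∀ a : ℕ, ¬ BranchArrow Q a) ∧ (∀ O : Finset ℕ, ¬ BranchTriangle Q O) ∧
      (∀ st' : SigmaTau Q, ∀ ρ : ℕ × ℕ, ¬ FreeRel Q st' ρ) := by
  refine ⟨R.gentle hne, ?_, ?_, ?_⟩
  · rintro a ⟨ha, hc⟩
    obtain ⟨h, hh, rfl⟩ := (R.A a).1 ha
    apply hc
    apply R.connected_delete
    refine (M.no_branch I hR nb hh).mono ?_
    rintro x ⟨hx, hx'⟩
    exact R.aminj _ _ hx hh (by simpa using hx')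
  · rintro O ⟨⟨a0, a1, a2, rfl, -, r1, r2, r3⟩, hc⟩
    obtain ⟨h, h1, h2, rfl, rfl⟩ := (R.rel _ _).1 r1
    obtain ⟨x, x1, x2, e, rfl⟩ := (R.rel _ _).1 r2
    have e := R.aminj _ _ h2 x1 e
    subst e
    have g := M.rel_faces hR h1 h2
    have e2 : M.π.symm h = M.π (M.π h) := by rw [Equiv.symm_apply_eq, I.tri3 g]
    have e3 : M.π.symm (M.π.symm h) = M.π h := by rw [e2]; simp
    obtain ⟨t, gt, ht, n1, n2, s⟩ := M.odd_one I nb g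
    have g1 := M.gapless_same gt (M.same_pi t)
    have g2 := M.gapless_same g1 (M.same_pi _)
    have c1 := M.tri_cut I gt g1 g2 n1 n2
    refine hc {am t, am (M.π t)} ?_ ?_ ?_
    · rw [e3, e2]
      have tt := I.tri3 gt
      rcases ht with rfl | rfl | rfl
      · intro y hy
        simp only [Finset.mem_insert, Finset.mem_singleton] at hy ⊢
        tauto
      · intro y hy
        rw [tt]
        simp only [Finset.mem_insert, Finset.mem_singleton] at hy ⊢
        tauto
      · intro y hy
        rw [tt]
        simp only [Finset.mem_insert, Finset.mem_singleton] at hy ⊢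
        tauto
    · apply Finset.card_pair
      intro e
      have := R.aminj _ _ (M.arr_of_gapless gt) (M.arr_of_gapless g1) e
      exact M.fpf t this.symm
    · apply R.connected_delete
      refine c1.mono ?_
      rintro y ⟨hy, hy'⟩
      simp only [Finset.mem_insert, Finset.mem_singleton] at hy'
      rcases hy' with e | e
      · exact Or.inl (R.aminj _ _ hy (M.arr_of_gapless gt) e)
      · exact Or.inr (R.aminj _ _ hy (M.arr_of_gapless g1) e)
  · rintro st ⟨a, b⟩ ⟨hr, hc, -⟩
    obtain ⟨h, h1, h2, rfl, rfl⟩ := (R.rel _ _).1 hr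
    exact hc (R.inC_of_gapless st (M.rel_faces hR h1 h2))

/-- Everything after the construction of the initial model. -/
theorem finish (R : Rep Q M vm am) (I : M.Inv) (h2 : M.I2) (hne : Nonempty X) :
    ∃ Q' : QuivRel, IsGentle Q' ∧ (∀ a : ℕ, ¬ BranchArrow Q' a) ∧
      (∀ O : Finset ℕ, ¬ BranchTriangle Q' O) ∧
      (∀ st' : SigmaTau Q', ∀ ρ : ℕ × ℕ, ¬ FreeRel Q' st' ρ) ∧
      RefEquiv Q Q' := by
  obtain ⟨M1, a1, b1⟩ := Mod.stageD _ M rfl I h2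
  obtain ⟨M2, a2, b2, c2⟩ := Mod.stageE _ M1 rfl (a1.inv I) b1
  obtain ⟨Q', am', hQ, R'⟩ := R.reach hne (a1.trans a2)
  obtain ⟨k1, k2, k3, k4⟩ := R'.conclude (a2.inv (a1.inv I)) b2 c2 hne
  exact ⟨Q', k1, k2, k3, k4, hQ⟩

end Rep
end GentleQuiv

namespace GentleQuiv
set_option linter.unusedSectionVars false
set_option linter.deprecated false
set_option linter.unusedVariables false

/-- Half-vertices and arrows of a gentle quiver (no acyclicity assumed). -/
structure Pre (H : Type) where
  A : Finset ℕ
  so : ℕ → H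
  ta : ℕ → H
  ι : H → H
  E : H → Bool
  inv : ∀ h, ι (ι h) = h
  Eι : ∀ h, E (ι h) = !(E h)
  so_inj : ∀ a ∈ A, ∀ b ∈ A, so a = so b → a = b
  ta_inj : ∀ a ∈ A, ∀ b ∈ A, ta a = ta b → a = b
  nl : ∀ a ∈ A, so a ≠ ta a
  conn : ∀ P : H → Prop, (∀ h, P h → P (ι h)) → (∀ a ∈ A, P (so a) ↔ P (ta a)) →
    ∀ e e', P e → P e'

namespace Pre
variable {H : Type} [Fintype H] [DecidableEq H] (S : Pre H)

def Initl (h : H) : Prop := ∀ a ∈ S.A, S.ta a ≠ h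
def Term (h : H) : Prop := ∀ a ∈ S.A, S.so a ≠ h

def Stp (x y : H) : Prop := ∃ a ∈ S.A, S.so a = S.ι x ∧ S.ta a = y

abbrev RT (x y : H) : Prop := Relation.ReflTransGen S.Stp x y

theorem stp_right {x y z : H} (h : S.Stp x y) (h' : S.Stp x z) : y = z := by
  obtain ⟨a, ha, h1, h2⟩ := h
  obtain ⟨b, hb, h3, h4⟩ := h'
  have := S.so_inj a ha b hb (h1.trans h3.symm)
  rw [← h2, ← h4, this]

theorem iota_inj {x y : H} (h : S.ι x = S.ι y) : x = y := by
  rw [← S.inv x, h, S.inv]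

theorem stp_left {x y z : H} (h : S.Stp x z) (h' : S.Stp y z) : x = y := by
  obtain ⟨a, ha, h1, h2⟩ := h
  obtain ⟨b, hb, h3, h4⟩ := h'
  have := S.ta_inj a ha b hb (h2.trans h4.symm)
  subst this
  exact S.iota_inj (h1.symm.trans h3)

/-- the unique start -/
theorem start_unique {n n' h : H} (hn : S.Initl n) (hn' : S.Initl n') (h1 : S.RT n h) (h2 : S.RT n' h) :
    n = n' := by
  induction h1 with
  | refl =>
    cases h2 with
    | refl => rfl
    | tail _ h3 => obtain ⟨a, ha, _, h4⟩ := h3; exact absurd h4 (hn a ha)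
  | tail h3 h4 ih =>
    cases h2 with
    | refl => obtain ⟨a, ha, _, h5⟩ := h4; exact absurd h5 (hn' a ha)
    | tail h5 h6 =>
      have := S.stp_left h4 h6
      subst this
      exact ih h5

theorem end_unique {n h h' : H} (t : S.Term (S.ι h)) (t' : S.Term (S.ι h')) (h1 : S.RT n h)
    (h2 : S.RT n h') : h = h' := by
  have key : ∀ {x y : H}, S.Term (S.ι x) → S.RT x y → x = y := by
    intro x y tx hxy
    rcases Relation.ReflTransGen.cases_head hxy with h | ⟨z, ⟨a, ha, h3, _⟩, _⟩
    · exact h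
    · exact absurd h3 (tx a ha)
  have ru : Relator.RightUnique S.Stp := fun _ _ _ h h' => S.stp_right h h'
  rcases Relation.ReflTransGen.total_of_right_unique ru h1 h2 with h | h
  · exact key t h
  · exact (key t' h).symm

theorem exists_start {h : H} (t : S.Term (S.ι h)) : ∃ n, S.Initl n ∧ S.RT n h := by
  by_contra hc
  have hp : ∀ x : {x // ¬ ∃ n, S.Initl n ∧ S.RT n x},
      ∃ y : {x // ¬ ∃ n, S.Initl n ∧ S.RT n x}, S.Stp y.1 x.1 := by
    rintro ⟨x, hx⟩
    have : ¬ S.Initl x := fun h => hx ⟨x, h, .refl⟩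
    unfold Initl at this
    push Not at this
    obtain ⟨a, ha, h1⟩ := this
    have st : S.Stp (S.ι (S.so a)) x := ⟨a, ha, by rw [S.inv], h1⟩
    exact ⟨⟨S.ι (S.so a), fun ⟨n, hn, hr⟩ => hx ⟨n, hn, hr.tail st⟩⟩, st⟩
  choose f hf using hp
  have fi : Function.Injective f := by
    intro x y hxy
    have h1 := hf x
    rw [hxy] at h1
    exact Subtype.ext (S.stp_right h1 (hf y))
  obtain ⟨y, hy⟩ := (Finite.injective_iff_surjective.1 fi) ⟨h, hc⟩
  have := hf y
  rw [hy] at this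
  obtain ⟨a, ha, h1, _⟩ := this
  exact t a ha h1

/-- half-vertices and gaps -/
abbrev XX : Type := H ⊕ {h : H // S.Initl h}

open Classical in
noncomputable def pf : S.XX → S.XX
  | .inr n => .inl n.1
  | .inl h => if c : ∃ a ∈ S.A, S.so a = h then .inl (S.ta c.choose) else
      .inr ⟨(S.exists_start (h := S.ι h) (by
        rw [S.inv]; intro a ha h1; exact c ⟨a, ha, h1⟩)).choose, (S.exists_start (h := S.ι h) (by
        rw [S.inv]; intro a ha h1; exact c ⟨a, ha, h1⟩)).choose_spec.1⟩

theorem pf_arr {a : ℕ} (ha : a ∈ S.A) : S.pf (.inl (S.so a)) = .inl (S.ta a) := by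
  have c : ∃ b ∈ S.A, S.so b = S.so a := ⟨a, ha, rfl⟩
  simp only [pf, dif_pos c]
  rw [S.so_inj _ c.choose_spec.1 _ ha c.choose_spec.2]

theorem pf_term {h n : H} (hn : S.Initl n) (t : S.Term h) (hr : S.RT n (S.ι h)) :
    S.pf (.inl h) = .inr ⟨n, hn⟩ := by
  have c : ¬ ∃ b ∈ S.A, S.so b = h := fun ⟨a, ha, e⟩ => t a ha e
  have ex := S.exists_start (h := S.ι h) (by rw [S.inv]; exact t)
  simp only [pf, dif_neg c]
  congr 1
  apply Subtype.ext
  exact S.start_unique ex.choose_spec.1 hn ex.choose_spec.2 hr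

theorem cases_half (h : H) : (∃ a ∈ S.A, S.so a = h) ∨
    (S.Term h ∧ ∃ n, S.Initl n ∧ S.RT n (S.ι h)) := by
  by_cases c : ∃ a ∈ S.A, S.so a = h
  · exact Or.inl c
  · have t : S.Term h := fun a ha e => c ⟨a, ha, e⟩
    exact Or.inr ⟨t, S.exists_start (by rw [S.inv]; exact t)⟩

theorem pf_inj : Function.Injective S.pf := by
  intro x y hxy
  rcases x with x | x <;> rcases y with y | y
  · rcases S.cases_half x with ⟨a, ha, rfl⟩ | ⟨t, n, hn, hr⟩ <;>
    rcases S.cases_half y with ⟨b, hb, rfl⟩ | ⟨t', n', hn', hr'⟩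
    · rw [S.pf_arr ha, S.pf_arr hb] at hxy
      rw [S.ta_inj a ha b hb (Sum.inl.inj hxy)]
    · rw [S.pf_arr ha, S.pf_term hn' t' hr'] at hxy; cases hxy
    · rw [S.pf_arr hb, S.pf_term hn t hr] at hxy; cases hxy
    · rw [S.pf_term hn t hr, S.pf_term hn' t' hr'] at hxy
      have : n = n' := by simpa using hxy
      subst this
      congr 1
      apply S.iota_inj
      exact S.end_unique (by rw [S.inv]; exact t) (by rw [S.inv]; exact t') hr hr'
  · rcases S.cases_half x with ⟨a, ha, rfl⟩ | ⟨t, n, hn, hr⟩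
    · rw [S.pf_arr ha] at hxy
      exact absurd (Sum.inl.inj hxy) (y.2 a ha)
    · rw [S.pf_term hn t hr] at hxy; cases hxy
  · rcases S.cases_half y with ⟨a, ha, rfl⟩ | ⟨t, n, hn, hr⟩
    · rw [S.pf_arr ha] at hxy
      exact absurd (Sum.inl.inj hxy).symm (x.2 a ha)
    · rw [S.pf_term hn t hr] at hxy; cases hxy
  · congr 1; exact Subtype.ext (Sum.inl.inj hxy)

noncomputable def pi : Equiv.Perm S.XX :=
  Equiv.ofBijective S.pf (Finite.injective_iff_bijective.1 S.pf_inj)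

theorem pi_arr {a : ℕ} (ha : a ∈ S.A) : S.pi (.inl (S.so a)) = .inl (S.ta a) := S.pf_arr ha
theorem pi_term {h n : H} (hn : S.Initl n) (t : S.Term h) (hr : S.RT n (S.ι h)) :
    S.pi (.inl h) = .inr ⟨n, hn⟩ := S.pf_term hn t hr
theorem pi_gap (n : {h : H // S.Initl h}) : S.pi (.inr n) = .inl n.1 := rfl

def invo : S.XX → S.XX
  | .inl h => .inl (S.ι h)
  | .inr n => .inr n

theorem iota_ne (h : H) : S.ι h ≠ h := by
  intro e
  have := S.Eι h
  rw [e] at this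
  simp at this

theorem io_inv (e : S.XX) : S.invo (S.invo e) = e := by
  rcases e with h | n
  · simp [invo, S.inv]
  · rfl

theorem io_gap (e : S.XX) : S.invo e = e ↔ ∃ n, e = .inr n := by
  rcases e with h | n
  · simp [invo, S.iota_ne]
  · simp [invo]

open Classical in
/-- label of the permitted path -/
noncomputable def lab : S.XX → Option {h : H // S.Initl h}
  | .inl h => if c : ∃ n, S.Initl n ∧ S.RT n h then some ⟨c.choose, c.choose_spec.1⟩ else none
  | .inr n => some n

theorem lab_some {n h : H} (hn : S.Initl n) (hr : S.RT n h) : S.lab (.inl h) = some ⟨n, hn⟩ := by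
  have c : ∃ n, S.Initl n ∧ S.RT n h := ⟨n, hn, hr⟩
  simp only [lab, dif_pos c]
  congr 1
  exact Subtype.ext (S.start_unique c.choose_spec.1 hn c.choose_spec.2 hr)

theorem lab_none {h : H} (hh : ¬ ∃ n, S.Initl n ∧ S.RT n h) : S.lab (.inl h) = none := by
  simp only [lab, dif_neg hh]

theorem lab_rho (e : S.XX) : S.lab (S.pi (S.invo e)) = S.lab e := by
  rcases e with h | n
  · show S.lab (S.pi (.inl (S.ι h))) = _
    rcases S.cases_half (S.ι h) with ⟨a, ha, e⟩ | ⟨t, n, hn, hr⟩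
    · rw [← e, S.pi_arr ha]
      have st : S.Stp h (S.ta a) := ⟨a, ha, e, rfl⟩
      by_cases c : ∃ n, S.Initl n ∧ S.RT n h
      · obtain ⟨n, hn, hr⟩ := c
        rw [S.lab_some hn hr, S.lab_some hn (hr.tail st)]
      · rw [S.lab_none c, S.lab_none]
        rintro ⟨n, hn, hr⟩
        cases hr with
        | refl => exact hn a ha rfl
        | tail h1 h2 => rw [S.stp_left h2 st] at h1; exact c ⟨n, hn, h1⟩
    · rw [S.pi_term hn t hr, S.inv] at *
      rw [S.lab_some hn hr]; rfl
  · show S.lab (S.pi (.inr n)) = _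
    rw [S.pi_gap, S.lab_some n.2 .refl]; rfl

end Pre
end GentleQuiv

namespace GentleQuiv
set_option linter.unusedSectionVars false
set_option linter.deprecated false
set_option linter.unusedVariables false

theorem rank_ge {E I : Type} [Fintype E] [Fintype I] [DecidableEq I] (A : Matrix E I (ZMod 2))
    (i0 : I) (h : ∀ c, A.mulVec c = 0 → ∀ i, c i = c i0) : Fintype.card I ≤ A.rank + 1 := by
  have h1 := LinearMap.finrank_range_add_finrank_ker A.mulVecLin
  rw [Module.finrank_fintype_fun_eq_card] at h1
  have h2 : Module.finrank (ZMod 2) (LinearMap.ker A.mulVecLin) ≤ 1 := by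
    have h3 : LinearMap.ker A.mulVecLin ≤ Submodule.span (ZMod 2) {(fun _ => 1 : I → ZMod 2)} := by
      intro c hc
      rw [Submodule.mem_span_singleton]
      refine ⟨c i0, ?_⟩
      ext i
      simp [h c hc i]
    refine (Submodule.finrank_mono h3).trans ?_
    rw [finrank_span_singleton]
    intro e
    have := congrFun e i0
    simp at this
  unfold Matrix.rank
  omega

namespace Pre
variable {H : Type} [Fintype H] [DecidableEq H] (S : Pre H)

abbrev JJ : Type := Quotient (Equiv.Perm.SameCycle.setoid S.pi)

noncomputable def jj (e : S.XX) : S.JJ := Quotient.mk _ e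

theorem jj_eq {e f : S.XX} : S.jj e = S.jj f ↔ S.pi.SameCycle e f := Quotient.eq

theorem jj_pi (e : S.XX) : S.jj (S.pi e) = S.jj e := by
  rw [jj_eq]; exact (Equiv.Perm.SameCycle.refl S.pi e).apply_right.symm

theorem sum_XX (f : S.XX → ZMod 2) (g : S.XX → ZMod 2) (hf : ∀ e, f (S.pi (S.invo e)) = f e)
    (hg : ∀ e, g (S.pi e) = g e) :
    ∑ h : {h : H // S.E h = true}, (f (.inl h.1) + f (.inl (S.ι h.1))) *
      (g (.inl h.1) + g (.inl (S.ι h.1))) = 0 := by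
  classical
  have h1 : ∑ e : S.XX, f e * g (S.invo e) = ∑ e : S.XX, f e * g e := by
    let ρ : Equiv.Perm S.XX := (Function.Involutive.toPerm S.invo S.io_inv).trans S.pi
    have hρ : ∀ e, ρ e = S.pi (S.invo e) := fun _ => rfl
    rw [← Equiv.sum_comp ρ (fun e => f e * g e)]
    refine Finset.sum_congr rfl fun e _ => ?_
    rw [hρ, hf, hg]
  have h2 : ∑ h : H, f (.inl h) * g (.inl (S.ι h)) = ∑ h : H, f (.inl h) * g (.inl h) := by
    rw [Fintype.sum_sum_type, Fintype.sum_sum_type] at h1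
    exact add_right_cancel h1
  have h3 : ∑ h : H, (f (.inl h) * g (.inl h) + f (.inl h) * g (.inl (S.ι h))) = 0 := by
    rw [Finset.sum_add_distrib, h2]; exact CharTwo.add_self_eq_zero _
  rw [← h3, ← Fintype.sum_subtype_add_sum_subtype (fun h => S.E h = true)]
  have h4 : ∑ h : {h : H // ¬ S.E h = true}, (f (.inl h.1) * g (.inl h.1) + f (.inl h.1) * g (.inl (S.ι h.1)))
      = ∑ h : {h : H // S.E h = true}, (f (.inl (S.ι h.1)) * g (.inl (S.ι h.1)) +
        f (.inl (S.ι h.1)) * g (.inl h.1)) := by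
    refine Fintype.sum_equiv ⟨fun h => ⟨S.ι h.1, by rw [S.Eι]; simpa using h.2⟩,
      fun h => ⟨S.ι h.1, by rw [S.Eι]; simpa using h.2⟩, fun h => Subtype.ext (S.inv _),
      fun h => Subtype.ext (S.inv _)⟩ _ _ ?_
    intro h
    simp [S.inv]
  rw [h4, ← Finset.sum_add_distrib]
  refine Finset.sum_congr rfl fun h _ => ?_
  ring

theorem card_H : Fintype.card H = 2 * Fintype.card {h : H // S.E h = true} := by
  have e : {h : H // S.E h = true} ≃ {h : H // ¬ S.E h = true} :=
    ⟨fun h => ⟨S.ι h.1, by rw [S.Eι, h.2]; simp⟩,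
      fun h => ⟨S.ι h.1, by rw [S.Eι]; simpa using h.2⟩, fun h => Subtype.ext (S.inv _),
      fun h => Subtype.ext (S.inv _)⟩
  have h1 := Fintype.card_congr (Equiv.sumCompl (fun h : H => S.E h = true))
  rw [Fintype.card_sum, ← Fintype.card_congr e] at h1
  omega

theorem ker_const {I : Type} (l : S.XX → I) (hl : ∀ i, ∃ h, l (.inl h) = i)
    (ha : ∀ a ∈ S.A, l (.inl (S.ta a)) = l (.inl (S.so a)) ∨ l (.inl (S.ta a)) = l (.inl (S.ι (S.so a))))
    (c : I → ZMod 2) (hc : ∀ h, S.E h = true → c (l (.inl h)) + c (l (.inl (S.ι h))) = 0) (i i' : I) :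
    c i = c i' := by
  have h2 : ∀ h, c (l (.inl (S.ι h))) = c (l (.inl h)) := by
    intro h
    cases e : S.E h with
    | true => exact (CharTwo.add_eq_zero.1 (hc h e)).symm
    | false =>
      have := hc (S.ι h) (by rw [S.Eι, e]; rfl)
      rw [S.inv] at this
      exact CharTwo.add_eq_zero.1 this
  obtain ⟨h, rfl⟩ := hl i
  obtain ⟨h', rfl⟩ := hl i'
  refine S.conn (fun x => c (l (.inl h)) = c (l (.inl x))) ?_ ?_ h h' rfl
  · intro x hx; rw [h2]; exact hx
  · intro a haA
    rcases ha a haA with e | e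
    · rw [e]
    · rw [e, h2]

open Classical in
/-- Euler inequality: if some half-vertex lies on a permitted cycle, there are few faces. -/
theorem euler {h0 : H} (hh : ¬ ∃ n, S.Initl n ∧ S.RT n h0) :
    2 * Fintype.card {h : H // S.Initl h} + 2 * Fintype.card S.JJ ≤ Fintype.card H + 2 := by
  let mat {I : Type} (l : S.XX → I) : Matrix {h : H // S.E h = true} I (ZMod 2) :=
    fun h i => (if l (.inl h.1) = i then 1 else 0) + (if l (.inl (S.ι h.1)) = i then 1 else 0)
  have mv : ∀ {I : Type} [Fintype I] (l : S.XX → I) (c : I → ZMod 2) (h : {h : H // S.E h = true}),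
      (mat l).mulVec c h = c (l (.inl h.1)) + c (l (.inl (S.ι h.1))) := by
    intro I _ l c h
    simp [Matrix.mulVec, dotProduct, mat, add_mul, Finset.sum_add_distrib]
  have hA : Fintype.card (Option {h : H // S.Initl h}) ≤ (mat S.lab).rank + 1 := by
    refine rank_ge _ none ?_
    intro c hc i
    refine S.ker_const S.lab ?_ ?_ c ?_ i none
    · rintro (_ | n)
      · exact ⟨h0, S.lab_none hh⟩
      · exact ⟨n.1, S.lab_some n.2 .refl⟩
    · intro a ha
      right
      have := S.lab_rho (.inl (S.ι (S.so a)))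
      rw [← this]
      show _ = S.lab (S.pi (.inl (S.ι (S.ι (S.so a)))))
      rw [S.inv, S.pi_arr ha]
    · intro h e
      rw [← mv S.lab c ⟨h, e⟩, hc]; rfl
  have hB : Fintype.card S.JJ ≤ (mat S.jj).rank + 1 := by
    refine rank_ge _ (S.jj (.inl h0)) ?_
    intro c hc i
    refine S.ker_const S.jj ?_ ?_ c ?_ i _
    · intro j
      obtain ⟨e, rfl⟩ := Quotient.exists_rep j
      rcases e with h | n
      · exact ⟨h, rfl⟩
      · exact ⟨n.1, S.jj_pi (.inr n)⟩
    · intro a ha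
      left
      rw [← S.pi_arr ha, S.jj_pi]
    · intro h e
      rw [← mv S.jj c ⟨h, e⟩, hc]; rfl
  have hz : (mat S.lab).transpose * mat S.jj = 0 := by
    ext i j
    have := S.sum_XX (fun e => if S.lab e = i then 1 else 0) (fun e => if S.jj e = j then 1 else 0)
      (fun e => by rw [S.lab_rho]) (fun e => by rw [S.jj_pi])
    rw [Matrix.mul_apply]
    rw [Matrix.zero_apply, ← this]
    refine Finset.sum_congr rfl fun h _ => ?_
    rw [Matrix.transpose_apply]
    simp only [mat]
    congr!
  have hr := Matrix.rank_add_rank_le_card_of_mul_eq_zero hz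
  rw [Matrix.rank_transpose] at hr
  rw [Fintype.card_option] at hA
  have := S.card_H
  omega

end Pre
end GentleQuiv

namespace GentleQuiv
set_option linter.unusedSectionVars false
set_option linter.deprecated false
set_option linter.unusedVariables false

section gaps
variable {X : Type} [Finite X] (π : Equiv.Perm X) (G : X → Prop)

noncomputable def gr (n : X) : ℕ := sInf {k | 1 ≤ k ∧ G ((π ^ k) n)}

theorem gr_mem {n : X} (hn : G n) : 1 ≤ gr π G n ∧ G ((π ^ (gr π G n)) n) := by
  have : gr π G n ∈ {k | 1 ≤ k ∧ G ((π ^ k) n)} := by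
    apply Nat.sInf_mem
    exact ⟨orderOf π, orderOf_pos π, by rw [pow_orderOf_eq_one]; exact hn⟩
  exact this

theorem gr_min {n : X} {j : ℕ} (h1 : 1 ≤ j) (h2 : j < gr π G n) : ¬ G ((π ^ j) n) :=
  fun h => Nat.notMem_of_lt_sInf h2 ⟨h1, h⟩

theorem gr_unique {n : X} {k : ℕ} (h1 : 1 ≤ k) (h2 : G ((π ^ k) n))
    (h3 : ∀ j, 1 ≤ j → j < k → ¬ G ((π ^ j) n)) : gr π G n = k := by
  apply le_antisymm
  · exact Nat.sInf_le ⟨h1, h2⟩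
  · by_contra hc
    push Not at hc
    have : gr π G n ∈ {k | 1 ≤ k ∧ G ((π ^ k) n)} := Nat.sInf_mem ⟨k, h1, h2⟩
    exact h3 _ this.1 hc this.2

theorem gr_cover {n e : X} (hn : G n) (h : π.SameCycle n e) :
    ∃ n' j, G n' ∧ π.SameCycle n n' ∧ j < gr π G n' ∧ (π ^ j) n' = e := by
  obtain ⟨k, hk⟩ := h.exists_nat_pow_eq
  clear h
  induction k using Nat.strong_induction_on generalizing n with
  | _ k ih =>
    by_cases c : k < gr π G n
    · exact ⟨n, k, hn, .refl _ _, c, hk⟩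
    · have hm := gr_mem π G hn
      have hs : π.SameCycle n ((π ^ gr π G n) n) := ⟨gr π G n, by simp⟩
      obtain ⟨n', j, h1, h2, h3, h4⟩ := ih (k - gr π G n) (by omega) hm.2 (by
        rw [← Equiv.Perm.mul_apply, ← pow_add, ← hk]; congr 2; omega)
      exact ⟨n', j, h1, hs.trans h2, h3, h4⟩

theorem gr_inj_aux {n n' : X} {j j' : ℕ} (hn : G n) (h' : j' < gr π G n') (hjj : j ≤ j')
    (e : (π ^ j) n = (π ^ j') n') : n = n' ∧ j = j' := by
  have h1 : n = (π ^ (j' - j)) n' := by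
    apply (π ^ j).injective
    rw [e, ← Equiv.Perm.mul_apply, ← pow_add]; congr 2; omega
  by_cases c : j = j'
  · subst c; simp at h1; exact ⟨h1, rfl⟩
  · exfalso
    refine gr_min π G (n := n') (j := j' - j) (by omega) (by omega) ?_
    rw [← h1]; exact hn

theorem gr_inj {n n' : X} {j j' : ℕ} (hn : G n) (hn' : G n') (h : j < gr π G n)
    (h' : j' < gr π G n') (e : (π ^ j) n = (π ^ j') n') : n = n' ∧ j = j' := by
  rcases le_total j j' with c | c
  · exact gr_inj_aux π G hn h' c e
  · have := gr_inj_aux π G hn' h c e.symm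
    exact ⟨this.1.symm, this.2.symm⟩

open Classical in
theorem gr_sum [Fintype X] (K : Finset X) (hK : ∀ n ∈ K, G n)
    (hcl : ∀ n ∈ K, ∀ m, G m → π.SameCycle n m → m ∈ K) :
    ∑ n ∈ K, gr π G n = (Finset.univ.filter fun e => ∃ n ∈ K, π.SameCycle n e).card := by
  have e0 : ∑ n ∈ K, gr π G n = (K.sigma fun n => Finset.range (gr π G n)).card := by
    simp [Finset.card_sigma]
  rw [e0]
  refine Finset.card_bij (fun x _ => (π ^ x.2) x.1) ?_ ?_ ?_
  · rintro ⟨n, j⟩ h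
    simp only [Finset.mem_sigma] at h
    simp only [Finset.mem_filter, Finset.mem_univ, true_and]
    exact ⟨n, h.1, j, by simp⟩
  · rintro ⟨n, j⟩ h ⟨n', j'⟩ h' e
    simp only [Finset.mem_sigma, Finset.mem_range] at h h'
    obtain ⟨rfl, rfl⟩ := gr_inj π G (hK _ h.1) (hK _ h'.1) h.2 h'.2 e
    rfl
  · intro e he
    simp only [Finset.mem_filter, Finset.mem_univ, true_and] at he
    obtain ⟨n, hn, hs⟩ := he
    obtain ⟨n', j, h1, h2, h3, h4⟩ := gr_cover π G (hK n hn) hs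
    exact ⟨⟨n', j⟩, by simp only [Finset.mem_sigma, Finset.mem_range]; exact ⟨hcl n hn n' h1 h2, h3⟩, h4⟩

end gaps

namespace Pre
variable {H : Type} [Fintype H] [DecidableEq H] (S : Pre H)

/-- antiwalks (head of the list is the last arrow) -/
inductive AW (n : H) : List ℕ → H → Prop
  | nil : AW n [] n
  | cons {l h a} : AW n l h → a ∈ S.A → S.so a = h → AW n (a :: l) (S.ta a)

theorem AW.pow {n : H} (hn : S.Initl n) {l : List ℕ} {h : H} (w : S.AW n l h) :
    (S.pi ^ (l.length + 1)) (.inr ⟨n, hn⟩) = .inl h ∧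
    ∀ j, 1 ≤ j → j ≤ l.length + 1 → ∃ x, (S.pi ^ j) (.inr ⟨n, hn⟩) = .inl x := by
  induction w with
  | nil =>
    refine ⟨by simp [S.pi_gap], ?_⟩
    intro j h1 h2
    have : j = 1 := by simp at h2; omega
    subst this
    exact ⟨n, by simp [S.pi_gap]⟩
  | @cons l h a w ha hs ih =>
    have e : (S.pi ^ ((a :: l).length + 1)) (.inr ⟨n, hn⟩) = .inl (S.ta a) := by
      rw [List.length_cons, pow_succ', Equiv.Perm.mul_apply, ih.1, ← hs, S.pi_arr ha]
    refine ⟨e, ?_⟩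
    intro j h1 h2
    by_cases c : j ≤ l.length + 1
    · exact ih.2 j h1 c
    · have : j = (a :: l).length + 1 := by simp at h2 ⊢; omega
      exact ⟨_, by rw [this, e]⟩

def Gp (e : S.XX) : Prop := S.invo e = e

theorem gp_inr (n : {h : H // S.Initl h}) : S.Gp (.inr n) := (S.io_gap _).2 ⟨n, rfl⟩
theorem gp_inl (h : H) : ¬ S.Gp (.inl h) := by
  intro c; obtain ⟨n, hn⟩ := (S.io_gap _).1 c; cases hn

theorem AW.run {n m : H} (hn : S.Initl n) {l : List ℕ} {h : H} (w : S.AW n l h) (t : S.Term h)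
    (hm : S.Initl m) (hr : S.RT m (S.ι h)) :
    gr S.pi S.Gp (.inr ⟨n, hn⟩) = l.length + 2 ∧
      (S.pi ^ (l.length + 2)) (.inr ⟨n, hn⟩) = .inr ⟨m, hm⟩ := by
  have p := w.pow S hn
  have e : (S.pi ^ (l.length + 2)) (.inr ⟨n, hn⟩) = .inr ⟨m, hm⟩ := by
    rw [pow_succ', Equiv.Perm.mul_apply, p.1, S.pi_term hm t hr]
  refine ⟨gr_unique _ _ (by omega) ?_ ?_, e⟩
  · rw [e]; exact S.gp_inr _
  · intro j h1 h2
    obtain ⟨x, hx⟩ := p.2 j h1 (by omega)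
    rw [hx]; exact S.gp_inl x

theorem AW.unique {n : H} (hn : S.Initl n) {l l' : List ℕ} {h h' : H} (w : S.AW n l h) (w' : S.AW n l' h')
    (hl : l.length = l'.length) : l = l' ∧ h = h' := by
  induction w generalizing l' h' with
  | nil =>
    cases w' with
    | nil => exact ⟨rfl, rfl⟩
    | cons => simp at hl
  | cons w ha hs ih =>
    cases w' with
    | nil => simp at hl
    | cons w' ha' hs' =>
      obtain ⟨rfl, rfl⟩ := ih w' (by simpa using hl)
      have := S.so_inj _ ha _ ha' (hs.trans hs'.symm)
      subst this
      exact ⟨rfl, rfl⟩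

theorem AW.unique_term {n : H} (hn : S.Initl n) {l l' : List ℕ} {h h' : H} (w : S.AW n l h)
    (w' : S.AW n l' h') (t : S.Term h) (t' : S.Term h') : l = l' ∧ h = h' := by
  obtain ⟨m, hm, hr⟩ := S.exists_start (h := S.ι h) (by rw [S.inv]; exact t)
  obtain ⟨m', hm', hr'⟩ := S.exists_start (h := S.ι h') (by rw [S.inv]; exact t')
  have h1 := (w.run S hn t hm hr).1
  have h2 := (w'.run S hn t' hm' hr').1
  exact w.unique S hn w' (by omega)

/-- every antiwalk with enough room exists -/
theorem AW.exists {n : H} (hn : S.Initl n) (j : ℕ) (hj : j + 1 < gr S.pi S.Gp (.inr ⟨n, hn⟩)) :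
    ∃ l h, S.AW n l h ∧ l.length = j := by
  induction j with
  | zero => exact ⟨[], n, .nil, rfl⟩
  | succ j ih =>
    obtain ⟨l, h, w, rfl⟩ := ih (by omega)
    rcases S.cases_half h with ⟨a, ha, e⟩ | ⟨t, m, hm, hr⟩
    · exact ⟨a :: l, S.ta a, .cons w ha e, rfl⟩
    · have := (w.run S hn t hm hr).1
      omega

theorem AW.exists_max {n : H} (hn : S.Initl n) : ∃ l h, S.AW n l h ∧ S.Term h := by
  have hm := gr_mem S.pi S.Gp (S.gp_inr ⟨n, hn⟩)
  have h2 : 2 ≤ gr S.pi S.Gp (.inr ⟨n, hn⟩) := by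
    by_contra hc
    have : gr S.pi S.Gp (.inr ⟨n, hn⟩) = 1 := by omega
    rw [this, pow_one, S.pi_gap] at hm
    exact S.gp_inl _ hm.2
  obtain ⟨l, h, w, hl⟩ := AW.exists S hn (gr S.pi S.Gp (.inr ⟨n, hn⟩) - 2) (by omega)
  refine ⟨l, h, w, ?_⟩
  rcases S.cases_half h with ⟨a, ha, e⟩ | ⟨t, _⟩
  · have := ((AW.cons w ha e).pow S hn).2 (gr S.pi S.Gp (.inr ⟨n, hn⟩)) (by omega) (by
      simp only [List.length_cons]; omega)
    obtain ⟨x, hx⟩ := this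
    rw [hx] at hm
    exact absurd hm.2 (S.gp_inl x)
  · exact t

theorem AW.mem {n : H} {l : List ℕ} {h : H} (w : S.AW n l h) {a : ℕ} (hm : a ∈ l) :
    ∃ l', S.AW n (a :: l') (S.ta a) ∧ a ∈ S.A := by
  induction w with
  | nil => simp at hm
  | @cons l h b w hb hs ih =>
    rcases List.mem_cons.1 hm with e | e
    · subst e; exact ⟨l, .cons w hb hs, hb⟩
    · exact ih e

/-- gapless half-vertices -/
def Gl (e : S.XX) : Prop := ∀ n, S.Gp n → ¬ S.pi.SameCycle n e

/-- being on a maximal antiwalk -/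
theorem on_walk {a : ℕ} (ha : a ∈ S.A) :
    (¬ S.Gl (.inl (S.ta a))) ↔ ∃ n l h, S.Initl n ∧ S.AW n l h ∧ S.Term h ∧ a ∈ l := by
  constructor
  · intro h
    unfold Gl at h
    push Not at h
    obtain ⟨g, hg, hs⟩ := h
    obtain ⟨g', j, h1, h2, h3, h4⟩ := gr_cover S.pi S.Gp hg hs
    obtain ⟨⟨n, hn⟩, rfl⟩ := (S.io_gap _).1 h1
    obtain ⟨l, h, w, t⟩ := AW.exists_max S hn
    obtain ⟨m, hm, hr⟩ := S.exists_start (h := S.ι h) (by rw [S.inv]; exact t)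
    have hrun := (w.run S hn t hm hr).1
    refine ⟨n, l, h, hn, w, t, ?_⟩
    have key : ∀ {l : List ℕ} {h : H}, S.AW n l h → ∀ j, j < l.length + 2 →
        (S.pi ^ j) (.inr ⟨n, hn⟩) = .inl (S.ta a) → a ∈ l := by
      intro l h w
      induction w with
      | nil =>
        intro j hj e
        simp at hj
        interval_cases j
        · simp at e
        · rw [pow_one, S.pi_gap] at e
          exact absurd (Sum.inl.inj e).symm (hn a ha)
      | @cons l h b w hb hs ih =>
        intro j hj e
        by_cases c : j < l.length + 2
        · exact List.mem_cons_of_mem _ (ih j c e)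
        · have e1 : j = (b :: l).length + 1 := by simp at hj ⊢; omega
          rw [e1, ((AW.cons w hb hs).pow S hn).1] at e
          rw [S.ta_inj a ha b hb (Sum.inl.inj e).symm]; simp
    exact key w j (by omega) h4
  · rintro ⟨n, l, h, hn, w, t, hm⟩ hg
    obtain ⟨l', w', _⟩ := w.mem S hm
    refine hg (.inr ⟨n, hn⟩) (S.gp_inr _) ⟨(((a :: l').length + 1 : ℕ) : ℤ), ?_⟩
    rw [zpow_natCast] 
    exact (w'.pow S hn).1

end Pre
end GentleQuiv

namespace GentleQuiv
set_option linter.unusedSectionVars false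
set_option linter.deprecated false
set_option linter.unusedVariables false

namespace Pre
variable {H : Type} [Fintype H] [DecidableEq H] (S : Pre H)

/-- gap labelling the permitted path -/
noncomputable def nodef (e : S.XX) : S.XX :=
  match S.lab e with
  | some n => .inr n
  | none => e

theorem nodef_some {e : S.XX} {n} (h : S.lab e = some n) : S.nodef e = .inr n := by
  simp [nodef, h]

theorem lab_ex (ac : ∀ h, ∃ n, S.Initl n ∧ S.RT n h) (e : S.XX) : ∃ n, S.lab e = some n := by
  rcases e with h | n
  · obtain ⟨n, hn, hr⟩ := ac h
    exact ⟨_, S.lab_some hn hr⟩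
  · exact ⟨n, rfl⟩

theorem pi_fpf (e : S.XX) : S.pi e ≠ e := by
  rcases e with h | n
  · rcases S.cases_half h with ⟨a, ha, rfl⟩ | ⟨t, n, hn, hr⟩
    · rw [S.pi_arr ha]
      intro h; exact S.nl a ha (Sum.inl.inj h).symm
    · rw [S.pi_term hn t hr]; intro h; cases h
  · rw [S.pi_gap]; intro h; cases h

theorem pi_io_inj : Function.Injective (fun e => S.pi (S.invo e)) := by
  intro x y h
  have := S.pi.injective h
  rw [← S.io_inv x, this, S.io_inv]

/-- the model attached to an acyclic half-vertex structure -/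
noncomputable def toMod (ac : ∀ h, ∃ n, S.Initl n ∧ S.RT n h) : Mod S.XX where
  ι := S.invo
  π := S.pi
  node := S.nodef
  inv := S.io_inv
  fpf := S.pi_fpf
  node_gap e := by
    obtain ⟨n, hn⟩ := S.lab_ex ac e
    rw [S.nodef_some hn]; rfl
  gap_node e h := by
    obtain ⟨n, rfl⟩ := (S.io_gap e).1 h
    exact S.nodef_some rfl
  node_step e := by
    obtain ⟨n, hn⟩ := S.lab_ex ac e
    rw [S.nodef_some hn, S.nodef_some ((S.lab_rho e).trans hn)]
  acyc T h1 h2 := by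
    by_contra hne
    obtain ⟨e, he⟩ := Set.nonempty_iff_ne_empty.2 hne
    have surj : ∀ x ∈ T, ∃ y ∈ T, S.pi (S.invo y) = x := by
      have fin : Finite T := inferInstance
      let f : T → T := fun x => ⟨S.pi (S.invo x.1), h2 x.1 x.2⟩
      have fi : Function.Injective f := by
        intro x y h
        exact Subtype.ext (S.pi_io_inj (congrArg Subtype.val h))
      intro x hx
      obtain ⟨y, hy⟩ := (Finite.injective_iff_surjective.1 fi) ⟨x, hx⟩
      exact ⟨y.1, y.2, congrArg Subtype.val hy⟩
    have gap : ∀ n, (.inr n : S.XX) ∉ T := fun n hn => h1 _ hn rfl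
    rcases e with h | n
    · obtain ⟨n, hn, hr⟩ := ac h
      have key : ∀ {x : H}, S.RT n x → (.inl x : S.XX) ∈ T → False := by
        intro x hx
        induction hx with
        | refl =>
          intro hT
          obtain ⟨y, hy, e⟩ := surj _ hT
          have : S.invo y = .inr ⟨n, hn⟩ := S.pi.injective (by rw [e]; rfl)
          have : y = .inr ⟨n, hn⟩ := by rw [← S.io_inv y, this]; rfl
          exact gap _ (this ▸ hy)
        | @tail y z _ hyz ih =>
          intro hT
          obtain ⟨w, hw, e⟩ := surj _ hT
          obtain ⟨a, ha, e1, e2⟩ := hyz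
          have : S.invo w = .inl (S.so a) := S.pi.injective (by rw [e, S.pi_arr ha, e2])
          have : w = .inl y := by
            rw [← S.io_inv w, this, e1]; show Sum.inl (S.ι (S.ι y)) = _; rw [S.inv]
          exact ih (this ▸ hw)
      exact key hr he
    · exact gap n he
  conn P h1 h2 e e' g g' hp := by
    have hi : ∀ e : S.XX, S.invo e ≠ e → ∃ h, e = .inl h := by
      intro e he
      rcases e with h | n
      · exact ⟨h, rfl⟩
      · exact absurd rfl he
    obtain ⟨h, rfl⟩ := hi e g
    obtain ⟨h', rfl⟩ := hi e' g'
    refine S.conn (fun x => P (.inl x)) (fun x hx => (h1 (.inl x)).1 hx) ?_ h h' hp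
    intro a ha
    have := h2 (.inl (S.so a)) (S.gp_inl _) (by rw [S.pi_arr ha]; exact S.gp_inl _)
    rw [S.pi_arr ha] at this
    exact this

theorem gr_ge (n : {h : H // S.Initl h}) : 2 ≤ gr S.pi S.Gp (.inr n) := by
  obtain ⟨l, h, w, t⟩ := AW.exists_max S n.2
  obtain ⟨m, hm, hr⟩ := S.exists_start (h := S.ι h) (by rw [S.inv]; exact t)
  have := (w.run S n.2 t hm hr).1
  have : gr S.pi S.Gp (.inr n) = l.length + 2 := this
  omega

/-- numerical data extracted from the invariant -/
structure Num (m1 m2 p q : ℕ) (n1 n2 : {h : H // S.Initl h}) : Prop where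
  tri : ∀ e, S.Gl e → {e' | S.pi.SameCycle e e'}.ncard = 3
  gl : {j : S.JJ | ∃ e, S.Gl e ∧ S.jj e = j}.ncard = m1 + m2
  ne : ¬ S.pi.SameCycle (.inr n1) (.inr n2)
  cov : ∀ n, S.pi.SameCycle (.inr n1) (.inr n) ∨ S.pi.SameCycle (.inr n2) (.inr n)
  c1 : {n : {h : H // S.Initl h} | S.pi.SameCycle (.inr n1) (.inr n)}.ncard = p + m1
  c2 : {n : {h : H // S.Initl h} | S.pi.SameCycle (.inr n2) (.inr n)}.ncard = q + m2
  s1 : ∑ᶠ n ∈ {n : {h : H // S.Initl h} | S.pi.SameCycle (.inr n1) (.inr n)},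
    (gr S.pi S.Gp (.inr n) - 2) = p
  s2 : ∑ᶠ n ∈ {n : {h : H // S.Initl h} | S.pi.SameCycle (.inr n2) (.inr n)},
    (gr S.pi S.Gp (.inr n) - 2) = q

open Classical in
theorem cls_count {k s : ℕ} (n1 : {h : H // S.Initl h})
    (c1 : {n : {h : H // S.Initl h} | S.pi.SameCycle (.inr n1) (.inr n)}.ncard = k)
    (s1 : ∑ᶠ n ∈ {n : {h : H // S.Initl h} | S.pi.SameCycle (.inr n1) (.inr n)},
      (gr S.pi S.Gp (.inr n) - 2) = s) (K : Finset S.XX)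
    (hK : ∀ e, e ∈ K ↔ S.Gp e ∧ S.pi.SameCycle (.inr n1) e) :
    K.card = k ∧ ∑ e ∈ K, gr S.pi S.Gp e = s + 2 * k := by
  have e1 : K = (Finset.univ.filter fun n : {h : H // S.Initl h} =>
      S.pi.SameCycle (.inr n1) (.inr n)).map ⟨Sum.inr, Sum.inr_injective⟩ := by
    ext e
    rw [hK]
    simp only [Finset.mem_map, Finset.mem_filter, Finset.mem_univ, true_and,
      Function.Embedding.coeFn_mk]
    constructor
    · rintro ⟨h1, h2⟩
      obtain ⟨n, rfl⟩ := (S.io_gap e).1 h1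
      exact ⟨n, h2, rfl⟩
    · rintro ⟨n, h, rfl⟩
      exact ⟨S.gp_inr n, h⟩
  have e2 : {n : {h : H // S.Initl h} | S.pi.SameCycle (.inr n1) (.inr n)} =
      ((Finset.univ.filter fun n : {h : H // S.Initl h} =>
      S.pi.SameCycle (.inr n1) (.inr n) : Finset _) : Set _) := by
    ext n; simp
  rw [e2, Set.ncard_coe_finset] at c1
  rw [e2, finsum_mem_coe_finset] at s1
  rw [e1, Finset.card_map, Finset.sum_map]
  refine ⟨c1, ?_⟩
  rw [← s1, ← c1, mul_comm, ← smul_eq_mul, ← Finset.sum_const, ← Finset.sum_add_distrib]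
  refine Finset.sum_congr rfl fun n _ => ?_
  have := S.gr_ge n
  show gr S.pi S.Gp (.inr n) = _
  omega

variable {S}

open Classical in
theorem Num.total {m1 m2 p q : ℕ} {n1 n2} (N : S.Num m1 m2 p q n1 n2) :
    Fintype.card {h : H // S.Initl h} = p + q + (m1 + m2) ∧
    Fintype.card H = 2 * p + 2 * q + 4 * (m1 + m2) ∧
    {e | S.Gl e}.ncard = 3 * (m1 + m2) ∧ Fintype.card S.JJ = m1 + m2 + 2 := by
  obtain ⟨a1, b1⟩ := S.cls_count n1 N.c1 N.s1
    (Finset.univ.filter fun e => S.Gp e ∧ S.pi.SameCycle (.inr n1) e) (by simp)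
  obtain ⟨a2, b2⟩ := S.cls_count n2 N.c2 N.s2
    (Finset.univ.filter fun e => S.Gp e ∧ S.pi.SameCycle (.inr n2) e) (by simp)
  have hd : Disjoint (Finset.univ.filter fun e => S.Gp e ∧ S.pi.SameCycle (.inr n1) e)
      (Finset.univ.filter fun e => S.Gp e ∧ S.pi.SameCycle (.inr n2) e) := by
    rw [Finset.disjoint_left]
    intro e h1 h2
    simp only [Finset.mem_filter, Finset.mem_univ, true_and] at h1 h2
    exact N.ne (h1.2.trans h2.2.symm)
  have hu : (Finset.univ.filter fun e => S.Gp e) =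
      (Finset.univ.filter fun e => S.Gp e ∧ S.pi.SameCycle (.inr n1) e).disjUnion
      (Finset.univ.filter fun e => S.Gp e ∧ S.pi.SameCycle (.inr n2) e) hd := by
    ext e
    simp only [Finset.mem_disjUnion, Finset.mem_filter, Finset.mem_univ, true_and]
    constructor
    · intro h
      obtain ⟨n, rfl⟩ := (S.io_gap e).1 h
      rcases N.cov n with c | c
      · exact Or.inl ⟨h, c⟩
      · exact Or.inr ⟨h, c⟩
    · rintro (h | h) <;> exact h.1
  have hG : (Finset.univ.filter fun e => S.Gp e).card = p + m1 + (q + m2) := by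
    rw [hu, Finset.card_disjUnion, a1, a2]
  have hI : Fintype.card {h : H // S.Initl h} = p + q + (m1 + m2) := by
    have : (Finset.univ.filter fun e => S.Gp e) =
        (Finset.univ : Finset {h : H // S.Initl h}).map ⟨Sum.inr, Sum.inr_injective⟩ := by
      ext e
      simp only [Finset.mem_map, Finset.mem_filter, Finset.mem_univ, true_and,
        Function.Embedding.coeFn_mk]
      constructor
      · intro h; obtain ⟨n, rfl⟩ := (S.io_gap e).1 h; exact ⟨n, rfl⟩
      · rintro ⟨n, rfl⟩; exact S.gp_inr n
    rw [this, Finset.card_map, Finset.card_univ] at hG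
    omega
  have hgs := gr_sum S.pi S.Gp (Finset.univ.filter fun e => S.Gp e) (by simp)
    (by intro n _ m hm _; simpa using hm)
  rw [hu, Finset.sum_disjUnion, b1, b2, ← hu] at hgs
  have hgs := hgs.trans (congrArg Finset.card (show _ = Finset.univ.filter (fun e => ¬ S.Gl e) from by
    ext e
    simp only [Finset.mem_filter, Finset.mem_univ, true_and, Gl]
    push Not
    simp))
  have hsplit := Finset.card_filter_add_card_filter_not (s := (Finset.univ : Finset S.XX)) (fun e => S.Gl e)
  rw [Finset.card_univ, Fintype.card_sum] at hsplit
  have hGl : (Finset.univ.filter fun e => S.Gl e).card = 3 * (m1 + m2) := by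
    have e2 : {j : S.JJ | ∃ e, S.Gl e ∧ S.jj e = j} =
        ((Finset.univ.filter fun e => S.Gl e).image S.jj : Finset _) := by
      ext j; simp
    have hgl := N.gl
    rw [e2, Set.ncard_coe_finset] at hgl
    rw [← hgl, mul_comm, Finset.card_eq_sum_card_image S.jj]
    apply Finset.sum_const_nat
    intro j hj
    obtain ⟨e, he, rfl⟩ := Finset.mem_image.1 hj
    simp only [Finset.mem_filter, Finset.mem_univ, true_and] at he
    rw [← N.tri e he, ← Set.ncard_coe_finset]
    congr 1
    ext f
    simp only [Finset.coe_filter, Finset.mem_filter, Finset.mem_univ, true_and, Set.mem_setOf_eq, S.jj_eq]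
    exact ⟨fun h => h.2.symm, fun h => ⟨fun n hn hs => he n hn (hs.trans h.symm), h.symm⟩⟩
  have hJ : Fintype.card S.JJ = m1 + m2 + 2 := by
    have hgl := N.gl
    rw [Set.ncard_eq_toFinset_card'] at hgl
    have huniv : (Finset.univ : Finset S.JJ) =
        {j : S.JJ | ∃ e, S.Gl e ∧ S.jj e = j}.toFinset ∪ {S.jj (.inr n1), S.jj (.inr n2)} := by
      symm
      rw [Finset.eq_univ_iff_forall]
      intro j
      obtain ⟨e, rfl⟩ := Quotient.exists_rep j
      change S.jj e ∈ _
      rw [Finset.mem_union]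
      by_cases c : S.Gl e
      · left; simp only [Set.mem_toFinset]; exact ⟨e, c, rfl⟩
      · right
        unfold Gl at c
        push Not at c
        obtain ⟨g, hg, hs⟩ := c
        obtain ⟨n, rfl⟩ := (S.io_gap g).1 hg
        simp only [Finset.mem_insert, Finset.mem_singleton, S.jj_eq]
        rcases N.cov n with c | c
        · exact Or.inl (c.trans hs).symm
        · exact Or.inr (c.trans hs).symm
    rw [← Finset.card_univ, huniv, Finset.card_union_of_disjoint, hgl, Finset.card_pair]
    · intro h; exact N.ne (S.jj_eq.1 h)
    · rw [Finset.disjoint_left]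
      intro j hj hj'
      simp only [Set.mem_toFinset] at hj
      obtain ⟨e, he, rfl⟩ := hj
      simp only [Finset.mem_insert, Finset.mem_singleton, S.jj_eq] at hj'
      rcases hj' with h | h
      · exact he _ (S.gp_inr _) h.symm
      · exact he _ (S.gp_inr _) h.symm
  refine ⟨hI, ?_, ?_, hJ⟩
  · omega
  · rw [← hGl, ← Set.ncard_coe_finset]; congr 1; ext e; simp

theorem Num.acyclic {m1 m2 p q : ℕ} {n1 n2} (N : S.Num m1 m2 p q n1 n2) (h : H) :
    ∃ n, S.Initl n ∧ S.RT n h := by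
  by_contra hc
  have h1 := S.euler hc
  obtain ⟨t1, t2, t3, t4⟩ := N.total
  rw [t1, t2, t4] at h1
  omega

theorem pow_three_of_card (e : S.XX) (h : {e' | S.pi.SameCycle e e'}.ncard = 3) :
    (S.pi ^ 3) e = e := by
  classical
  have hf : {e' | S.pi.SameCycle e e'} = (((S.pi.cycleOf e).support : Finset _) : Set _) := by
    ext f
    simp only [Set.mem_setOf_eq, Finset.mem_coe, Equiv.Perm.mem_support_cycleOf_iff]
    simp [S.pi_fpf]
  rw [hf, Set.ncard_coe_finset] at h
  have := Equiv.Perm.pow_mod_card_support_cycleOf_self_apply S.pi 3 e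
  rw [h] at this
  simpa using this.symm

theorem Num.inv {m1 m2 p q : ℕ} {n1 n2} (N : S.Num m1 m2 p q n1 n2) :
    (S.toMod N.acyclic).Inv where
  tri e he := pow_three_of_card e (N.tri e he)
  count := by
    classical
    obtain ⟨t1, t2, t3, t4⟩ := N.total
    have h1 : {e | (S.toMod N.acyclic).ι e ≠ e}.ncard = Fintype.card H := by
      have : {e | (S.toMod N.acyclic).ι e ≠ e} = Set.range (Sum.inl : H → S.XX) := by
        ext e
        rcases e with h | n
        · simp only [Set.mem_setOf_eq, Set.mem_range, Sum.inl.injEq, exists_eq, iff_true]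
          exact S.gp_inl h
        · simp only [Set.mem_setOf_eq, Set.mem_range, reduceCtorEq, exists_false, iff_false, not_not]
          exact S.gp_inr n
      rw [this, ← Set.image_univ, Set.ncard_image_of_injective _ Sum.inl_injective, Set.ncard_univ,
        Nat.card_eq_fintype_card]
    have h2 : {e | (S.toMod N.acyclic).ι e = e}.ncard = Fintype.card {h : H // S.Initl h} := by
      have : {e | (S.toMod N.acyclic).ι e = e} = Set.range (Sum.inr : _ → S.XX) := by
        ext e
        rcases e with h | n
        · simp only [Set.mem_setOf_eq, Set.mem_range, reduceCtorEq, exists_false, iff_false]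
          exact S.gp_inl h
        · simp only [Set.mem_setOf_eq, Set.mem_range, Sum.inr.injEq, exists_eq, iff_true]
          exact S.gp_inr n
      rw [this, ← Set.image_univ, Set.ncard_image_of_injective _ Sum.inr_injective, Set.ncard_univ,
        Nat.card_eq_fintype_card]
    have h3 : {e | (S.toMod N.acyclic).Gapless e}.ncard = 3 * (m1 + m2) := t3
    rw [h1, h2, h3, t1, t2]
    ring
  two := by
    refine ⟨.inr n1, .inr n2, S.gp_inr _, S.gp_inr _, N.ne, ?_⟩
    intro k hk
    obtain ⟨n, rfl⟩ := (S.io_gap k).1 hk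
    exact N.cov n

open Classical in
theorem Num.i2 {m1 m2 p q : ℕ} {n1 n2} (N : S.Num m1 m2 p q n1 n2) :
    (S.toMod N.acyclic).I2 := by
  intro e he
  obtain ⟨n, rfl⟩ := (S.io_gap e).1 he
  have key : ∀ {n' k s : _}, S.pi.SameCycle (.inr n') (.inr n) →
      {n : {h : H // S.Initl h} | S.pi.SameCycle (.inr n') (.inr n)}.ncard = k →
      ∑ᶠ n ∈ {n : {h : H // S.Initl h} | S.pi.SameCycle (.inr n') (.inr n)},
      (gr S.pi S.Gp (.inr n) - 2) = s → s ≤ k →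
      ∑ k ∈ (S.toMod N.acyclic).cls (.inr n), (S.toMod N.acyclic).r k ≤
        3 * ((S.toMod N.acyclic).cls (.inr n)).card := by
    intro n' k s hs h1 h2 h3
    obtain ⟨a, b⟩ := S.cls_count n' h1 h2 ((S.toMod N.acyclic).cls (.inr n)) (by
      intro e
      rw [Mod.mem_cls]
      exact ⟨fun h => ⟨h.1, hs.trans h.2⟩, fun h => ⟨h.1, hs.symm.trans h.2⟩⟩)
    rw [a]
    have b' : ∑ k ∈ (S.toMod N.acyclic).cls (.inr n), (S.toMod N.acyclic).r k = s + 2 * k := b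
    rw [b']; omega
  rcases N.cov n with c | c
  · exact key c N.c1 N.s1 (by omega)
  · exact key c N.c2 N.s2 (by omega)

end Pre
end GentleQuiv

namespace GentleQuiv
set_option linter.unusedSectionVars false
set_option linter.deprecated false
set_option linter.unusedVariables false

/-- half-vertices of a quiver -/
abbrev HH (Q : QuivRel) : Type := {x : ℕ × ℤ // x ∈ Q.V ×ˢ ({1, -1} : Finset ℤ)}

section conc
variable {Q : QuivRel} (st : SigmaTau Q) (hg : IsGentle Q)

theorem hh_mem {x : ℕ} {s : ℤ} (hx : x ∈ Q.V) (hs : s = 1 ∨ s = -1) :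
    (x, s) ∈ Q.V ×ˢ ({1, -1} : Finset ℤ) := by
  simp [hx, hs]

def mkH (x : ℕ) (s : ℤ) (hx : x ∈ Q.V) (hs : s = 1 ∨ s = -1) : HH Q := ⟨(x, s), hh_mem hx hs⟩

theorem hh_v (h : HH Q) : h.1.1 ∈ Q.V := (Finset.mem_product.1 h.2).1
theorem hh_s (h : HH Q) : h.1.2 = 1 ∨ h.1.2 = -1 := by
  have := (Finset.mem_product.1 h.2).2
  simpa using this

def hι (h : HH Q) : HH Q := ⟨(h.1.1, -h.1.2), hh_mem (hh_v h) (by rcases hh_s h with e | e <;> simp [e])⟩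

noncomputable def hso (hg : IsGentle Q) (a : ℕ) : HH Q :=
  if h : (Q.src a, st.σ a) ∈ Q.V ×ˢ ({1, -1} : Finset ℤ) then ⟨_, h⟩ else
    ⟨(hg.1.choose, 1), hh_mem hg.1.choose_spec (Or.inl rfl)⟩

noncomputable def hta (hg : IsGentle Q) (a : ℕ) : HH Q :=
  if h : (Q.tgt a, st.τ a) ∈ Q.V ×ˢ ({1, -1} : Finset ℤ) then ⟨_, h⟩ else
    ⟨(hg.1.choose, 1), hh_mem hg.1.choose_spec (Or.inl rfl)⟩

theorem hso_val {a : ℕ} (ha : a ∈ Q.A) : (hso st hg a).1 = (Q.src a, st.σ a) := by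
  have := hh_mem (hg.2.1 a ha).1 (st.σ_pm a ha)
  rw [hso, dif_pos this]

theorem hta_val {a : ℕ} (ha : a ∈ Q.A) : (hta st hg a).1 = (Q.tgt a, st.τ a) := by
  have := hh_mem (hg.2.1 a ha).2 (st.τ_pm a ha)
  rw [hta, dif_pos this]

theorem pm_ne_neg {s : ℤ} (h : s = 1 ∨ s = -1) : s ≠ -s := by
  rcases h with h | h <;> subst h <;> decide

theorem hso_inj {a b : ℕ} (ha : a ∈ Q.A) (hb : b ∈ Q.A) (h : hso st hg a = hso st hg b) : a = b := by
  have h1 := congrArg Subtype.val h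
  rw [hso_val st hg ha, hso_val st hg hb, Prod.mk.injEq] at h1
  by_contra hne
  have h2 := st.σ_src a ha b hb hne h1.1
  rw [h1.2] at h2
  exact pm_ne_neg (st.σ_pm b hb) h2

theorem hta_inj {a b : ℕ} (ha : a ∈ Q.A) (hb : b ∈ Q.A) (h : hta st hg a = hta st hg b) : a = b := by
  have h1 := congrArg Subtype.val h
  rw [hta_val st hg ha, hta_val st hg hb, Prod.mk.injEq] at h1
  by_contra hne
  have h2 := st.τ_tgt a ha b hb hne h1.1
  rw [h1.2] at h2
  exact pm_ne_neg (st.τ_pm b hb) h2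

theorem hrel {a b : ℕ} (ha : a ∈ Q.A) (hb : b ∈ Q.A) :
    (a, b) ∈ Q.rel ↔ hso st hg a = hta st hg b := by
  rw [Subtype.ext_iff, hso_val st hg ha, hta_val st hg hb, Prod.mk.injEq]
  constructor
  · intro h
    have hc := (hg.2.2.2.1 _ h).2.2
    exact ⟨hc, (st.rel_iff a ha b hb hc).1 h⟩
  · rintro ⟨h1, h2⟩
    exact (st.rel_iff a ha b hb h1).2 h2

theorem hι_inv (h : HH Q) : hι (hι h) = h := by
  apply Subtype.ext; simp [hι]

theorem same_v {h h' : HH Q} (e : h.1.1 = h'.1.1) : h' = h ∨ h' = hι h := by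
  have h1 := hh_s h
  have h2 := hh_s h'
  by_cases c : h.1.2 = h'.1.2
  · left; exact Subtype.ext (Prod.ext e.symm c.symm)
  · right
    apply Subtype.ext
    refine Prod.ext e.symm ?_
    show h'.1.2 = -h.1.2
    omega

/-- the half-vertex structure of a gentle quiver -/
noncomputable def toPre (hnl : ∀ a ∈ Q.A, hso st hg a ≠ hta st hg a) : Pre (HH Q) where
  A := Q.A
  so := hso st hg
  ta := hta st hg
  ι := hι
  E h := decide (h.1.2 = 1)
  inv := hι_inv
  Eι h := by
    rcases hh_s h with e | e <;> simp [hι, e]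
  so_inj a ha b hb h := hso_inj st hg ha hb h
  ta_inj a ha b hb h := hta_inj st hg ha hb h
  nl := hnl
  conn P h1 h2 e e' he := by
    have sv : ∀ h h' : HH Q, h.1.1 = h'.1.1 → P h → P h' := by
      intro h h' e hp
      rcases same_v e with r | r
      · rwa [r]
      · rw [r]; exact h1 _ hp
    have key : ∀ y, Relation.ReflTransGen (Adj Q) e.1.1 y → ∀ h : HH Q, h.1.1 = y → P h := by
      intro y hy
      induction hy with
      | refl => intro h hh; exact sv e h hh.symm he
      | tail _ hyz ih =>
        intro h hh
        obtain ⟨a, ha, ⟨r1, r2⟩ | ⟨r1, r2⟩⟩ := hyz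
        · have p1 := ih (hso st hg a) (by rw [hso_val st hg ha]; exact r1)
          exact sv _ _ (by rw [hta_val st hg ha, hh]; exact r2) ((h2 a ha).1 p1)
        · have p1 := ih (hta st hg a) (by rw [hta_val st hg ha]; exact r2)
          exact sv _ _ (by rw [hso_val st hg ha, hh]; exact r1) ((h2 a ha).2 p1)
    exact key _ (hg.2.2.1 _ (hh_v e) _ (hh_v e')) e' rfl

variable (hnl : ∀ a ∈ Q.A, hso st hg a ≠ hta st hg a)

noncomputable def cvm : (toPre st hg hnl).XX → ℕ
  | .inl h => h.1.1
  | .inr n => n.1.1.1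

open Classical in
noncomputable def cam : (toPre st hg hnl).XX → ℕ
  | .inl h => if c : ∃ a ∈ Q.A, hta st hg a = h then c.choose else 0
  | .inr n => 0

theorem cam_ta {a : ℕ} (ha : a ∈ Q.A) : cam st hg hnl (.inl (hta st hg a)) = a := by
  have c : ∃ b ∈ Q.A, hta st hg b = hta st hg a := ⟨a, ha, rfl⟩
  simp only [cam, dif_pos c]
  exact hta_inj st hg c.choose_spec.1 ha c.choose_spec.2

theorem Pre.arr_iff {H : Type} [Fintype H] [DecidableEq H] (S : Pre H)
    (ac : ∀ h, ∃ n, S.Initl n ∧ S.RT n h) (e : S.XX) :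
    (S.toMod ac).Arr e ↔ ∃ a ∈ S.A, e = .inl (S.ta a) := by
  constructor
  · rintro ⟨h1, h2⟩
    have h2 : S.invo (S.pi.symm e) ≠ S.pi.symm e := h2
    have he : e = S.pi (S.pi.symm e) := by simp
    generalize S.pi.symm e = f at *
    rcases f with x | n
    · rcases S.cases_half x with ⟨a, ha, rfl⟩ | ⟨t, n, hn, hr⟩
      · exact ⟨a, ha, by rw [he, S.pi_arr ha]⟩
      · rw [S.pi_term hn t hr] at he
        rw [he] at h1
        exact absurd (S.gp_inr _) h1
    · exact absurd (S.gp_inr n) h2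
  · rintro ⟨a, ha, rfl⟩
    have e1 : S.pi.symm (.inl (S.ta a)) = .inl (S.so a) := by
      rw [Equiv.symm_apply_eq, S.pi_arr ha]
    refine ⟨S.gp_inl _, ?_⟩
    show S.invo (S.pi.symm (.inl (S.ta a))) ≠ S.pi.symm (.inl (S.ta a))
    rw [e1]; exact S.gp_inl _

theorem toRep (ac : ∀ h, ∃ n, (toPre st hg hnl).Initl n ∧ (toPre st hg hnl).RT n h) :
    Rep Q ((toPre st hg hnl).toMod ac) (cvm st hg hnl) (cam st hg hnl) := by
  have sy : ∀ a ∈ Q.A, ((toPre st hg hnl).toMod ac).π.symm (.inl (hta st hg a)) =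
      .inl (hso st hg a) := by
    intro a ha
    rw [Equiv.symm_apply_eq]
    exact ((toPre st hg hnl).pi_arr ha).symm
  have ai := (toPre st hg hnl).arr_iff ac
  have ar : ∀ a ∈ Q.A, ((toPre st hg hnl).toMod ac).Arr (.inl (hta st hg a)) :=
    fun a ha => (ai _).2 ⟨a, ha, rfl⟩
  have ai' : ∀ e, ((toPre st hg hnl).toMod ac).Arr e → ∃ a ∈ Q.A, e = .inl (hta st hg a) :=
    fun e he => (ai e).1 he
  have nongap : ∀ e, ((toPre st hg hnl).toMod ac).ι e ≠ e → ∃ h, e = .inl h := by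
    intro e he
    rcases e with h | n
    · exact ⟨h, rfl⟩
    · exact absurd rfl he
  constructor
  · rintro (h | n) <;> rfl
  · intro e e' h1 h2 h3
    obtain ⟨h, rfl⟩ := nongap e h1
    obtain ⟨h', rfl⟩ := nongap e' h2
    rcases same_v (show h.1.1 = h'.1.1 from h3) with r | r
    · left; rw [r]
    · right; rw [r]; rfl
  · intro v
    constructor
    · intro hv
      exact ⟨.inl (mkH v 1 hv (Or.inl rfl)), (toPre st hg hnl).gp_inl _, rfl⟩
    · rintro ⟨e, he, rfl⟩
      obtain ⟨h, rfl⟩ := nongap e he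
      exact hh_v h
  · intro a
    constructor
    · intro ha; exact ⟨_, ar a ha, cam_ta st hg hnl ha⟩
    · rintro ⟨h, hh, rfl⟩
      obtain ⟨a, ha, rfl⟩ := ai' h hh
      rwa [cam_ta st hg hnl ha]
  · intro h h' hh hh' e
    obtain ⟨a, ha, rfl⟩ := ai' h hh
    obtain ⟨b, hb, rfl⟩ := ai' h' hh'
    rw [cam_ta st hg hnl ha, cam_ta st hg hnl hb] at e
    rw [e]
  · intro h hh
    obtain ⟨a, ha, rfl⟩ := ai' h hh
    rw [cam_ta st hg hnl ha, sy a ha]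
    show _ = (hso st hg a).1.1
    rw [hso_val st hg ha]
  · intro h hh
    obtain ⟨a, ha, rfl⟩ := ai' h hh
    rw [cam_ta st hg hnl ha]
    show _ = (hta st hg a).1.1
    rw [hta_val st hg ha]
  · intro a b
    constructor
    · intro hr
      obtain ⟨ha, hb, _⟩ := hg.2.2.2.1 _ hr
      have e := (hrel st hg ha hb).1 hr
      refine ⟨.inl (hta st hg a), ar a ha, ?_, (cam_ta st hg hnl ha).symm, ?_⟩
      · rw [sy a ha, e]; exact ar b hb
      · rw [sy a ha, e, cam_ta st hg hnl hb]
    · rintro ⟨h, h1, h2, rfl, rfl⟩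
      obtain ⟨a, ha, rfl⟩ := ai' h h1
      rw [sy a ha] at h2 ⊢
      obtain ⟨b, hb, e⟩ := ai' _ h2
      rw [e, cam_ta st hg hnl ha, cam_ta st hg hnl hb]
      exact (hrel st hg ha hb).2 (Sum.inl.inj e)

theorem finish_of_num {m1 m2 p q : ℕ} {n1 n2}
    (N : (toPre st hg hnl).Num m1 m2 p q n1 n2) :
    ∃ Q' : QuivRel, IsGentle Q' ∧ (∀ a : ℕ, ¬ BranchArrow Q' a) ∧
      (∀ O : Finset ℕ, ¬ BranchTriangle Q' O) ∧
      (∀ st' : SigmaTau Q', ∀ ρ : ℕ × ℕ, ¬ FreeRel Q' st' ρ) ∧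
      RefEquiv Q Q' := by
  classical
  exact (toRep st hg hnl N.acyclic).finish N.inv N.i2 ⟨.inr n1⟩

end conc
end GentleQuiv

namespace GentleQuiv
set_option linter.unusedSectionVars false
set_option linter.deprecated false
set_option linter.unusedVariables false

/-- gaps in the same cycle are linked by the first-return map -/
theorem gr_link {X : Type} [Finite X] (π : Equiv.Perm X) (G : X → Prop) {n e : X} (hn : G n) (he : G e)
    (h : π.SameCycle n e) :
    Relation.EqvGen (fun x y => G x ∧ G y ∧ (π ^ gr π G y) y = x) n e := by
  obtain ⟨k, hk⟩ := h.exists_nat_pow_eq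
  clear h
  induction k using Nat.strong_induction_on generalizing n with
  | _ k ih =>
    by_cases c : k < gr π G n
    · rcases Nat.eq_zero_or_pos k with h0 | h0
      · subst h0; simp at hk; subst hk; exact .refl _
      · exact absurd (hk ▸ he) (gr_min π G h0 c)
    · have hm := gr_mem π G hn
      refine .trans _ _ _ (.symm _ _ (.rel _ _ ⟨hm.2, hn, rfl⟩)) (ih (k - gr π G n) (by omega) hm.2 ?_)
      rw [← Equiv.Perm.mul_apply, ← pow_add, ← hk]; congr 2; omega

namespace Pre
/-- permitted walks -/
inductive PW {H : Type} (S : Pre H) (n : H) : List ℕ → H → Prop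
  | nil : PW S n [] n
  | cons {l h a} : PW S n l h → a ∈ S.A → S.so a = S.ι h → PW S n (a :: l) (S.ta a)

theorem rt_iff {H : Type} (S : Pre H) (n h : H) : S.RT n h ↔ ∃ l, S.PW n l h := by
  constructor
  · intro hr
    induction hr with
    | refl => exact ⟨[], .nil⟩
    | tail _ h2 ih =>
      obtain ⟨l, w⟩ := ih
      obtain ⟨a, ha, e1, rfl⟩ := h2
      exact ⟨a :: l, .cons w ha e1⟩
  · rintro ⟨l, w⟩
    induction w with
    | nil => exact .refl
    | cons w ha e ih => exact ih.tail ⟨_, ha, e, rfl⟩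
end Pre

section conc
variable {Q : QuivRel} (st : SigmaTau Q) (hg : IsGentle Q)
  (hnl : ∀ a ∈ Q.A, hso st hg a ≠ hta st hg a)

def thOf (x : ℕ) (s : ℤ) : List ℕ → Thread
  | [] => .triv x s
  | a :: l => .arrows (a :: l)

theorem thOf_ne {x : ℕ} {s : ℤ} {l : List ℕ} (h : l ≠ []) : thOf x s l = .arrows l := by
  cases l with
  | nil => exact absurd rfl h
  | cons => rfl

theorem gl_cons (a b : ℕ) (l : List ℕ) : (a :: b :: l).getLast! = (b :: l).getLast! := by
  simp [List.getLast!]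

theorem aw_list {n h : HH Q} {l : List ℕ} (w : (toPre st hg hnl).AW n l h) (hl : l ≠ []) :
    IsAntiList Q l ∧ hta st hg l.head! = h ∧ hso st hg l.getLast! = n := by
  induction w with
  | nil => exact absurd rfl hl
  | @cons l h a w ha e ih =>
    cases l with
    | nil =>
      cases w
      refine ⟨⟨by simp, by intro c hc; rw [List.mem_singleton.1 hc]; exact ha, List.isChain_singleton _⟩, rfl, ?_⟩
      exact e
    | cons b l =>
      obtain ⟨⟨i1, i2, i3⟩, i4, i5⟩ := ih (by simp)
      refine ⟨⟨by simp, ?_, ?_⟩, rfl, ?_⟩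
      · intro c hc
        rcases List.mem_cons.1 hc with r | r
        · subst r; exact ha
        · exact i2 c r
      · refine List.IsChain.cons_cons ?_ i3
        exact (hrel st hg ha (i2 b (by simp))).2 (Eq.trans e i4.symm)
      · rw [gl_cons]; exact i5

theorem list_aw {l : List ℕ} (h : IsAntiList Q l) :
    (toPre st hg hnl).AW (hso st hg l.getLast!) l (hta st hg l.head!) := by
  obtain ⟨h1, h2, h3⟩ := h
  induction l with
  | nil => exact absurd rfl h1
  | cons a l ih =>
    cases l with
    | nil => exact .cons .nil (h2 a (by simp)) rfl
    | cons b l =>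
      have h3' := List.isChain_cons_cons.1 h3
      have := ih (by simp) (fun c hc => h2 c (List.mem_cons_of_mem _ hc)) h3'.2
      rw [gl_cons]
      exact .cons this (h2 a (by simp)) ((hrel st hg (h2 a (by simp)) (h2 b (by simp))).1 h3'.1)

theorem hso_neg {a : ℕ} (ha : a ∈ Q.A) {h : HH Q} :
    hso st hg a = hι h ↔ Q.src a = h.1.1 ∧ st.σ a = - h.1.2 := by
  rw [Subtype.ext_iff, hso_val st hg ha]
  simp [hι]

theorem hperm {a b : ℕ} (ha : a ∈ Q.A) (hb : b ∈ Q.A) :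
    (Q.src a = Q.tgt b ∧ (a, b) ∉ Q.rel) ↔ hso st hg a = hι (hta st hg b) := by
  rw [hso_neg st hg ha, hta_val st hg hb]
  have s1 := st.σ_pm a ha
  have s2 := st.τ_pm b hb
  constructor
  · rintro ⟨h1, h2⟩
    rw [st.rel_iff a ha b hb h1] at h2
    refine ⟨h1, ?_⟩
    show _ = - st.τ b
    omega
  · rintro ⟨h1, h2⟩
    have h1 : Q.src a = Q.tgt b := h1
    have h2 : st.σ a = - st.τ b := h2
    refine ⟨h1, ?_⟩
    rw [st.rel_iff a ha b hb h1]
    omega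

theorem pw_list {n h : HH Q} {l : List ℕ} (w : (toPre st hg hnl).PW n l h) (hl : l ≠ []) :
    IsPermList Q l ∧ hta st hg l.head! = h ∧ hso st hg l.getLast! = hι n := by
  induction w with
  | nil => exact absurd rfl hl
  | @cons l h a w ha e ih =>
    cases l with
    | nil =>
      cases w
      refine ⟨⟨⟨by simp, by intro c hc; rw [List.mem_singleton.1 hc]; exact ha, List.isChain_singleton _⟩,
        List.isChain_singleton _⟩, rfl, ?_⟩
      exact e
    | cons b l =>
      obtain ⟨⟨⟨i1, i2, i3⟩, i6⟩, i4, i5⟩ := ih (by simp)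
      have hh := (hperm st hg ha (i2 b (by simp))).2
        (Eq.trans e (congrArg hι i4.symm))
      refine ⟨⟨⟨by simp, ?_, ?_⟩, ?_⟩, rfl, ?_⟩
      · intro c hc
        rcases List.mem_cons.1 hc with r | r
        · subst r; exact ha
        · exact i2 c r
      · exact List.IsChain.cons_cons hh.1 i3
      · exact List.IsChain.cons_cons hh.2 i6
      · rw [gl_cons]; exact i5

theorem list_pw {l : List ℕ} (h : IsPermList Q l) :
    (toPre st hg hnl).PW (hι (hso st hg l.getLast!)) l (hta st hg l.head!) := by
  obtain ⟨⟨h1, h2, h3⟩, h4⟩ := h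
  induction l with
  | nil => exact absurd rfl h1
  | cons a l ih =>
    cases l with
    | nil => exact .cons .nil (h2 a (by simp)) (hι_inv _).symm
    | cons b l =>
      have h3' := List.isChain_cons_cons.1 h3
      have h4' := List.isChain_cons_cons.1 h4
      have := ih h4'.2 (by simp) (fun c hc => h2 c (List.mem_cons_of_mem _ hc)) h3'.2
      rw [gl_cons]
      exact .cons this (h2 a (by simp))
        ((hperm st hg (h2 a (by simp)) (h2 b (by simp))).1 ⟨h3'.1, h4'.1⟩)

theorem aw_data {n h : HH Q} {l : List ℕ} (w : (toPre st hg hnl).AW n l h) :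
    IsAntiThread Q (thOf n.1.1 n.1.2 l) ∧
    (thOf n.1.1 n.1.2 l).source Q = n.1.1 ∧ (thOf n.1.1 n.1.2 l).sigma st = n.1.2 ∧
    (thOf n.1.1 n.1.2 l).target Q = h.1.1 ∧ (thOf n.1.1 n.1.2 l).tauAnti st = h.1.2 ∧
    (thOf n.1.1 n.1.2 l).len = l.length := by
  by_cases c : l = []
  · subst c
    cases w
    exact ⟨⟨hh_v n, hh_s n⟩, rfl, rfl, rfl, rfl, rfl⟩
  · rw [thOf_ne c]
    obtain ⟨h1, h2, h3⟩ := aw_list st hg hnl w c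
    have m1 : l.head! ∈ Q.A := by
      apply h1.2.1; cases l with
      | nil => exact absurd rfl c
      | cons a l => simp
    have m2 : l.getLast! ∈ Q.A := by
      apply h1.2.1; cases l with
      | nil => exact absurd rfl c
      | cons a l => simp [List.getLast!]
    have e2 := congrArg Subtype.val h2
    have e3 := congrArg Subtype.val h3
    rw [hta_val st hg m1] at e2
    rw [hso_val st hg m2] at e3
    exact ⟨h1, congrArg Prod.fst e3, congrArg Prod.snd e3, congrArg Prod.fst e2,
      congrArg Prod.snd e2, rfl⟩

theorem pw_data {n h : HH Q} {l : List ℕ} (w : (toPre st hg hnl).PW n l h) :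
    IsPathThread Q (thOf n.1.1 (-n.1.2) l) ∧
    (thOf n.1.1 (-n.1.2) l).source Q = n.1.1 ∧ (thOf n.1.1 (-n.1.2) l).sigma st = -n.1.2 ∧
    (thOf n.1.1 (-n.1.2) l).target Q = h.1.1 ∧ (thOf n.1.1 (-n.1.2) l).tauPath st = h.1.2 := by
  by_cases c : l = []
  · subst c
    cases w
    exact ⟨⟨hh_v n, by rcases hh_s n with e | e <;> simp [e]⟩, rfl, rfl, rfl,
      by simp [thOf, Thread.tauPath]⟩
  · rw [thOf_ne c]
    obtain ⟨h1, h2, h3⟩ := pw_list st hg hnl w c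
    have m1 : l.head! ∈ Q.A := by
      apply h1.1.2.1; cases l with
      | nil => exact absurd rfl c
      | cons a l => simp
    have m2 : l.getLast! ∈ Q.A := by
      apply h1.1.2.1; cases l with
      | nil => exact absurd rfl c
      | cons a l => simp [List.getLast!]
    have e2 := congrArg Subtype.val h2
    have e3 := congrArg Subtype.val h3
    rw [hta_val st hg m1] at e2
    rw [hso_val st hg m2] at e3
    exact ⟨h1, congrArg Prod.fst e3, congrArg Prod.snd e3, congrArg Prod.fst e2,
      congrArg Prod.snd e2⟩

theorem anti_ex {w : Thread} (h : IsAntiThread Q w) :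
    ∃ n l h, (toPre st hg hnl).AW n l h ∧ w = thOf n.1.1 n.1.2 l := by
  cases w with
  | triv x s => exact ⟨mkH x s h.1 h.2, [], _, .nil, rfl⟩
  | arrows l => exact ⟨_, l, _, list_aw st hg hnl h, (thOf_ne h.1).symm⟩

theorem path_ex {w : Thread} (h : IsPathThread Q w) :
    ∃ n l h, (toPre st hg hnl).PW n l h ∧ w = thOf n.1.1 (-n.1.2) l := by
  cases w with
  | triv x s =>
    refine ⟨hι (mkH x s h.1 h.2), [], _, .nil, ?_⟩
    simp [thOf, hι, mkH]
  | arrows l => exact ⟨_, l, _, list_pw st hg hnl h, (thOf_ne h.1.1).symm⟩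

theorem term_iff (h : HH Q) (x : ℕ) (s : ℤ) (hx : x = h.1.1) (hs : s = h.1.2) :
    (¬ ∃ a ∈ Q.A, Q.src a = x ∧ st.σ a = s) ↔ (toPre st hg hnl).Term h := by
  subst hx hs
  constructor
  · intro c a ha e
    have e := congrArg Subtype.val e
    have e : (hso st hg a).1 = h.1 := e
    rw [hso_val st hg ha] at e
    exact c ⟨a, ha, congrArg Prod.fst e, congrArg Prod.snd e⟩
  · rintro t ⟨a, ha, e1, e2⟩
    exact t a ha (Subtype.ext ((hso_val st hg ha).trans (Prod.ext e1 e2)))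

theorem init_iff (h : HH Q) (x : ℕ) (s : ℤ) (hx : x = h.1.1) (hs : s = h.1.2) :
    (¬ ∃ a ∈ Q.A, Q.tgt a = x ∧ st.τ a = s) ↔ (toPre st hg hnl).Initl h := by
  subst hx hs
  constructor
  · intro c a ha e
    have e := congrArg Subtype.val e
    have e : (hta st hg a).1 = h.1 := e
    rw [hta_val st hg ha] at e
    exact c ⟨a, ha, congrArg Prod.fst e, congrArg Prod.snd e⟩
  · rintro t ⟨a, ha, e1, e2⟩
    exact t a ha (Subtype.ext ((hta_val st hg ha).trans (Prod.ext e1 e2)))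

theorem inN_iff {n h : HH Q} {l : List ℕ} (w : (toPre st hg hnl).AW n l h) :
    InN Q st (thOf n.1.1 n.1.2 l) ↔ (toPre st hg hnl).Initl n ∧ (toPre st hg hnl).Term h := by
  obtain ⟨d1, d2, d3, d4, d5, d6⟩ := aw_data st hg hnl w
  unfold InN
  rw [term_iff st hg hnl h _ _ d4 d5, init_iff st hg hnl n _ _ d2 d3]
  exact ⟨fun h => ⟨h.2.2, h.2.1⟩, fun h => ⟨d1, h.2, h.1⟩⟩

theorem inM_iff {n h : HH Q} {l : List ℕ} (w : (toPre st hg hnl).PW n l h) :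
    InM Q st (thOf n.1.1 (-n.1.2) l) ↔
      (toPre st hg hnl).Initl n ∧ (toPre st hg hnl).Term (hι h) := by
  obtain ⟨d1, d2, d3, d4, d5⟩ := pw_data st hg hnl w
  unfold InM
  rw [term_iff st hg hnl (hι h) _ _ d4 (by rw [d5]; rfl), init_iff st hg hnl n _ _ d2 (by rw [d3]; simp)]
  exact ⟨fun h => ⟨h.2.2, h.2.1⟩, fun h => ⟨d1, h.2, h.1⟩⟩

/-- the maximal antipath starting at a gap -/
noncomputable def thr (n : {h : HH Q // (toPre st hg hnl).Initl h}) : Thread :=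
  thOf n.1.1.1 n.1.1.2 (Pre.AW.exists_max (toPre st hg hnl) n.2).choose

theorem thr_spec (n : {h : HH Q // (toPre st hg hnl).Initl h}) :
    ∃ l h, (toPre st hg hnl).AW n.1 l h ∧ (toPre st hg hnl).Term h ∧
      thr st hg hnl n = thOf n.1.1.1 n.1.1.2 l := by
  obtain ⟨h, w, t⟩ := (Pre.AW.exists_max (toPre st hg hnl) n.2).choose_spec
  exact ⟨_, h, w, t, rfl⟩

theorem inN_thr (w : Thread) : InN Q st w ↔ ∃ n, w = thr st hg hnl n := by
  constructor
  · intro hw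
    obtain ⟨n, l, h, a, rfl⟩ := anti_ex st hg hnl hw.1
    obtain ⟨hi, ht⟩ := (inN_iff st hg hnl a).1 hw
    obtain ⟨l', h', a', t', e⟩ := thr_spec st hg hnl ⟨n, hi⟩
    refine ⟨⟨n, hi⟩, ?_⟩
    rw [e, (a.unique_term _ hi a' ht t').1]
  · rintro ⟨n, rfl⟩
    obtain ⟨l', h', a', t', e⟩ := thr_spec st hg hnl n
    rw [e, inN_iff st hg hnl a']
    exact ⟨n.2, t'⟩

theorem thr_inj : Function.Injective (thr st hg hnl) := by
  intro n n' e
  obtain ⟨l, h, w, t, e1⟩ := thr_spec st hg hnl n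
  obtain ⟨l', h', w', t', e2⟩ := thr_spec st hg hnl n'
  have d := aw_data st hg hnl w
  have d' := aw_data st hg hnl w'
  rw [← e1] at d
  rw [← e2, ← e] at d'
  apply Subtype.ext
  apply Subtype.ext
  exact Prod.ext (d.2.1.symm.trans d'.2.1) (d.2.2.1.symm.trans d'.2.2.1)

theorem thr_len (n : {h : HH Q // (toPre st hg hnl).Initl h}) :
    (thr st hg hnl n).len =
      gr (toPre st hg hnl).pi (toPre st hg hnl).Gp (.inr n) - 2 := by
  obtain ⟨l, h, w, t, e1⟩ := thr_spec st hg hnl n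
  obtain ⟨m, hm, hr⟩ := (toPre st hg hnl).exists_start (h := (toPre st hg hnl).ι h)
    (by rw [(toPre st hg hnl).inv]; exact t)
  have h1 := (w.run _ n.2 t hm hr).1
  have h2 := (aw_data st hg hnl w).2.2.2.2.2
  rw [← e1] at h2
  have h1 : gr (toPre st hg hnl).pi (toPre st hg hnl).Gp (.inr n) = l.length + 2 := h1
  omega

theorem phi_iff (n n' : {h : HH Q // (toPre st hg hnl).Initl h}) :
    PhiRel Q st (thr st hg hnl n) (thr st hg hnl n') ↔
      ((toPre st hg hnl).pi ^ gr (toPre st hg hnl).pi (toPre st hg hnl).Gp (.inr n'))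
        (.inr n') = .inr n := by
  obtain ⟨l, h, w, t, e⟩ := thr_spec st hg hnl n
  obtain ⟨l', h', w', t', e'⟩ := thr_spec st hg hnl n'
  have d := aw_data st hg hnl w
  have d' := aw_data st hg hnl w'
  rw [← e] at d
  rw [← e'] at d'
  obtain ⟨m, hm, hr⟩ := (toPre st hg hnl).exists_start (h := (toPre st hg hnl).ι h')
    (by rw [(toPre st hg hnl).inv]; exact t')
  have run := w'.run _ n'.2 t' hm hr
  have e1 : ((toPre st hg hnl).pi ^ gr (toPre st hg hnl).pi (toPre st hg hnl).Gp (.inr n'))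
        (.inr n') = .inr ⟨m, hm⟩ := by
    have := run.1
    have : gr (toPre st hg hnl).pi (toPre st hg hnl).Gp (.inr n') = l'.length + 2 := this
    rw [this]; exact run.2
  rw [e1]
  constructor
  · rintro ⟨_, _, μ, hμ, s1, s2, s3, s4⟩
    obtain ⟨x, k, y, pw, rfl⟩ := path_ex st hg hnl hμ.1
    obtain ⟨hi, ht⟩ := (inM_iff st hg hnl pw).1 hμ
    have dd := pw_data st hg hnl pw
    have ex : x = n.1 := by
      apply Subtype.ext
      refine Prod.ext ?_ ?_
      · rw [← dd.2.1, s1, d.2.1]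
      · have := dd.2.2.1.symm.trans s2
        rw [d.2.2.1] at this
        exact neg_injective this
    have ey : y = hι h' := by
      apply Subtype.ext
      refine Prod.ext ?_ ?_
      · show y.1.1 = h'.1.1
        rw [← dd.2.2.2.1, ← s3, d'.2.2.2.1]
      · show y.1.2 = - h'.1.2
        rw [← dd.2.2.2.2, ← d'.2.2.2.2.1, s4]; simp
    subst ex ey
    have := (toPre st hg hnl).start_unique hi hm (((toPre st hg hnl).rt_iff _ _).2 ⟨k, pw⟩) hr
    congr 1
    exact Subtype.ext this.symm
  · intro hh
    have hh : (⟨m, hm⟩ : {h : HH Q // (toPre st hg hnl).Initl h}) = n := Sum.inr.inj hh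
    subst hh
    obtain ⟨k, pw⟩ := ((toPre st hg hnl).rt_iff _ _).1 hr
    have dd := pw_data st hg hnl pw
    refine ⟨(inN_thr st hg hnl _).2 ⟨_, rfl⟩, (inN_thr st hg hnl _).2 ⟨_, rfl⟩, _,
      (inM_iff st hg hnl pw).2 ⟨hm, ?_⟩, ?_, ?_, ?_, ?_⟩
    · have : hι ((toPre st hg hnl).ι h') = h' := hι_inv h'
      rw [this]; exact t'
    · rw [dd.2.1, d.2.1]
    · rw [dd.2.2.1, d.2.2.1]
    · rw [dd.2.2.2.1, d'.2.2.2.1]; rfl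
    · rw [dd.2.2.2.2, d'.2.2.2.2.1]
      show _ = - - h'.1.2
      simp

theorem phi_eqv (n : {h : HH Q // (toPre st hg hnl).Initl h}) (w : Thread) :
    Relation.EqvGen (PhiRel Q st) (thr st hg hnl n) w ↔
      ∃ n', w = thr st hg hnl n' ∧ (toPre st hg hnl).pi.SameCycle (.inr n) (.inr n') := by
  constructor
  · intro h
    have key : ∀ w w', Relation.EqvGen (PhiRel Q st) w w' → w = w' ∨ ∃ n n', w = thr st hg hnl n ∧
        w' = thr st hg hnl n' ∧ (toPre st hg hnl).pi.SameCycle (.inr n) (.inr n') := by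
      intro w w' h
      induction h with
      | refl => exact Or.inl rfl
      | rel x y h =>
        obtain ⟨n, rfl⟩ := (inN_thr st hg hnl _).1 h.1
        obtain ⟨n', rfl⟩ := (inN_thr st hg hnl _).1 h.2.1
        refine Or.inr ⟨n, n', rfl, rfl, ?_⟩
        rw [phi_iff] at h
        exact Equiv.Perm.SameCycle.symm ⟨(gr (toPre st hg hnl).pi (toPre st hg hnl).Gp (.inr n') : ℕ),
          by rw [zpow_natCast]; exact h⟩
      | symm x y _ ih =>
        rcases ih with rfl | ⟨n, n', e1, e2, e3⟩
        · exact Or.inl rfl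
        · exact Or.inr ⟨n', n, e2, e1, e3.symm⟩
      | trans x y z _ _ ih1 ih2 =>
        rcases ih1 with rfl | ⟨n, n', e1, e2, e3⟩
        · exact ih2
        · rcases ih2 with rfl | ⟨k, k', f1, f2, f3⟩
          · exact Or.inr ⟨n, n', e1, e2, e3⟩
          · have := thr_inj st hg hnl (e2.symm.trans f1)
            subst this
            exact Or.inr ⟨n, k', e1, f2, e3.trans f3⟩
    rcases key _ _ h with e | ⟨k, k', e1, e2, e3⟩
    · exact ⟨n, e.symm, .refl _ _⟩
    · have := thr_inj st hg hnl e1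
      subst this
      exact ⟨k', e2, e3⟩
  · rintro ⟨n', rfl, hs⟩
    have link := gr_link (toPre st hg hnl).pi (toPre st hg hnl).Gp
      ((toPre st hg hnl).gp_inr n) ((toPre st hg hnl).gp_inr n') hs
    have key : ∀ x y, Relation.EqvGen (fun x y => (toPre st hg hnl).Gp x ∧ (toPre st hg hnl).Gp y ∧
        ((toPre st hg hnl).pi ^ gr (toPre st hg hnl).pi (toPre st hg hnl).Gp y) y = x) x y →
        x = y ∨ ∃ n n', x = .inr n ∧ y = .inr n' ∧
          Relation.EqvGen (PhiRel Q st) (thr st hg hnl n) (thr st hg hnl n') := by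
      intro x y h
      induction h with
      | refl => exact Or.inl rfl
      | rel x y h =>
        obtain ⟨h1, h2, h3⟩ := h
        obtain ⟨n, rfl⟩ := ((toPre st hg hnl).io_gap x).1 h1
        obtain ⟨n', rfl⟩ := ((toPre st hg hnl).io_gap y).1 h2
        exact Or.inr ⟨n, n', rfl, rfl, .rel _ _ ((phi_iff st hg hnl n n').2 h3)⟩
      | symm x y _ ih =>
        rcases ih with rfl | ⟨n, n', e1, e2, e3⟩
        · exact Or.inl rfl
        · exact Or.inr ⟨n', n, e2, e1, e3.symm⟩
      | trans x y z _ _ ih1 ih2 =>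
        rcases ih1 with rfl | ⟨n, n', e1, e2, e3⟩
        · exact ih2
        · rcases ih2 with rfl | ⟨k, k', f1, f2, f3⟩
          · exact Or.inr ⟨n, n', e1, e2, e3⟩
          · have := Sum.inr.inj (e2.symm.trans f1)
            subst this
            exact Or.inr ⟨n, k', e1, f2, .trans _ _ _ e3 f3⟩
    rcases key _ _ link with e | ⟨k, k', e1, e2, e3⟩
    · have := Sum.inr.inj e
      subst this; exact .refl _
    · rw [Sum.inr.inj e1, Sum.inr.inj e2]; exact e3

theorem nOrbit_iff (O : Set Thread) : NOrbit Q st O ↔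
    ∃ n, O = thr st hg hnl '' {n' | (toPre st hg hnl).pi.SameCycle (.inr n) (.inr n')} := by
  have key : ∀ n, {w' | Relation.EqvGen (PhiRel Q st) (thr st hg hnl n) w'} =
      thr st hg hnl '' {n' | (toPre st hg hnl).pi.SameCycle (.inr n) (.inr n')} := by
    intro n
    ext w
    simp only [Set.mem_setOf_eq, Set.mem_image, phi_eqv st hg hnl]
    constructor
    · rintro ⟨n', rfl, h⟩; exact ⟨n', h, rfl⟩
    · rintro ⟨n', h, rfl⟩; exact ⟨n', rfl, h⟩
  constructor
  · rintro ⟨w, hw, rfl⟩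
    obtain ⟨n, rfl⟩ := (inN_thr st hg hnl w).1 hw
    exact ⟨n, key n⟩
  · rintro ⟨n, rfl⟩
    exact ⟨_, (inN_thr st hg hnl _).2 ⟨n, rfl⟩, (key n).symm⟩

theorem inC_iff (a : ℕ) : InC Q st a ↔ a ∈ Q.A ∧ (toPre st hg hnl).Gl (.inl (hta st hg a)) := by
  unfold InC
  refine and_congr_right fun ha => ?_
  rw [not_iff_comm]
  have := (toPre st hg hnl).on_walk ha
  refine Iff.trans this ?_
  constructor
  · rintro ⟨n, l, h, hi, w, t, hm⟩
    refine ⟨l, ?_, hm⟩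
    rw [← thOf_ne (x := n.1.1) (s := n.1.2) (by rintro rfl; simp at hm)]
    exact (inN_iff st hg hnl w).2 ⟨hi, t⟩
  · rintro ⟨l, hl, hm⟩
    have w := list_aw st hg hnl hl.1
    rw [← thOf_ne (x := (hso st hg l.getLast!).1.1) (s := (hso st hg l.getLast!).1.2) hl.1.1,
      inN_iff st hg hnl w] at hl
    exact ⟨_, l, _, hl.1, w, hl.2, hm⟩

theorem gl_same {H : Type} [Fintype H] [DecidableEq H] (S : Pre H) {e f : S.XX} (h : S.Gl e)
    (hs : S.pi.SameCycle e f) : S.Gl f := fun n hn h' => h n hn (h'.trans hs.symm)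

theorem psi_eqv {a : ℕ} (ha : InC Q st a) (b : ℕ) :
    Relation.EqvGen (PsiRel Q st) a b ↔
      b ∈ Q.A ∧ (toPre st hg hnl).pi.SameCycle (.inl (hta st hg a)) (.inl (hta st hg b)) := by
  constructor
  · intro h
    have key : ∀ x y, Relation.EqvGen (PsiRel Q st) x y → x = y ∨ (x ∈ Q.A ∧ y ∈ Q.A ∧
        (toPre st hg hnl).pi.SameCycle (.inl (hta st hg x)) (.inl (hta st hg y))) := by
      intro x y h
      induction h with
      | refl => exact Or.inl rfl
      | rel x y h =>
        obtain ⟨h1, h2, h3, h4⟩ := h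
        refine Or.inr ⟨h1.1, h2.1, ?_⟩
        have e : hso st hg x = hta st hg y := Subtype.ext
          ((hso_val st hg h1.1).trans ((Prod.ext h3.symm h4.symm).trans (hta_val st hg h2.1).symm))
        have := (toPre st hg hnl).pi_arr h1.1
        have : (toPre st hg hnl).pi (.inl (hso st hg x)) = .inl (hta st hg x) := this
        rw [e] at this
        exact Equiv.Perm.SameCycle.symm ⟨1, by rw [zpow_one]; exact this⟩
      | symm x y _ ih =>
        rcases ih with rfl | ⟨e1, e2, e3⟩
        · exact Or.inl rfl
        · exact Or.inr ⟨e2, e1, e3.symm⟩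
      | trans x y z _ _ ih1 ih2 =>
        rcases ih1 with rfl | ⟨e1, e2, e3⟩
        · exact ih2
        · rcases ih2 with rfl | ⟨f1, f2, f3⟩
          · exact Or.inr ⟨e1, e2, e3⟩
          · exact Or.inr ⟨e1, f2, e3.trans f3⟩
    rcases key _ _ h with e | e
    · subst e; exact ⟨ha.1, .refl _ _⟩
    · exact e.2
  · rintro ⟨hb, hs⟩
    obtain ⟨k, hk⟩ := hs.exists_nat_pow_eq
    have key : ∀ k : ℕ, ∃ b, InC Q st b ∧ ((toPre st hg hnl).pi ^ k) (.inl (hta st hg a)) =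
        .inl (hta st hg b) ∧ Relation.EqvGen (PsiRel Q st) a b := by
      intro k
      induction k with
      | zero => exact ⟨a, ha, rfl, .refl _⟩
      | succ k ih =>
        obtain ⟨b, hb, e, hE⟩ := ih
        have hgl := ((inC_iff st hg hnl b).1 hb).2
        rcases (toPre st hg hnl).cases_half (hta st hg b) with ⟨c, hc, e1⟩ | ⟨t, n, hn, hr⟩
        · have e2 : (toPre st hg hnl).pi (.inl (hta st hg b)) = .inl (hta st hg c) := by
            rw [← e1]; exact (toPre st hg hnl).pi_arr hc
          have hC : InC Q st c := (inC_iff st hg hnl c).2 ⟨hc, gl_same _ hgl ⟨1, by rw [zpow_one, e2]⟩⟩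
          have e1 : hso st hg c = hta st hg b := e1
          have e1 := congrArg Subtype.val e1
          rw [hso_val st hg hc, hta_val st hg hb.1] at e1
          refine ⟨c, hC, by rw [pow_succ', Equiv.Perm.mul_apply, e, e2], .trans _ _ _ hE
            (.symm _ _ (.rel _ _ ⟨hC, hb, (congrArg Prod.fst e1).symm, (congrArg Prod.snd e1).symm⟩))⟩
        · exfalso
          have e2 := (toPre st hg hnl).pi_term hn t hr
          exact hgl _ ((toPre st hg hnl).gp_inr ⟨n, hn⟩)
            (Equiv.Perm.SameCycle.symm ⟨1, by rw [zpow_one, e2]⟩)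
    obtain ⟨c, hc, e, hE⟩ := key k
    rw [hk] at e
    rw [hta_inj st hg hb hc.1 (Sum.inl.inj e)]
    exact hE

/-- arrows in a gapless class -/
def cSet (j : (toPre st hg hnl).JJ) : Set ℕ :=
  {b | b ∈ Q.A ∧ (toPre st hg hnl).jj (.inl (hta st hg b)) = j}

theorem gl_arr {e : (toPre st hg hnl).XX} (h : (toPre st hg hnl).Gl e) :
    ∃ a ∈ Q.A, e = .inl (hta st hg a) := by
  have he : e = (toPre st hg hnl).pi ((toPre st hg hnl).pi.symm e) := by simp
  have h' : (toPre st hg hnl).Gl ((toPre st hg hnl).pi.symm e) := gl_same _ h ⟨-1, by simp⟩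
  generalize (toPre st hg hnl).pi.symm e = f at *
  rcases f with x | n
  · rcases (toPre st hg hnl).cases_half x with ⟨a, ha, rfl⟩ | ⟨t, n, hn, hr⟩
    · exact ⟨a, ha, by rw [he, (toPre st hg hnl).pi_arr ha]; rfl⟩
    · rw [(toPre st hg hnl).pi_term hn t hr] at he
      rw [he] at h
      exact absurd (.refl _ _) (h _ ((toPre st hg hnl).gp_inr _))
  · exact absurd (.refl _ _) (h' _ ((toPre st hg hnl).gp_inr _))

theorem cOrbit_iff (O : Set ℕ) : COrbit Q st O ↔
    ∃ e, (toPre st hg hnl).Gl e ∧ O = cSet st hg hnl ((toPre st hg hnl).jj e) := by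
  have key : ∀ a, InC Q st a → {b | Relation.EqvGen (PsiRel Q st) a b} =
      cSet st hg hnl ((toPre st hg hnl).jj (.inl (hta st hg a))) := by
    intro a ha
    ext b
    simp only [Set.mem_setOf_eq, cSet, psi_eqv st hg hnl ha, Pre.jj_eq]
    exact and_congr_right fun _ => Equiv.Perm.sameCycle_comm
  constructor
  · rintro ⟨a, ha, rfl⟩
    exact ⟨_, ((inC_iff st hg hnl a).1 ha).2, key a ha⟩
  · rintro ⟨e, he, rfl⟩
    obtain ⟨a, ha, rfl⟩ := gl_arr st hg hnl he
    have hc := (inC_iff st hg hnl a).2 ⟨ha, he⟩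
    exact ⟨a, hc, (key a hc).symm⟩

end conc
end GentleQuiv

namespace GentleQuiv
set_option linter.unusedSectionVars false
set_option linter.deprecated false
set_option linter.unusedVariables false

section fin
variable {Q : QuivRel} (st : SigmaTau Q)

theorem psi_mem {x y : ℕ} (h : Relation.EqvGen (PsiRel Q st) x y) : x = y ∨ (x ∈ Q.A ∧ y ∈ Q.A) := by
  induction h with
  | refl => exact Or.inl rfl
  | rel x y h => exact Or.inr ⟨h.1.1, h.2.1.1⟩
  | symm x y _ ih => rcases ih with rfl | h; exacts [Or.inl rfl, Or.inr h.symm]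
  | trans x y z _ _ i1 i2 =>
    rcases i1 with rfl | h
    · exact i2
    · rcases i2 with rfl | h'
      · exact Or.inr h
      · exact Or.inr ⟨h.1, h'.2⟩

theorem cOrbit_sub {O : Set ℕ} (h : COrbit Q st O) : O ⊆ ↑Q.A := by
  obtain ⟨a, ha, rfl⟩ := h
  intro b hb
  rcases psi_mem st hb with rfl | h
  · exact ha.1
  · exact h.2

theorem cOrbit_fin : {O : Set ℕ | COrbit Q st O}.Finite :=
  (Q.A.finite_toSet.powerset).subset fun O h => cOrbit_sub st h

theorem nl_of (hg : IsGentle Q)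
    (h1 : {O : Set ℕ | COrbit Q st O ∧ O.ncard = 1} = ∅) :
    ∀ a ∈ Q.A, hso st hg a ≠ hta st hg a := by
  intro a ha e
  have hC : InC Q st a := by
    refine ⟨ha, ?_⟩
    rintro ⟨l, ⟨⟨h2, h3, h4⟩, _, h5⟩, hm⟩
    have key : ∀ l : List ℕ, (∀ b ∈ l, b ∈ Q.A) → l.Chain' (fun a b => (a, b) ∈ Q.rel) → a ∈ l →
        l.getLast! = a := by
      intro l
      induction l with
      | nil => intro _ _ h; simp at h
      | cons b l ih =>
        intro i1 i2 i3
        cases l with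
        | nil => simp at i3; subst i3; rfl
        | cons c l =>
          have i2' := List.isChain_cons_cons.1 i2
          rw [gl_cons]
          refine ih (fun x hx => i1 x (List.mem_cons_of_mem _ hx)) i2'.2 ?_
          rcases List.mem_cons.1 i3 with r | r
          · subst r
            have hc := i1 c (by simp)
            have := (hrel st hg ha hc).1 i2'.1
            rw [hta_inj st hg ha hc (e.symm.trans this)]
            simp
          · exact r
    have := key l h3 h4 hm
    refine h5 ⟨a, ha, ?_⟩
    have e := congrArg Subtype.val e
    rw [hso_val st hg ha, hta_val st hg ha] at e
    show _ = Q.src l.getLast! ∧ _ = st.σ l.getLast!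
    rw [this]
    exact ⟨(congrArg Prod.fst e).symm, (congrArg Prod.snd e).symm⟩
  have hO : ∀ x y, Relation.EqvGen (PsiRel Q st) x y → (x = a ↔ y = a) := by
    intro x y h
    induction h with
    | refl => rfl
    | rel x y h =>
      obtain ⟨⟨h1, _⟩, ⟨h2, _⟩, h3, h4⟩ := h
      have r : hso st hg x = hta st hg y := Subtype.ext
        ((hso_val st hg h1).trans ((Prod.ext h3.symm h4.symm).trans (hta_val st hg h2).symm))
      constructor
      · rintro rfl; exact (hta_inj st hg h1 h2 (e.symm.trans r)).symm
      · rintro rfl; exact hso_inj st hg h1 h2 (r.trans e.symm)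
    | symm x y _ ih => exact ih.symm
    | trans x y z _ _ i1 i2 => exact i1.trans i2
  have : {b | Relation.EqvGen (PsiRel Q st) a b} ∈ {O : Set ℕ | COrbit Q st O ∧ O.ncard = 1} := by
    refine ⟨⟨a, hC, rfl⟩, ?_⟩
    have : {b | Relation.EqvGen (PsiRel Q st) a b} = {a} := by
      ext b
      simp only [Set.mem_setOf_eq, Set.mem_singleton_iff]
      constructor
      · intro h; exact (hO _ _ h).1 rfl
      · rintro rfl; exact .refl _
    rw [this, Set.ncard_singleton]
  rw [h1] at this
  exact this

/-- two-element families from counts -/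
theorem two_of_count {α : Type} {T : Set α} (hT : T.Finite) (D : α → ℕ × ℕ) (u v : ℕ × ℕ)
    (h : ∀ x, {t | t ∈ T ∧ D t = x}.ncard = (if x = u then 1 else 0) + (if x = v then 1 else 0)) :
    ∃ t1 t2, t1 ∈ T ∧ t2 ∈ T ∧ t1 ≠ t2 ∧ D t1 = u ∧ D t2 = v ∧ ∀ t ∈ T, t = t1 ∨ t = t2 := by
  have fin : ∀ x, {t | t ∈ T ∧ D t = x}.Finite := fun x => hT.subset fun t ht => ht.1
  have cov : ∀ t ∈ T, D t = u ∨ D t = v := by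
    intro t ht
    by_contra hc
    push Not at hc
    have := h (D t)
    rw [if_neg hc.1, if_neg hc.2, Set.ncard_eq_zero (fin _)] at this
    have h2 : t ∈ {t' | t' ∈ T ∧ D t' = D t} := ⟨ht, rfl⟩
    rw [this] at h2
    exact h2
  by_cases c : u = v
  · subst c
    have := h u
    rw [if_pos rfl] at this
    obtain ⟨t1, t2, hne, e⟩ := Set.ncard_eq_two.1 this
    have m1 : t1 ∈ {t | t ∈ T ∧ D t = u} := by rw [e]; simp
    have m2 : t2 ∈ {t | t ∈ T ∧ D t = u} := by rw [e]; simp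
    refine ⟨t1, t2, m1.1, m2.1, hne, m1.2, m2.2, ?_⟩
    intro t ht
    have : t ∈ {t | t ∈ T ∧ D t = u} := ⟨ht, by rcases cov t ht with h | h <;> exact h⟩
    rw [e] at this
    simpa using this
  · have hu := h u
    have hv := h v
    rw [if_pos rfl, if_neg c] at hu
    rw [if_pos rfl, if_neg (Ne.symm c)] at hv
    obtain ⟨t1, e1⟩ := Set.ncard_eq_one.1 hu
    obtain ⟨t2, e2⟩ := Set.ncard_eq_one.1 (show _ = 1 by simpa using hv)
    have m1 : t1 ∈ {t | t ∈ T ∧ D t = u} := by rw [e1]; simp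
    have m2 : t2 ∈ {t | t ∈ T ∧ D t = v} := by rw [e2]; simp
    refine ⟨t1, t2, m1.1, m2.1, ?_, m1.2, m2.2, ?_⟩
    · rintro rfl; exact c (m1.2.symm.trans m2.2)
    · intro t ht
      rcases cov t ht with r | r
      · left
        have : t ∈ {t | t ∈ T ∧ D t = u} := ⟨ht, r⟩
        rw [e1] at this; exact this
      · right
        have : t ∈ {t | t ∈ T ∧ D t = v} := ⟨ht, r⟩
        rw [e2] at this; exact this

theorem fInv_zero_le (k : ℕ) (hN : ∀ O, NOrbit Q st O → pN O ≠ 0) :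
    fInv Q st (0, k) = {O : Set ℕ | COrbit Q st O ∧ O.ncard = k}.ncard := by
  unfold fInv
  have : {O : Set Thread | NOrbit Q st O ∧ pN O = (0, k).1 ∧ qN O = (0, k).2} = ∅ := by
    ext O
    simp only [Set.mem_setOf_eq, Set.mem_empty_iff_false, iff_false]
    rintro ⟨h1, h2, _⟩
    exact hN O h1 h2
  rw [this, Set.ncard_empty, zero_add]
  simp

theorem main (hA : ClassAtilde Q st) :
    ∃ Q' : QuivRel, IsGentle Q' ∧ (∀ a : ℕ, ¬ BranchArrow Q' a) ∧
      (∀ O : Finset ℕ, ¬ BranchTriangle Q' O) ∧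
      (∀ st' : SigmaTau Q', ∀ ρ : ℕ × ℕ, ¬ FreeRel Q' st' ρ) ∧
      RefEquiv Q Q' := by
  obtain ⟨hg, m1, m2, p, q, hp, hq, hf⟩ := hA
  have ch1 : ∀ k, charFn (p + m1) p (0, k) = 0 := by
    intro k; unfold charFn; rw [if_neg]; rw [Prod.mk.injEq]; omega
  have ch2 : ∀ k, charFn (q + m2) q (0, k) = 0 := by
    intro k; unfold charFn; rw [if_neg]; rw [Prod.mk.injEq]; omega
  have hnl : ∀ a ∈ Q.A, hso st hg a ≠ hta st hg a := by
    apply nl_of st hg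
    have := hf (0, 1)
    rw [ch1, ch2] at this
    have h3 : charFn 0 3 (0, 1) = 0 := by simp [charFn]
    rw [h3] at this
    unfold fInv at this
    have h4 : {O : Set ℕ | COrbit Q st O ∧ (0, 1).1 = 0 ∧ O.ncard = (0, 1).2}.ncard = 0 := by omega
    rw [Set.ncard_eq_zero ((cOrbit_fin st).subset fun O h => h.1)] at h4
    simpa using h4
  -- orbit data
  have nfin : {O : Set Thread | NOrbit Q st O}.Finite := by
    refine (Set.finite_range fun n => thr st hg hnl ''
      {n' | (toPre st hg hnl).pi.SameCycle (.inr n) (.inr n')}).subset ?_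
    intro O hO
    obtain ⟨n, rfl⟩ := (nOrbit_iff st hg hnl O).1 hO
    exact ⟨n, rfl⟩
  have pNe : ∀ n, pN (thr st hg hnl '' {n' | (toPre st hg hnl).pi.SameCycle (.inr n) (.inr n')}) =
      {n' | (toPre st hg hnl).pi.SameCycle (.inr n) (.inr n')}.ncard := fun n =>
    Set.ncard_image_of_injective _ (thr_inj st hg hnl)
  have qNe : ∀ n, qN (thr st hg hnl '' {n' | (toPre st hg hnl).pi.SameCycle (.inr n) (.inr n')}) =
      ∑ᶠ n' ∈ {n' | (toPre st hg hnl).pi.SameCycle (.inr n) (.inr n')},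
        (gr (toPre st hg hnl).pi (toPre st hg hnl).Gp (.inr n') - 2) := by
    intro n
    unfold qN
    rw [finsum_mem_image ((thr_inj st hg hnl).injOn)]
    simp only [thr_len]
  have pN0 : ∀ O, NOrbit Q st O → pN O ≠ 0 := by
    intro O hO
    obtain ⟨n, rfl⟩ := (nOrbit_iff st hg hnl O).1 hO
    rw [pNe, Ne, Set.ncard_eq_zero]
    intro h
    have : n ∈ {n' | (toPre st hg hnl).pi.SameCycle (.inr n) (.inr n')} := .refl _ _
    rw [h] at this
    exact this
  have fC : ∀ k, {O : Set ℕ | COrbit Q st O ∧ O.ncard = k}.ncard = (m1 + m2) * charFn 0 3 (0, k) := by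
    intro k
    rw [← fInv_zero_le st k pN0, hf, ch1, ch2]; rfl
  have C3 : ∀ O, COrbit Q st O → O.ncard = 3 := by
    intro O hO
    by_contra hc
    have := fC O.ncard
    have h3 : charFn 0 3 (0, O.ncard) = 0 := by
      unfold charFn; rw [if_neg]; rw [Prod.mk.injEq]; exact fun h => hc h.2
    rw [h3, mul_zero, Set.ncard_eq_zero ((cOrbit_fin st).subset fun O h => h.1)] at this
    have h2 : O ∈ {O' : Set ℕ | COrbit Q st O' ∧ O'.ncard = O.ncard} := ⟨hO, rfl⟩
    rw [this] at h2
    exact h2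
  have Cm : {O : Set ℕ | COrbit Q st O}.ncard = m1 + m2 := by
    have := fC 3
    have h3 : charFn 0 3 (0, 3) = 1 := by simp [charFn]
    rw [h3, mul_one] at this
    rw [← this]
    congr 1
    ext O
    exact ⟨fun h => ⟨h, C3 O h⟩, fun h => h.1⟩
  obtain ⟨O1, O2, hO1, hO2, hne, D1, D2, cov⟩ := two_of_count nfin (fun O => (pN O, qN O))
    (p + m1, p) (q + m2, q) (by
      rintro ⟨x, y⟩
      have e1 : {t | t ∈ {O | NOrbit Q st O} ∧ (fun O => (pN O, qN O)) t = (x, y)} =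
          {O : Set Thread | NOrbit Q st O ∧ pN O = (x, y).1 ∧ qN O = (x, y).2} := by
        ext O; simp
      rw [e1]
      by_cases hx : x = 0
      · subst hx
        have e2 : {O : Set Thread | NOrbit Q st O ∧ pN O = (0, y).1 ∧ qN O = (0, y).2} = ∅ := by
          ext O
          simp only [Set.mem_setOf_eq, Set.mem_empty_iff_false, iff_false]
          rintro ⟨h1, h2, _⟩
          exact pN0 O h1 h2
        rw [e2, Set.ncard_empty]
        have a1 := ch1 y
        have a2 := ch2 y
        unfold charFn at a1 a2
        rw [a1, a2]
      · have := hf (x, y)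
        unfold fInv at this
        have e2 : {O : Set ℕ | COrbit Q st O ∧ (x, y).1 = 0 ∧ O.ncard = (x, y).2} = ∅ := by
          ext O
          simp [hx]
        have e3 : charFn 0 3 (x, y) = 0 := by
          unfold charFn; rw [if_neg]; rw [Prod.mk.injEq]; exact fun h => hx h.1
        rw [e2, Set.ncard_empty, e3] at this
        simpa [charFn] using this)
  obtain ⟨n1, rfl⟩ := (nOrbit_iff st hg hnl O1).1 hO1
  obtain ⟨n2, rfl⟩ := (nOrbit_iff st hg hnl O2).1 hO2
  have d1 := Prod.mk.inj D1
  have d2 := Prod.mk.inj D2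
  rw [pNe, qNe] at d1 d2
  have same_of : ∀ n n', thr st hg hnl '' {k | (toPre st hg hnl).pi.SameCycle (.inr n') (.inr k)} =
      thr st hg hnl '' {k | (toPre st hg hnl).pi.SameCycle (.inr n) (.inr k)} →
      (toPre st hg hnl).pi.SameCycle (.inr n) (.inr n') := by
    intro n n' h
    have h := Set.image_injective.2 (thr_inj st hg hnl) h
    have : n' ∈ {k | (toPre st hg hnl).pi.SameCycle (.inr n') (.inr k)} := .refl _ _
    rw [h] at this
    exact this
  have N : (toPre st hg hnl).Num m1 m2 p q n1 n2 := by
    constructor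
    · intro e he
      have h3 := C3 _ ((cOrbit_iff st hg hnl _).2 ⟨e, he, rfl⟩)
      have : {e' | (toPre st hg hnl).pi.SameCycle e e'} =
          (fun b => (.inl (hta st hg b) : (toPre st hg hnl).XX)) ''
            cSet st hg hnl ((toPre st hg hnl).jj e) := by
        ext f
        simp only [Set.mem_setOf_eq, Set.mem_image, cSet, Pre.jj_eq]
        constructor
        · intro hs
          obtain ⟨a, ha, rfl⟩ := gl_arr st hg hnl (gl_same _ he hs)
          exact ⟨a, ⟨ha, hs.symm⟩, rfl⟩
        · rintro ⟨a, ⟨ha, hs⟩, rfl⟩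
          exact hs.symm
      rw [this, Set.ncard_image_of_injOn, h3]
      intro a ha b hb e
      exact hta_inj st hg ha.1 hb.1 (Sum.inl.inj e)
    · rw [← Cm]
      have : {O : Set ℕ | COrbit Q st O} = cSet st hg hnl ''
          {j | ∃ e, (toPre st hg hnl).Gl e ∧ (toPre st hg hnl).jj e = j} := by
        ext O
        simp only [Set.mem_setOf_eq, Set.mem_image, cOrbit_iff st hg hnl]
        constructor
        · rintro ⟨e, he, rfl⟩; exact ⟨_, ⟨e, he, rfl⟩, rfl⟩
        · rintro ⟨_, ⟨e, he, rfl⟩, rfl⟩; exact ⟨e, he, rfl⟩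
      rw [this, Set.ncard_image_of_injOn]
      rintro _ ⟨e, he, rfl⟩ _ ⟨f, hf, rfl⟩ h
      obtain ⟨a, ha, rfl⟩ := gl_arr st hg hnl he
      have : a ∈ cSet st hg hnl ((toPre st hg hnl).jj (.inl (hta st hg a))) := ⟨ha, rfl⟩
      rw [h] at this
      exact this.2
    · intro h
      apply hne
      congr 1
      ext k
      exact ⟨fun h' => h.symm.trans h', fun h' => h.trans h'⟩
    · intro n
      rcases cov _ ((nOrbit_iff st hg hnl _).2 ⟨n, rfl⟩) with h | h
      · exact Or.inl (same_of _ _ h)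
      · exact Or.inr (same_of _ _ h)
    · exact d1.1
    · exact d2.1
    · exact d1.2
    · exact d2.2
  exact finish_of_num st hg hnl N

end fin
end GentleQuiv

namespace GentleQuiv

/-- Every `𝚫 ∈ Ã` is reflection-equivalent to a gentle
quiver without branch arrows, without branch triangles and without free
relations. -/
theorem stmt15 (Q : QuivRel) (st : SigmaTau Q) (hA : ClassAtilde Q st) :
    ∃ Q' : QuivRel, IsGentle Q' ∧ (∀ a : ℕ, ¬ BranchArrow Q' a) ∧
      (∀ O : Finset ℕ, ¬ BranchTriangle Q' O) ∧
      (∀ st' : SigmaTau Q', ∀ ρ : ℕ × ℕ, ¬ FreeRel Q' st' ρ) ∧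
      RefEquiv Q Q' := by
  exact main st hA

end GentleQuiv
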